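/- arXiv:math/0207170 — 3 statements merged into one kernel-verified Lean document; each statement's English description precedes it below -/
import Mathlib

section
/- Let f : Y → X be a projective morphism between noetherian schemes with fibers of dimension at most n, with X affine. Let L be an f-ample line bundle on Y generated by global sections and a ∈ ℤ. If M ∈ D^b(coh Y) satisfies Ext^i_Y(L^{⊗(a+j)}, M) = 0 for all i ∈ ℤ and all 0 ≤ j ≤ n, then M = 0. -/
/-!
The situation `f : Y → X` (`X` affine noetherian, `f` projective with fibers of dimension
`≤ n`) is formalized through the abelian monoidal category `C = coh(Y)` with unit
`𝟙_ C = O_Y`.  Cohomology over the affine base is `H^i(Y, T) = Ext^i(O_Y, T)`, so the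
fiber-dimension bound is the vanishing `H^i = 0` for `i > n`.  The line bundle `L` is
encoded by its family of tensor powers `L : ℤ → C`; `f`-ampleness of `L` (over an affine
base) is encoded by the Serre criterion: every `T` becomes globally generated after
twisting by a large power of `L`.  The object `M` of `D^b(coh Y)` is a cochain complex
with bounded homology, and `M = 0` means that `M` vanishes in the derived category. -/

open CategoryTheory CategoryTheory.Limits CategoryTheory.Abelian MonoidalCategory

universe w' w v u

/-- `T` is generated by (finitely many) global sections. -/
def GlobGen {C : Type u} [Category.{v} C] [Abelian C] [MonoidalCategory C] (T : C) : Prop :=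
  ∃ (m : ℕ) (p : (∐ fun _ : Fin m => (𝟙_ C)) ⟶ T), Epi p

section KernelFunctor
variable {C : Type u} [Category.{v} C] [Abelian C]

/-- The objectwise kernel of a natural transformation to the identity. -/
noncomputable def kerFun {F : C ⥤ C} (α : F ⟶ 𝟭 C) : C ⥤ C where
  obj T := kernel (α.app T)
  map {T T'} g := kernel.map (α.app T) (α.app T') (F.map g) g (by simp)
  map_id T := by
    rw [← cancel_mono (kernel.ι _)]
    simp
  map_comp f g := by
    rw [← cancel_mono (kernel.ι _)]
    simp

noncomputable def kerFunι {F : C ⥤ C} (α : F ⟶ 𝟭 C) : kerFun α ⟶ F where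
  app T := kernel.ι (α.app T)
  naturality := by intros; simp [kerFun]

instance {F : C ⥤ C} (α : F ⟶ 𝟭 C) (T : C) : Mono ((kerFunι α).app T) :=
  inferInstanceAs (Mono (kernel.ι (α.app T)))

lemma kerFunι_comp {F : C ⥤ C} (α : F ⟶ 𝟭 C) (T : C) :
    (kerFunι α).app T ≫ α.app T = 0 := kernel.condition _

lemma kerFun_lift {F : C ⥤ C} (α : F ⟶ 𝟭 C) {A T : C} (z : A ⟶ F.obj T)
    (hz : z ≫ α.app T = 0) : ∃ y : A ⟶ (kerFun α).obj T, y ≫ (kerFunι α).app T = z :=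
  ⟨kernel.lift _ z hz, kernel.lift_ι _ _ _⟩

instance {F : C ⥤ C} [F.Additive] (α : F ⟶ 𝟭 C) : (kerFun α).Additive where
  map_add {X Y f g} := by
    rw [← cancel_mono ((kerFunι α).app Y)]
    simp

lemma kerFun_mono {F : C ⥤ C} (α : F ⟶ 𝟭 C) {X Y : C} (f : X ⟶ Y) [Mono (F.map f)] :
    Mono ((kerFun α).map f) := by
  have : Mono ((kerFun α).map f ≫ (kerFunι α).app Y) := by
    rw [NatTrans.naturality]
    infer_instance
  exact mono_of_mono _ ((kerFunι α).app Y)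

lemma kerFun_epi {F : C ⥤ C} [F.Additive] [PreservesFiniteLimits F]
    [PreservesFiniteColimits F] (α : F ⟶ 𝟭 C) (hα : ∀ T, Epi (α.app T))
    (S : ShortComplex C) (hS : S.ShortExact) : Epi ((kerFun α).map S.g) := by
  have hFS : (S.map F).ShortExact := hS.map_of_exact F
  have := hS.mono_f
  have := hS.epi_g
  have e1 : Epi (F.map S.g) := hFS.epi_g
  rw [epi_iff_surjective_up_to_refinements]
  intro A y
  obtain ⟨A1, p1, hp1, z, hz⟩ :=
    surjective_up_to_refinements_of_epi (F.map S.g) (y ≫ (kerFunι α).app S.X₃)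
  have h0 : (z ≫ α.app S.X₂) ≫ S.g = 0 := by
    have := α.naturality S.g
    dsimp at this
    rw [Category.assoc, ← this, ← Category.assoc, ← hz, Category.assoc, Category.assoc,
      kerFunι_comp]
    simp
  have := hα S.X₁
  obtain ⟨A2, p2, hp2, u, hu⟩ :=
    surjective_up_to_refinements_of_epi (α.app S.X₁) (hS.exact.lift _ h0)
  obtain ⟨t, ht⟩ := kerFun_lift α (p2 ≫ z - u ≫ F.map S.f) (by
    have := α.naturality S.f
    dsimp at this hu
    rw [Preadditive.sub_comp, Category.assoc, Category.assoc, this, ← Category.assoc u, ← hu,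
      Category.assoc, hS.exact.lift_f, sub_self])
  refine ⟨A2, p2 ≫ p1, epi_comp _ _, t, ?_⟩
  rw [← cancel_mono ((kerFunι α).app S.X₃)]
  rw [Category.assoc, Category.assoc, hz, Category.assoc, NatTrans.naturality,
    ← Category.assoc t, ht, Preadditive.sub_comp, Category.assoc, Category.assoc,
    ← F.map_comp, S.zero]
  simp

lemma kerFun_mid {F : C ⥤ C} [F.Additive] [PreservesFiniteLimits F]
    [PreservesFiniteColimits F] (α : F ⟶ 𝟭 C)
    (S : ShortComplex C) (hS : S.ShortExact) {A : C} (y : A ⟶ (kerFun α).obj S.X₂)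
    (hy : y ≫ (kerFun α).map S.g = 0) :
    ∃ t : A ⟶ (kerFun α).obj S.X₁, y = t ≫ (kerFun α).map S.f := by
  have hFS : (S.map F).ShortExact := hS.map_of_exact F
  have := hS.mono_f
  have m1 : Mono (S.map F).f := hFS.mono_f
  have h0 : (y ≫ (kerFunι α).app S.X₂) ≫ F.map S.g = 0 := by
    rw [Category.assoc, ← NatTrans.naturality, ← Category.assoc, hy, zero_comp]
  let l : A ⟶ F.obj S.X₁ := hFS.exact.lift _ h0
  have hl : l ≫ F.map S.f = y ≫ (kerFunι α).app S.X₂ := hFS.exact.lift_f _ h0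
  obtain ⟨t, ht⟩ := kerFun_lift α l (by
    have := α.naturality S.f
    dsimp at this
    rw [← cancel_mono S.f, Category.assoc, ← this, ← Category.assoc, hl, Category.assoc,
      kerFunι_comp]
    simp)
  refine ⟨t, ?_⟩
  rw [← cancel_mono ((kerFunι α).app S.X₂)]
  rw [Category.assoc, NatTrans.naturality, ← Category.assoc, ht, hl]

lemma kerFun_shortExact {F : C ⥤ C} [F.Additive] [PreservesFiniteLimits F]
    [PreservesFiniteColimits F] (α : F ⟶ 𝟭 C) (hα : ∀ T, Epi (α.app T))
    (S : ShortComplex C) (hS : S.ShortExact) : (S.map (kerFun α)).ShortExact := by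
  have hFS : (S.map F).ShortExact := hS.map_of_exact F
  have m1 : Mono (F.map S.f) := hFS.mono_f
  have : Mono (S.map (kerFun α)).f := kerFun_mono α S.f
  have : Epi (S.map (kerFun α)).g := kerFun_epi α hα S hS
  refine ShortComplex.ShortExact.mk ?_
  rw [ShortComplex.exact_iff_exact_up_to_refinements]
  intro A y hy
  obtain ⟨t, ht⟩ := kerFun_mid α S hS y hy
  exact ⟨A, 𝟙 A, inferInstance, t, (Category.id_comp _).trans ht⟩

lemma kerFun_exact {F : C ⥤ C} [F.Additive] [PreservesFiniteLimits F]
    [PreservesFiniteColimits F] (α : F ⟶ 𝟭 C) (hα : ∀ T, Epi (α.app T)) :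
    PreservesFiniteLimits (kerFun α) ∧ PreservesFiniteColimits (kerFun α) :=
  ((kerFun α).exact_tfae.out 0 3).1 (kerFun_shortExact α hα)

end KernelFunctor

section PowFunctor
variable {C : Type u} [Category.{v} C] [Abelian C]

noncomputable abbrev powFun (R : C ⥤ C) (m : ℕ) : C ⥤ C :=
  R ⋙ Functor.const (Discrete (Fin m)) ⋙ colim

instance powFun_exactShape (m : ℕ) : HasExactColimitsOfShape (Discrete (Fin m)) C :=
  have : HasFiniteBiproducts C := Abelian.hasFiniteBiproducts
  hasExactColimitsOfShape_discrete_finite (C := C) (Fin m)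

instance powFun_lim (R : C ⥤ C) (m : ℕ) [PreservesFiniteLimits R] :
    PreservesFiniteLimits (powFun R m) := by
  unfold powFun
  infer_instance

instance powFun_colim (R : C ⥤ C) (m : ℕ) [PreservesFiniteColimits R] :
    PreservesFiniteColimits (powFun R m) := by
  unfold powFun
  infer_instance

noncomputable def powι (R : C ⥤ C) {m : ℕ} (i : Fin m) : R ⟶ powFun R m where
  app T := colimit.ι ((Functor.const (Discrete (Fin m))).obj (R.obj T)) ⟨i⟩
  naturality {X Y} f := by
    simp [powFun]

noncomputable def powDesc {R G : C ⥤ C} {m : ℕ} (β : Fin m → (R ⟶ G)) : powFun R m ⟶ G where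
  app T := colimit.desc ((Functor.const (Discrete (Fin m))).obj (R.obj T))
    { pt := G.obj T, ι := Discrete.natTrans (fun i => (β i.as).app T) }
  naturality {X Y} f := by
    dsimp [powFun]
    ext i
    simp

lemma powι_desc {R G : C ⥤ C} {m : ℕ} (β : Fin m → (R ⟶ G)) (i : Fin m) (T : C) :
    (powι R i).app T ≫ (powDesc β).app T = (β i).app T := by
  simp [powι, powDesc]

lemma pow_ext {R : C ⥤ C} {m : ℕ} {T Z : C} {f g : (powFun R m).obj T ⟶ Z}
    (h : ∀ i, (powι R i).app T ≫ f = (powι R i).app T ≫ g) : f = g :=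
  colimit.hom_ext (fun i => h i.as)

noncomputable def powπ (R : C ⥤ C) {m : ℕ} (i : Fin m) : powFun R m ⟶ R :=
  powDesc (fun j => if j = i then 𝟙 R else 0)

lemma pow_sum (R : C ⥤ C) (m : ℕ) (T : C) :
    ∑ i : Fin m, (powπ R i).app T ≫ (powι R i).app T = 𝟙 ((powFun R m).obj T) := by
  apply pow_ext
  intro j
  rw [Preadditive.comp_sum, Finset.sum_eq_single j]
  · rw [← Category.assoc, powπ, powι_desc]
    simp
  · intro i _ hi
    rw [← Category.assoc, powπ, powι_desc]
    simp [hi.symm]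
  · simp

end PowFunctor

section Derived
open DerivedCategory Pretriangulated
variable {C : Type u} [Category.{v} C] [Abelian C] [HasDerivedCategory.{w'} C]

def Perp (X Y : DerivedCategory C) : Prop := ∀ (i : ℤ) (f : X ⟶ Y⟦i⟧), f = 0

lemma Perp.of_iso {X Y Y' : DerivedCategory C} (h : Perp X Y) (e : Y ≅ Y') : Perp X Y' := by
  intro i f
  have := h i (f ≫ e.inv⟦i⟧')
  rw [← cancel_mono (e.inv⟦i⟧'), this, zero_comp]

lemma Perp.of_iso_left {X X' Y : DerivedCategory C} (h : Perp X Y) (e : X ≅ X') : Perp X' Y := by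
  intro i f
  have := h i (e.hom ≫ f)
  rw [← cancel_epi e.hom, this, comp_zero]

lemma Perp.shift {X Y : DerivedCategory C} (h : Perp X Y) (j : ℤ) : Perp X (Y⟦j⟧) := by
  intro i f
  have := h (j + i) (f ≫ (shiftFunctorAdd (DerivedCategory C) j i).inv.app Y)
  rw [← cancel_mono ((shiftFunctorAdd (DerivedCategory C) j i).inv.app Y), this, zero_comp]

lemma Perp.zero {X Y : DerivedCategory C} (h : Perp X Y) (f : X ⟶ Y) : f = 0 := by
  have := h 0 (f ≫ (shiftFunctorZero (DerivedCategory C) ℤ).inv.app Y)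
  rw [← cancel_mono ((shiftFunctorZero (DerivedCategory C) ℤ).inv.app Y)]
  simpa using this

lemma Perp.third {X : DerivedCategory C} (T : Triangle (DerivedCategory C))
    (hT : T ∈ distTriang (DerivedCategory C)) (h1 : Perp X T.obj₁) (h2 : Perp X T.obj₂) :
    Perp X T.obj₃ := by
  intro i f
  have hT' := Triangle.shift_distinguished T hT i
  obtain ⟨g, hg⟩ := Triangle.coyoneda_exact₃ _ hT' f ((h1.shift i) 1 _)
  have : g = 0 := h2 i g
  rw [hg, this]
  exact zero_comp

variable {F : C ⥤ C} [F.Additive] (α : F ⟶ 𝟭 C)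

/-- The map of complexes induced by `α`. -/
noncomputable def cmap (M : CochainComplex C ℤ) :
    (F.mapHomologicalComplex (ComplexShape.up ℤ)).obj M ⟶ M where
  f i := α.app (M.X i)
  comm' i j _ := by
    have := α.naturality (M.d i j)
    dsimp at this ⊢
    exact this.symm

/-- The short complex `K M ⟶ F M ⟶ M`. -/
noncomputable def ses (M : CochainComplex C ℤ) : ShortComplex (CochainComplex C ℤ) :=
  ShortComplex.mk ((NatTrans.mapHomologicalComplex (kerFunι α) (ComplexShape.up ℤ)).app M)
    (cmap α M) (by
      ext i
      exact kerFunι_comp α (M.X i))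

noncomputable def sesMap {M M' : CochainComplex C ℤ} (φ : M ⟶ M') : ses α M ⟶ ses α M' where
  τ₁ := ((kerFun α).mapHomologicalComplex (ComplexShape.up ℤ)).map φ
  τ₂ := (F.mapHomologicalComplex (ComplexShape.up ℤ)).map φ
  τ₃ := φ
  comm₁₂ := by
    ext i
    exact (kerFunι α).naturality (φ.f i)
  comm₂₃ := by
    ext i
    exact α.naturality (φ.f i)

lemma ses_shortExact (hα : ∀ T, Epi (α.app T)) (M : CochainComplex C ℤ) :
    (ses α M).ShortExact := by
  refine HomologicalComplex.shortExact_of_degreewise_shortExact _ ?_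
  intro i
  have := hα (M.X i)
  let S := ShortComplex.mk (kernel.ι (α.app (M.X i))) (α.app (M.X i)) (kernel.condition _)
  have hS : S.ShortExact :=
    { exact := S.exact_of_f_is_kernel (kernelIsKernel _)
      mono_f := by dsimp [S]; infer_instance
      epi_g := this }
  exact hS

variable [PreservesFiniteLimits (kerFun α)] [PreservesFiniteColimits (kerFun α)]

noncomputable def sesδ (hα : ∀ T, Epi (α.app T)) (M : CochainComplex C ℤ) :
    Q.obj M ⟶
      (Q.obj (((kerFun α).mapHomologicalComplex (ComplexShape.up ℤ)).obj M))⟦(1 : ℤ)⟧ :=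
  triangleOfSESδ (ses_shortExact α hα M)

/-- The endofunctor `K(-)[1]` of the derived category. -/
noncomputable def SF : DerivedCategory C ⥤ DerivedCategory C :=
  (kerFun α).mapDerivedCategory ⋙ shiftFunctor _ (1 : ℤ)

noncomputable def SFiso (M : CochainComplex C ℤ) :
    (SF α).obj (Q.obj M) ≅
      (Q.obj (((kerFun α).mapHomologicalComplex (ComplexShape.up ℤ)).obj M))⟦(1 : ℤ)⟧ :=
  (shiftFunctor _ (1 : ℤ)).mapIso ((kerFun α).mapDerivedCategoryFactors.app M)

noncomputable def tauδ (hα : ∀ T, Epi (α.app T)) :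
    (Q : CochainComplex C ℤ ⥤ DerivedCategory C) ⟶ Q ⋙ SF α where
  app M := sesδ α hα M ≫ (SFiso α M).inv
  naturality {M M'} φ := by
    have h := triangleOfSESδ_naturality (ses_shortExact α hα M) (ses_shortExact α hα M')
      (sesMap α φ)
    have h2 := (kerFun α).mapDerivedCategoryFactors.inv.naturality φ
    have h3 : (SFiso α M).inv ≫ (SF α).map (Q.map φ) =
        (Q.map (((kerFun α).mapHomologicalComplex (ComplexShape.up ℤ)).map φ))⟦(1 : ℤ)⟧' ≫
          (SFiso α M').inv := by
      dsimp [SFiso, SF]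
      rw [← Functor.map_comp, ← Functor.map_comp]
      exact congrArg _ h2.symm
    have h4 : Q.map φ ≫ sesδ α hα M' = sesδ α hα M ≫
       (Q.map (((kerFun α).mapHomologicalComplex (ComplexShape.up ℤ)).map φ))⟦(1 : ℤ)⟧' := h.symm
    dsimp
    rw [Category.assoc, h3, ← Category.assoc, h4, Category.assoc]

noncomputable def deltaN (hα : ∀ T, Epi (α.app T)) : 𝟭 (DerivedCategory C) ⟶ SF α :=
  letI : Localization.Lifting Q (HomologicalComplex.quasiIso C (ComplexShape.up ℤ)) (Q ⋙ SF α)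
    (SF α) := ⟨Iso.refl _⟩
  letI : Localization.Lifting Q (HomologicalComplex.quasiIso C (ComplexShape.up ℤ)) Q
    (𝟭 (DerivedCategory C)) := ⟨Functor.rightUnitor _⟩
  Localization.liftNatTrans Q (HomologicalComplex.quasiIso C (ComplexShape.up ℤ)) Q (Q ⋙ SF α)
    (𝟭 _) (SF α) (tauδ α hα)

lemma deltaN_app (hα : ∀ T, Epi (α.app T)) (M : CochainComplex C ℤ) :
    (deltaN α hα).app (Q.obj M) =
      sesδ α hα M ≫ (SFiso α M).inv := by
  dsimp only [deltaN]
  rw [Localization.liftNatTrans_app]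
  dsimp [Localization.Lifting.iso]
  simp [tauδ]

lemma deltaN_inj (hα : ∀ T, Epi (α.app T)) (X : DerivedCategory C) (M : CochainComplex C ℤ)
    (hX : Perp X (Q.obj ((F.mapHomologicalComplex (ComplexShape.up ℤ)).obj M)))
    (x : X ⟶ Q.obj M) (hx : x ≫ (deltaN α hα).app (Q.obj M) = 0) : x = 0 := by
  rw [deltaN_app, ← Category.assoc] at hx
  have hx' : x ≫ sesδ α hα M = 0 := by
    rw [← cancel_mono (SFiso α M).inv, zero_comp]
    exact hx
  obtain ⟨g, hg⟩ := Triangle.coyoneda_exact₃ _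
    (triangleOfSES_distinguished (ses_shortExact α hα M)) x hx'
  have : g = 0 := hX.zero g
  rw [hg, this]
  exact zero_comp

lemma Perp_SF (hα : ∀ T, Epi (α.app T)) (X : DerivedCategory C) (M : CochainComplex C ℤ)
    (hX : Perp X (Q.obj ((F.mapHomologicalComplex (ComplexShape.up ℤ)).obj M)))
    (hM : Perp X (Q.obj M)) : Perp X ((SF α).obj (Q.obj M)) := by
  refine Perp.of_iso ?_ (SFiso α M).symm
  exact Perp.third _ (rot_of_distTriang _
    (triangleOfSES_distinguished (ses_shortExact α hα M))) hX hM


/-- iterates of `SF` -/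
noncomputable def SFn : ℕ → (DerivedCategory C ⥤ DerivedCategory C)
  | 0 => 𝟭 _
  | r + 1 => SF α ⋙ SFn r

noncomputable def compNT (S T : DerivedCategory C ⥤ DerivedCategory C)
    (d : 𝟭 (DerivedCategory C) ⟶ S) (d' : 𝟭 (DerivedCategory C) ⟶ T) :
    𝟭 (DerivedCategory C) ⟶ S ⋙ T where
  app Y := d.app Y ≫ d'.app (S.obj Y)
  naturality X Y f := by
    have h1 := d.naturality f
    have h2 := d'.naturality (S.map f)
    dsimp at h1 h2 ⊢
    rw [← Category.assoc, h1, Category.assoc, h2, ← Category.assoc]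

noncomputable def deltaNn (hα : ∀ T, Epi (α.app T)) : ∀ r : ℕ, 𝟭 (DerivedCategory C) ⟶ SFn α r
  | 0 => 𝟙 _
  | r + 1 => compNT (SF α) (SFn α r) (deltaN α hα) (deltaNn hα r)

lemma deltaNn_succ (hα : ∀ T, Epi (α.app T)) (r : ℕ) (Y : DerivedCategory C) :
    (deltaNn α hα (r + 1)).app Y =
      (deltaN α hα).app Y ≫ (deltaNn α hα r).app ((SF α).obj Y) := by
  rfl

/-- The object of the derived category attached to `A : C`. -/
noncomputable abbrev sg (A : C) : DerivedCategory C :=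
  Q.obj ((CochainComplex.singleFunctor C 0).obj A)

noncomputable def sgMap (G : C ⥤ C) [G.Additive] [PreservesFiniteLimits G]
    [PreservesFiniteColimits G] (A : C) : G.mapDerivedCategory.obj (sg A) ≅ sg (G.obj A) :=
  (G.mapDerivedCategorySingleFunctor 0).app A

lemma SFn_single (r : ℕ) : ∀ (T : C) (j : ℤ),
    ∃ T' : C, Nonempty ((SFn α r).obj ((sg T)⟦j⟧) ≅ (sg T')⟦(j + r : ℤ)⟧) := by
  induction r with
  | zero =>
    intro T j
    exact ⟨T, ⟨eqToIso (by simp [SFn])⟩⟩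
  | succ r ih =>
    intro T j
    obtain ⟨T', ⟨e⟩⟩ := ih ((kerFun α).obj T) (j + 1)
    refine ⟨T', ⟨?_⟩⟩
    refine (SFn α r).mapIso (?_ : (SF α).obj _ ≅ _) ≪≫ e ≪≫ eqToIso ?_
    · exact (shiftFunctor _ (1 : ℤ)).mapIso
        (((kerFun α).mapDerivedCategory.commShiftIso j).app (sg T) ≪≫
          (shiftFunctor _ j).mapIso (sgMap (kerFun α) T)) ≪≫
          ((shiftFunctorAdd (DerivedCategory C) j 1).app _).symm
    · congr 2
      push_cast
      ring

end Derived

section Transport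
open DerivedCategory Pretriangulated
variable {C : Type u} [Category.{v} C] [Abelian C] [HasDerivedCategory.{w'} C]
variable (R R' : C ⥤ C) [R.Additive] [PreservesFiniteLimits R]
  [PreservesFiniteColimits R] [R'.Additive] [PreservesFiniteLimits R']
  [PreservesFiniteColimits R']

noncomputable def derIso (e : R ⋙ R' ≅ 𝟭 C) :
    R.mapDerivedCategory ⋙ R'.mapDerivedCategory ≅ 𝟭 (DerivedCategory C) := by
  letI l1 : Localization.Lifting Q (HomologicalComplex.quasiIso C (ComplexShape.up ℤ)) Q
    (𝟭 (DerivedCategory C)) := ⟨Functor.rightUnitor _⟩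
  letI l2 : Localization.Lifting Q (HomologicalComplex.quasiIso C (ComplexShape.up ℤ))
    (Q ⋙ R.mapDerivedCategory ⋙ R'.mapDerivedCategory)
    (R.mapDerivedCategory ⋙ R'.mapDerivedCategory) := ⟨Iso.refl _⟩
  refine Localization.liftNatIso Q (HomologicalComplex.quasiIso C (ComplexShape.up ℤ))
    (Q ⋙ R.mapDerivedCategory ⋙ R'.mapDerivedCategory) Q _ _ ?_
  refine (Functor.associator _ _ _).symm ≪≫
    Functor.isoWhiskerRight R.mapDerivedCategoryFactors _ ≪≫ Functor.associator _ _ _ ≪≫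
    Functor.isoWhiskerLeft _ R'.mapDerivedCategoryFactors ≪≫ (Functor.associator _ _ _).symm ≪≫
    Functor.isoWhiskerRight (?_ : _ ≅ 𝟭 _) Q ≪≫ Functor.leftUnitor _
  exact NatIso.ofComponents
    (fun M => HomologicalComplex.Hom.isoOfComponents (fun i => e.app (M.X i))
      (fun i j _ => (e.hom.naturality (M.d i j)).symm))
    (fun {M M'} φ => by
      ext i
      exact e.hom.naturality (φ.f i))

lemma der_faithful (e : R ⋙ R' ≅ 𝟭 C) : (R.mapDerivedCategory (C₁ := C) (C₂ := C)).Faithful :=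
  Functor.Faithful.of_comp_iso (derIso R R' e)

lemma Perp.transport (e : R ⋙ R' ≅ 𝟭 C) (e' : R' ⋙ R ≅ 𝟭 C) {A : C} {Y : DerivedCategory C}
    (h : Perp (sg (R'.obj A)) Y) : Perp (sg A) (R.mapDerivedCategory.obj Y) := by
  intro i x
  have := der_faithful R' R e'
  have h' : Perp (R'.mapDerivedCategory.obj (sg A))
      (R'.mapDerivedCategory.obj (R.mapDerivedCategory.obj Y)) :=
    (h.of_iso_left (sgMap R' A).symm).of_iso ((derIso R R' e).app Y).symm
  apply R'.mapDerivedCategory.map_injective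
  have h2 := h' i (R'.mapDerivedCategory.map x ≫
    (R'.mapDerivedCategory.commShiftIso i).hom.app _)
  rw [Functor.map_zero, ← cancel_mono ((R'.mapDerivedCategory.commShiftIso i).hom.app _), h2,
    zero_comp]

lemma Perp.pow (m : ℕ) [(powFun R m).Additive] {X : DerivedCategory C} {M : CochainComplex C ℤ}
    (h : Perp X (Q.obj ((R.mapHomologicalComplex (ComplexShape.up ℤ)).obj M))) :
    Perp X (Q.obj (((powFun R m).mapHomologicalComplex (ComplexShape.up ℤ)).obj M)) := by
  intro i f
  let p (k : Fin m) := (NatTrans.mapHomologicalComplex (powπ R k) (ComplexShape.up ℤ)).app M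
  let q (k : Fin m) := (NatTrans.mapHomologicalComplex (powι R k) (ComplexShape.up ℤ)).app M
  have hs : ∑ k, p k ≫ q k = 𝟙 _ := by
    ext j
    refine Eq.trans ((HomologicalComplex.eval C (ComplexShape.up ℤ) j).map_sum
      (fun k => p k ≫ q k) Finset.univ) ?_
    exact pow_sum R m (M.X j)
  have hs2 : ∑ k, (Q.map (p k))⟦i⟧' ≫ (Q.map (q k))⟦i⟧' = 𝟙 _ := by
    simp only [← Functor.map_comp]
    rw [← Functor.map_sum, ← Functor.map_sum, hs]
    simp
  rw [← Category.comp_id f, ← hs2, Preadditive.comp_sum]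
  refine Finset.sum_eq_zero fun k _ => ?_
  rw [← Category.assoc, h i (f ≫ _), zero_comp]

end Transport


section Iterate
open DerivedCategory Pretriangulated
variable {C : Type u} [Category.{v} C] [Abelian C] [HasDerivedCategory.{w'} C]
variable {F : C ⥤ C} [F.Additive] (α : F ⟶ 𝟭 C)
variable [PreservesFiniteLimits (kerFun α)] [PreservesFiniteColimits (kerFun α)]

/-- replacement of an object of the derived category by a complex -/
lemma exists_rep (Y : DerivedCategory C) :
    ∃ M : CochainComplex C ℤ, Nonempty (Q.obj M ≅ Y) :=
  ⟨_, ⟨Q.objObjPreimageIso Y⟩⟩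

lemma iter_inj (hα : ∀ T, Epi (α.app T)) (X : ℕ → DerivedCategory C)
    (hX : ∀ (k : ℕ) (M : CochainComplex C ℤ), Perp (X (k + 1)) (Q.obj M) →
      Perp (X k) (Q.obj ((F.mapHomologicalComplex (ComplexShape.up ℤ)).obj M)))
    (r : ℕ) : ∀ (Y : DerivedCategory C), (∀ k, 1 ≤ k → k ≤ r → Perp (X k) Y) →
      ∀ x : X 0 ⟶ Y, x ≫ (deltaNn α hα r).app Y = 0 → x = 0 := by
  induction r with
  | zero =>
    intro Y _ x hx
    exact (Category.comp_id x).symm.trans hx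
  | succ r ih =>
    intro Y hY x hx
    obtain ⟨M, ⟨e⟩⟩ := exists_rep Y
    have hM : ∀ k, 1 ≤ k → k ≤ r + 1 → Perp (X k) (Q.obj M) :=
      fun k h1 h2 => (hY k h1 h2).of_iso e.symm
    have h1 : ∀ k, 1 ≤ k → k ≤ r → Perp (X k) ((SF α).obj Y) := by
      intro k hk hk'
      exact (Perp_SF α hα (X k) M (hX k M (hM (k + 1) (by omega) (by omega)))
        (hM k hk (by omega))).of_iso ((SF α).mapIso e)
    have h2 : x ≫ (deltaN α hα).app Y = 0 := by
      apply ih ((SF α).obj Y) h1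
      refine Eq.trans (Category.assoc _ _ _) ?_
      exact hx
    have h3 : x ≫ e.inv = 0 := by
      apply deltaN_inj α hα (X 0) M (hX 0 M (hM 1 le_rfl (by omega)))
      have := (deltaN α hα).naturality e.inv
      dsimp at this
      rw [Category.assoc, this, ← Category.assoc, h2, zero_comp]
    rw [← cancel_mono e.inv, h3, zero_comp]

/-- The step lemma. -/
lemma step_perp (hα : ∀ T, Epi (α.app T)) (A : ℕ → C)
    (hA : ∀ (k : ℕ) (M : CochainComplex C ℤ), Perp (sg (A (k + 1))) (Q.obj M) →
      Perp (sg (A k)) (Q.obj ((F.mapHomologicalComplex (ComplexShape.up ℤ)).obj M)))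
    (r : ℕ) (hr : ∀ (T : C) (f : sg (A 0) ⟶ (sg T)⟦(r : ℤ)⟧), f = 0)
    (Y : DerivedCategory C) (hY : ∀ k, 1 ≤ k → k ≤ r → Perp (sg (A k)) Y) :
    Perp (sg (A 0)) Y := by
  intro i x
  apply iter_inj α hα (fun k => sg (A k)) hA r (Y⟦i⟧)
    (fun k h1 h2 => (hY k h1 h2).shift i) x
  have h1 := (deltaNn α hα r).naturality x
  refine Eq.trans h1 ?_
  have h2 : (deltaNn α hα r).app (sg (A 0)) = 0 := by
    obtain ⟨T', ⟨e⟩⟩ := SFn_single α r (A 0) 0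
    let e' : (SFn α r).obj (sg (A 0)) ≅ (sg T')⟦(r : ℤ)⟧ :=
      (SFn α r).mapIso ((shiftFunctorZero (DerivedCategory C) ℤ).app (sg (A 0))).symm ≪≫ e ≪≫
        eqToIso (by rw [zero_add])
    have h3 : (deltaNn α hα r).app (sg (A 0)) ≫ e'.hom = 0 := hr _ _
    rw [← cancel_mono e'.hom, zero_comp]
    exact h3
  exact (congrArg (fun t => t ≫ (SFn α r).map x) h2).trans zero_comp

end Iterate

section Generation
open DerivedCategory Pretriangulated
variable {C : Type u} [Category.{v} C] [Abelian C] [HasDerivedCategory.{w'} C]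

lemma isGE_of_homology (M : CochainComplex C ℤ) (b : ℤ)
    (h : ∀ i, i < b → IsZero (M.homology i)) : (Q.obj M).IsGE b := by
  rw [isGE_iff]
  intro i hi
  exact (h i hi).of_iso ((homologyFunctorFactors C i).app M)

lemma low_zero (Y : DerivedCategory C) (b : ℤ) [Y.IsGE b] (T : C) (i : ℤ) (hi : i + 1 ≤ b)
    (f : sg T ⟶ Y⟦i⟧) : f = 0 := by
  have h1 : (sg T).IsLE 0 := inferInstanceAs (((singleFunctor C 0).obj T).IsLE 0)
  have h2 : (Y⟦i⟧).IsGE (b - i) := by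
    exact TStructure.t.isGE_shift Y b i (b - i) (by omega)
  exact TStructure.t.zero_of_isLE_of_isGE f 0 (b - i) (by omega) h1 h2

lemma all_perp (Y : DerivedCategory C) (b : ℤ) [Y.IsGE b]
    (h : ∀ T : C, ∃ (P : C) (p : P ⟶ T), Epi p ∧ Perp (sg P) Y) (T : C) : Perp (sg T) Y := by
  have key : ∀ (k : ℕ) (T : C) (f : sg T ⟶ Y⟦b - 1 + (k : ℤ)⟧), f = 0 := by
    intro k
    induction k with
    | zero =>
      intro T f
      exact low_zero Y b T _ (by simp) f
    | succ k ih =>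
      intro T f
      obtain ⟨P, p, hp, hP⟩ := h T
      let S := ShortComplex.mk (kernel.ι p) p (kernel.condition p)
      have hS : S.ShortExact :=
        { exact := S.exact_of_f_is_kernel (kernelIsKernel _)
          mono_f := by dsimp [S]; infer_instance
          epi_g := hp }
      have hd := hS.singleTriangle_distinguished
      obtain ⟨g, hg⟩ := Triangle.yoneda_exact₃ _ hd (f : hS.singleTriangle.obj₃ ⟶ _) (hP _ _)
      let e : Y⟦b - 1 + ((k + 1 : ℕ) : ℤ)⟧ ≅ (Y⟦b - 1 + (k : ℤ)⟧)⟦(1 : ℤ)⟧ :=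
        (shiftFunctorAdd' (DerivedCategory C) (b - 1 + (k : ℤ)) 1 _ (by push_cast; ring)).app Y
      obtain ⟨g', hg'⟩ := (shiftFunctor (DerivedCategory C) (1 : ℤ)).map_surjective
        ((g ≫ e.hom : (sg (kernel p))⟦(1 : ℤ)⟧ ⟶ _))
      have hg0 : g' = 0 := ih _ g'
      have : g ≫ e.hom = 0 := by
        refine hg'.symm.trans ?_
        rw [hg0, Functor.map_zero]
        rfl
      have hg1 : g = 0 := by
        rw [← cancel_mono e.hom, this, zero_comp]
      rw [hg, hg1]
      exact comp_zero
  intro i f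
  by_cases hi : i + 1 ≤ b
  · exact low_zero Y b T i hi f
  · obtain ⟨k, hk⟩ : ∃ k : ℕ, i = b - 1 + (k : ℤ) := ⟨(i - (b - 1)).toNat, by omega⟩
    subst hk
    exact key k T f

lemma homology_zero_of_perp (M : CochainComplex C ℤ) (h : ∀ T : C, Perp (sg T) (Q.obj M)) (i : ℤ) :
    IsZero (M.homology i) := by
  let φ : (HomologicalComplex.single C (ComplexShape.up ℤ) i).obj (M.cycles i) ⟶ M :=
    HomologicalComplex.mkHomFromSingle (M.iCycles i) (fun j _ => M.iCycles_d i j)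
  have h0 : Q.map φ = 0 := by
    apply (shiftFunctor (DerivedCategory C) i).map_injective
    rw [Functor.map_zero]
    let e : sg (M.cycles i) ≅
        (Q.obj ((HomologicalComplex.single C (ComplexShape.up ℤ) i).obj (M.cycles i)))⟦i⟧ :=
      (((singleFunctors C).shiftIso i 0 i (by simp)).app (M.cycles i)).symm
    rw [← cancel_epi e.hom, comp_zero]
    exact h _ i _
  have h1 : HomologicalComplex.homologyMap φ i = 0 := by
    have := homologyFunctorFactors_hom_naturality (C := C) φ i
    rw [h0, Functor.map_zero, zero_comp] at this
    exact (cancel_epi ((homologyFunctorFactors C i).hom.app _)).1 (this.symm.trans comp_zero.symm)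
  have h2 : HomologicalComplex.cyclesMap φ i ≫ M.homologyπ i = 0 := by
    rw [← HomologicalComplex.homologyπ_naturality, h1, comp_zero]
  have h3 : (HomologicalComplex.singleObjCyclesSelfIso (ComplexShape.up ℤ) i (M.cycles i)).inv ≫
      HomologicalComplex.cyclesMap φ i = 𝟙 _ := by
    rw [← cancel_mono (M.iCycles i)]
    simp [φ]
  have h4 : M.homologyπ i = 0 := by
    rw [← Category.id_comp (M.homologyπ i), ← h3, Category.assoc, h2, comp_zero]
  rw [IsZero.iff_id_eq_zero, ← cancel_epi (M.homologyπ i), h4]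
  simp

lemma isZero_of_homology (M : CochainComplex C ℤ) (h : ∀ i, IsZero (M.homology i)) :
    IsZero (Q.obj M) := by
  have : IsIso (0 : Q.obj M ⟶ Q.obj M) := by
    rw [DerivedCategory.isIso_iff]
    intro n
    have hz : IsZero ((homologyFunctor C n).obj (Q.obj M)) :=
      (h n).of_iso ((homologyFunctorFactors C n).app M)
    exact ⟨0, hz.eq_of_src _ _, hz.eq_of_src _ _⟩
  rw [IsZero.iff_id_eq_zero, ← cancel_epi (0 : Q.obj M ⟶ Q.obj M)]
  simp

end Generation


section Equivalences
variable {C : Type u} [Category.{v} C] [Abelian C]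

/-- a jointly epimorphic family -/
def JEpi {P T : C} {p : ℕ} (q : Fin p → (P ⟶ T)) : Prop :=
  ∀ (Z : C) (g : T ⟶ Z), (∀ i, q i ≫ g = 0) → g = 0

lemma equiv_props (R R' : C ⥤ C) (e : R ⋙ R' ≅ 𝟭 C) (e' : R' ⋙ R ≅ 𝟭 C) :
    R.Additive ∧ PreservesFiniteLimits R ∧ PreservesFiniteColimits R ∧ R.Faithful := by
  have : R.IsEquivalence := Functor.IsEquivalence.mk' R' e.symm e'
  have h1 : PreservesFiniteLimits R := inferInstance
  have h2 : PreservesFiniteColimits R := inferInstance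
  have h3 : R.Additive := Functor.additive_of_preserves_binary_products R
  exact ⟨h3, h1, h2, inferInstance⟩

lemma JEpi.map (R R' : C ⥤ C) (e : R ⋙ R' ≅ 𝟭 C) (e' : R' ⋙ R ≅ 𝟭 C) {P T : C} {p : ℕ}
    {q : Fin p → (P ⟶ T)} (hq : JEpi q) : JEpi (fun i => R.map (q i)) := by
  obtain ⟨_, _, _, _⟩ := equiv_props R' R e' e
  intro Z g hg
  apply R'.map_injective
  rw [Functor.map_zero, ← cancel_epi (e.inv.app T), comp_zero]
  apply hq
  intro i
  have h1 := e.inv.naturality (q i)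
  dsimp at h1
  rw [← Category.assoc, h1, Category.assoc, ← R'.map_comp, hg i, Functor.map_zero, comp_zero]

lemma JEpi.comp_iso {P T P' T' : C} {p : ℕ} {q : Fin p → (P ⟶ T)} (hq : JEpi q) (u : P' ≅ P)
    (w : T ≅ T') : JEpi (fun i => u.hom ≫ q i ≫ w.hom) := by
  intro Z g hg
  have : w.hom ≫ g = 0 := by
    apply hq
    intro i
    rw [← cancel_epi u.hom, comp_zero, ← hg i]
    simp
  rw [← cancel_epi w.hom, this, comp_zero]

variable [MonoidalCategory C]

noncomputable def twR (A B : C) (e : A ⊗ B ≅ 𝟙_ C) : tensorRight A ⋙ tensorRight B ≅ 𝟭 C :=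
  NatIso.ofComponents (fun T => α_ T A B ≪≫ whiskerLeftIso T e ≪≫ ρ_ T) (by
    intro X Y f
    dsimp
    simp only [Category.assoc, associator_naturality_left_assoc, whiskerLeftIso_hom,
      ← whisker_exchange_assoc,
      rightUnitor_naturality])

noncomputable def twL (A B : C) (e : B ⊗ A ≅ 𝟙_ C) : tensorLeft A ⋙ tensorLeft B ≅ 𝟭 C :=
  NatIso.ofComponents (fun T => (α_ B A T).symm ≪≫ whiskerRightIso e T ≪≫ λ_ T) (by
    intro X Y f
    dsimp
    simp only [Category.assoc, associator_inv_naturality_right_assoc,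
      whiskerRightIso_hom, whisker_exchange_assoc,
      leftUnitor_naturality])

lemma GlobGen.of_iso {T T' : C} (h : GlobGen T) (e : T ≅ T') : GlobGen T' := by
  obtain ⟨m, p, hp⟩ := h
  exact ⟨m, p ≫ e.hom, epi_comp _ _⟩

lemma GlobGen.jepi {T : C} (h : GlobGen T) :
    ∃ (p : ℕ) (q : Fin p → (𝟙_ C ⟶ T)), JEpi q := by
  obtain ⟨m, p, hp⟩ := h
  refine ⟨m, fun i => Sigma.ι (fun _ : Fin m => (𝟙_ C)) i ≫ p, ?_⟩
  intro Z g hg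
  rw [← cancel_epi p, comp_zero]
  apply Sigma.hom_ext
  intro i
  rw [← Category.assoc, hg i, comp_zero]

lemma GlobGen.jepi_twist {T A B : C} (e : A ⊗ B ≅ 𝟙_ C) (e' : B ⊗ A ≅ 𝟙_ C)
    (h : GlobGen (T ⊗ A)) : ∃ (p : ℕ) (q : Fin p → (B ⟶ T)), JEpi q := by
  obtain ⟨p, q, hq⟩ := h.jepi
  exact ⟨p, _, (hq.map (tensorRight B) (tensorRight A) (twR B A e') (twR A B e)).comp_iso
    (λ_ B).symm ((twR A B e).app T)⟩

/-- tensoring a morphism to the unit gives a natural transformation to the identity -/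
noncomputable def betaNT {B : C} (s : B ⟶ 𝟙_ C) : tensorRight B ⟶ 𝟭 C where
  app T := T ◁ s ≫ (ρ_ T).hom
  naturality X Y f := by
    dsimp
    rw [← Category.assoc, ← whisker_exchange, Category.assoc, rightUnitor_naturality,
      Category.assoc]

lemma alpha_epi {B : C} {m : ℕ} (s : Fin m → (B ⟶ 𝟙_ C)) (hs : JEpi s) (T A A' : C)
    (e : A ⊗ A' ≅ 𝟙_ C) (e' : A' ⊗ A ≅ 𝟙_ C) {p : ℕ} (q : Fin p → (A ⟶ T)) (hq : JEpi q) :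
    Epi ((powDesc (fun i => betaNT (s i))).app T) := by
  apply Preadditive.epi_of_cancel_zero
  intro Z g hg
  have h1 : ∀ i, (betaNT (s i)).app T ≫ g = 0 := by
    intro i
    rw [← powι_desc (fun i => betaNT (s i)), Category.assoc, hg, comp_zero]
  apply hq
  intro j
  rw [← cancel_epi (ρ_ A).hom, comp_zero]
  apply hs.map (tensorLeft A) (tensorLeft A') (twL A A' e') (twL A' A e)
  intro i
  have h2 := (betaNT (s i)).naturality (q j)
  have h3 : (A ◁ s i ≫ (ρ_ A).hom) ≫ q j =
    q j ▷ B ≫ (betaNT (s i)).app T := h2.symm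
  have h4 : (A ◁ s i) ≫ (ρ_ A).hom ≫ q j ≫ g = 0 := by
    rw [← Category.assoc, ← Category.assoc, h3, Category.assoc, h1, comp_zero]
  exact h4

end Equivalences

section Final
open DerivedCategory Pretriangulated
variable {C : Type u} [Category.{v} C] [Abelian C] [HasDerivedCategory.{w'} C]

noncomputable def sgIso {A B : C} (e : A ≅ B) : sg A ≅ sg B :=
  Q.mapIso ((CochainComplex.singleFunctor C 0).mapIso e)

lemma hom_zero_transport (R R' : C ⥤ C) (e : R ⋙ R' ≅ 𝟭 C) (e' : R' ⋙ R ≅ 𝟭 C) (A : C) (j : ℤ)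
    (h : ∀ (T : C) (f : sg (R.obj A) ⟶ (sg T)⟦j⟧), f = 0) (T : C) (f : sg A ⟶ (sg T)⟦j⟧) :
    f = 0 := by
  obtain ⟨_, _, _, _⟩ := equiv_props R' R e' e
  obtain ⟨_, _, _, _⟩ := equiv_props R R' e e'
  have := der_faithful R R' e
  apply R.mapDerivedCategory.map_injective
  let u : R.mapDerivedCategory.obj ((sg T)⟦j⟧) ≅ (sg (R.obj T))⟦j⟧ :=
    (R.mapDerivedCategory.commShiftIso j).app (sg T) ≪≫
      (shiftFunctor _ j).mapIso (sgMap R T)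
  have h1 := h _ ((sgMap R A).inv ≫ R.mapDerivedCategory.map f ≫ u.hom)
  rw [Functor.map_zero, ← cancel_mono u.hom, ← cancel_epi (sgMap R A).inv, h1]
  simp

lemma ext_zero [HasExt.{w} C] (A T : C) (N : ℕ) (h : Subsingleton (Abelian.Ext A T N))
    (f : sg A ⟶ (sg T)⟦(N : ℤ)⟧) : f = 0 := by
  have h1 : Subsingleton (ShiftedHom ((singleFunctor C 0).obj A) ((singleFunctor C 0).obj T)
    (N : ℤ)) := Abelian.Ext.homEquiv.symm.subsingleton
  have : Subsingleton (sg A ⟶ (sg T)⟦(N : ℤ)⟧) := h1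
  exact Subsingleton.elim _ _

lemma cover_perp {A T : C} {p : ℕ} (q : Fin p → (A ⟶ T)) (hq : JEpi q) (Y : DerivedCategory C)
    (h : Perp (sg A) Y) : ∃ (P : C) (p : P ⟶ T), Epi p ∧ Perp (sg P) Y := by
  refine ⟨(powFun (𝟭 C) p).obj A, colimit.desc ((Functor.const (Discrete (Fin p))).obj A)
    { pt := T, ι := Discrete.natTrans (fun i => q i.as) }, ?_, ?_⟩
  · apply Preadditive.epi_of_cancel_zero
    intro Z g hg
    apply hq
    intro i
    have : (colimit.ι ((Functor.const (Discrete (Fin p))).obj A) ⟨i⟩) ≫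
      colimit.desc ((Functor.const (Discrete (Fin p))).obj A)
      { pt := T, ι := Discrete.natTrans (fun i => q i.as) } = q i := by simp
    rw [← this, Category.assoc]
    exact (congrArg _ hg).trans comp_zero
  · intro i f
    let G := CochainComplex.singleFunctor C 0 ⋙ (Q : _ ⥤ DerivedCategory C)
    have hs : ∑ k : Fin p, G.map ((powπ (𝟭 C) k).app A) ≫ G.map ((powι (𝟭 C) k).app A) =
        𝟙 (sg ((powFun (𝟭 C) p).obj A)) := by
      simp only [← Functor.map_comp]
      rw [← Functor.map_sum, pow_sum]
      exact G.map_id _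
    rw [← Category.id_comp f, ← hs, Preadditive.sum_comp]
    refine Finset.sum_eq_zero fun k _ => ?_
    rw [Category.assoc]
    exact (congrArg _ (h i _)).trans comp_zero

end Final

/-- Let `f : Y → X` be a projective morphism of noetherian schemes with
fibers of dimension `≤ n`, `X` affine.  Let `L` be an `f`-ample line bundle generated by
global sections and `a : ℤ`.  If `M ∈ D^b(coh Y)` satisfies `Ext^i(L^{a+j}, M) = 0` for
all `i ∈ ℤ` and all `0 ≤ j ≤ n`, then `M = 0`. -/
theorem stmt1 {C : Type u} [Category.{v} C] [Abelian C] [MonoidalCategory C]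
    [HasDerivedCategory.{w'} C]
    [HasExt.{w} C]
    (n : ℕ)
    -- the fibers of `f` have dimension `≤ n` :
    (hdim : ∀ (T : C) (i : ℕ), n < i → Subsingleton (Abelian.Ext (𝟙_ C) T i))
    -- the powers `L^k` of the line bundle `L` :
    (L : ℤ → C) (hL0 : Nonempty (L 0 ≅ 𝟙_ C))
    (hLadd : ∀ j k : ℤ, Nonempty (L (j + k) ≅ L j ⊗ L k))
    -- `L` is generated by global sections :
    (hLgg : GlobGen (L 1))
    -- `L` is (`f`-)ample: high twists of any coherent sheaf are globally generated :
    (hample : ∀ T : C, ∃ m₀ : ℤ, ∀ m : ℤ, m₀ ≤ m → GlobGen (T ⊗ L m))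
    (a : ℤ)
    -- `M ∈ D^b(coh Y)` :
    (M : CochainComplex C ℤ)
    (hbdd : ∃ N : ℕ, ∀ i : ℤ, (N : ℤ) < |i| → Limits.IsZero (M.homology i))
    -- `Ext^i_Y(L^{a+j}, M) = 0` for all `i` and all `0 ≤ j ≤ n` :
    (hvan : ∀ (i : ℤ) (j : ℕ), j ≤ n →
      Subsingleton ((DerivedCategory.Q.obj
          ((CochainComplex.singleFunctor C 0).obj (L (a + j))) ⟶
        (DerivedCategory.Q.obj M)⟦i⟧))) :
    Limits.IsZero (DerivedCategory.Q.obj M) := by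
  classical
  -- the powers of `L` are invertible
  have hinv : ∀ j k : ℤ, j + k = 0 → Nonempty (L j ⊗ L k ≅ 𝟙_ C) := by
    intro j k h
    obtain ⟨e0⟩ := hL0
    obtain ⟨e1⟩ := hLadd j k
    exact ⟨e1.symm ≪≫ eqToIso (by rw [h]) ≪≫ e0⟩
  -- covers by negative powers
  have hcov : ∀ T : C, ∃ m₀ : ℤ, ∀ m : ℤ, m₀ ≤ m →
      ∃ (p : ℕ) (q : Fin p → (L (-m) ⟶ T)), JEpi q := by
    intro T
    obtain ⟨m₀, h⟩ := hample T
    refine ⟨m₀, fun m hm => ?_⟩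
    obtain ⟨e⟩ := hinv m (-m) (by ring)
    obtain ⟨e'⟩ := hinv (-m) m (by ring)
    exact (h m hm).jepi_twist e e'
  obtain ⟨e⟩ := hinv 1 (-1) (by ring)
  obtain ⟨e'⟩ := hinv (-1) 1 (by ring)
  obtain ⟨m, s, hs⟩ := GlobGen.jepi_twist e e' (hLgg.of_iso (λ_ (L 1)).symm)
  obtain ⟨i1, i2, i3, -⟩ := equiv_props (tensorRight (L (-1))) (tensorRight (L 1))
    (twR _ _ e') (twR _ _ e)
  obtain ⟨j1, j2, j3, -⟩ := equiv_props (tensorRight (L 1)) (tensorRight (L (-1)))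
    (twR _ _ e) (twR _ _ e')
  have i4 : (powFun (tensorRight (L (-1))) m).Additive :=
    Functor.additive_of_preserves_binary_products _
  let α : powFun (tensorRight (L (-1))) m ⟶ 𝟭 C := powDesc (fun i => betaNT (s i))
  have hα : ∀ T, Epi (α.app T) := by
    intro T
    obtain ⟨m₀, h⟩ := hcov T
    obtain ⟨p, q, hq⟩ := h m₀ le_rfl
    obtain ⟨e⟩ := hinv (-m₀) m₀ (by ring)
    obtain ⟨e'⟩ := hinv m₀ (-m₀) (by ring)
    exact alpha_epi s hs T (L (-m₀)) (L m₀) e e' q hq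
  obtain ⟨k1, k2⟩ := kerFun_exact α hα
  -- cohomological dimension
  have hdim' : ∀ (c : ℤ) (T : C) (f : sg (L c) ⟶ (sg T)⟦((n + 1 : ℕ) : ℤ)⟧), f = 0 := by
    intro c
    obtain ⟨e⟩ := hinv c (-c) (by ring)
    obtain ⟨e'⟩ := hinv (-c) c (by ring)
    apply hom_zero_transport (tensorRight (L (-c))) (tensorRight (L c)) (twR _ _ e') (twR _ _ e)
    intro T f
    have h1 := ext_zero (𝟙_ C) T (n + 1) (hdim T (n + 1) (by omega)) ((sgIso e).inv ≫ f)
    rw [← cancel_epi (sgIso e).inv, comp_zero]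
    exact h1
  -- one step
  have hstep : ∀ (c : ℤ), (∀ k : ℕ, 1 ≤ k → k ≤ n + 1 →
      Perp (sg (L (c + k))) (DerivedCategory.Q.obj M)) →
      Perp (sg (L c)) (DerivedCategory.Q.obj M) := by
    intro c hc
    have h0 : c + ((0 : ℕ) : ℤ) = c := by simp
    rw [← h0]
    refine step_perp α hα (fun k => L (c + k)) ?_ (n + 1) (hdim' _) _ hc
    intro k M' hM'
    obtain ⟨u⟩ := hLadd (c + k) 1
    have v : L (c + ((k + 1 : ℕ) : ℤ)) ≅ L (c + k) ⊗ L 1 :=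
      eqToIso (by congr 1; push_cast; ring) ≪≫ u
    have h1 : Perp (sg ((tensorRight (L 1)).obj (L (c + k)))) (DerivedCategory.Q.obj M') :=
      hM'.of_iso_left (sgIso v)
    have h2 := Perp.transport (tensorRight (L (-1))) (tensorRight (L 1)) (twR _ _ e')
      (twR _ _ e) h1
    have h3 := h2.of_iso ((tensorRight (L (-1))).mapDerivedCategoryFactors.app M')
    exact Perp.pow (tensorRight (L (-1))) m h3
  have hall : ∀ (r : ℕ) (c : ℤ), a - r ≤ c → c ≤ a + n →
      Perp (sg (L c)) (DerivedCategory.Q.obj M) := by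
    intro r
    induction r with
    | zero =>
      intro c hc hc'
      obtain ⟨j, rfl⟩ : ∃ j : ℕ, c = a + j := ⟨(c - a).toNat, by push_cast at hc; omega⟩
      intro i f
      have := hvan i j (by omega)
      exact Subsingleton.elim _ _
    | succ r ih =>
      intro c hc hc'
      by_cases h : a - r ≤ c
      · exact ih c h hc'
      · apply hstep
        intro k hk hk'
        push_cast at hc
        exact ih _ (by omega) (by omega)
  obtain ⟨N, hN⟩ := hbdd
  have hGE : (DerivedCategory.Q.obj M).IsGE (-(N : ℤ)) :=
    isGE_of_homology M _ (fun i hi => hN i (by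
      rw [abs_of_neg (by omega)]
      omega))
  refine isZero_of_homology M (homology_zero_of_perp M
    (all_perp (DerivedCategory.Q.obj M) (-(N : ℤ)) ?_))
  intro T
  obtain ⟨m₀, h⟩ := hcov T
  obtain ⟨p, q, hq⟩ := h (max m₀ (-a)) (le_max_left _ _)
  refine cover_perp q hq _ (hall (a + max m₀ (-a)).toNat _ ?_ ?_)
  · have := le_max_right m₀ (-a)
    omega
  · have := le_max_right m₀ (-a)
    omega
end

section
/- Let R be a normal Gorenstein complete local domain of dimension n ≥ 3 which is finite free of rank two over a regular complete local ring P. Let I be a rank one reflexive R-module of depth ≥ n−1. Then the kernel K of the natural surjection R ⊗_P I → I is a rank one reflexive R-module isomorphic to I^{-1} in the class group Cl(R). -/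
open CategoryTheory IsLocalRing RingTheory.Sequence

attribute [local instance] HasDerivedCategory.standard
attribute [local instance] CategoryTheory.hasExt_of_hasDerivedCategory

/-- A regular local ring: noetherian local and the maximal ideal is generated by
`dim` many elements. -/
def IsRegLocal (P : Type) [CommRing P] [IsLocalRing P] : Prop :=
  IsNoetherianRing P ∧ ∃ s : Finset P,
    Ideal.span (s : Set P) = maximalIdeal P ∧ (s.card : WithBot (WithTop ℕ)) = ringKrullDim P

/-- A Gorenstein local ring: noetherian local, and `Ext^i(k, R)` vanishes for `i ≠ d` and is
nontrivial for a single `d` (equivalently, `R` has finite injective dimension over itself). -/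
def IsGorLocal (R : Type) [CommRing R] [IsLocalRing R] : Prop :=
  IsNoetherianRing R ∧ ∃ d : ℕ,
    (∀ i : ℕ, i ≠ d → Subsingleton
      (Abelian.Ext (ModuleCat.of R (ResidueField R)) (ModuleCat.of R R) i)) ∧
    Nontrivial (Abelian.Ext (ModuleCat.of R (ResidueField R)) (ModuleCat.of R R) d)

/-- `depth M ≥ c`: there is an `M`-regular sequence of length `c` of nonunits. -/
def DepthGE (R : Type) [CommRing R] (M : Type) [AddCommGroup M] [Module R M] (c : ℕ) : Prop :=
  ∃ rs : List R, rs.length = c ∧ (∀ r ∈ rs, r ∈ nonunits R) ∧ IsRegular M rs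

lemma aux_map_max {P : Type} [CommRing P] [IsLocalRing P] (x : P) (hx : x ∈ maximalIdeal P)
    [IsLocalRing (P ⧸ Ideal.span {x})] :
    (maximalIdeal P).map (Ideal.Quotient.mk (Ideal.span {x})) =
      maximalIdeal (P ⧸ Ideal.span {x}) := by
  have hs := Ideal.Quotient.mk_surjective (I := Ideal.span {x})
  rcases Ideal.map_eq_top_or_isMaximal_of_surjective _ hs
    (inferInstance : (maximalIdeal P).IsMaximal) with h | h
  · exfalso
    have h1 := congrArg (Ideal.comap (Ideal.Quotient.mk (Ideal.span {x}))) h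
    rw [Ideal.comap_map_of_surjective _ hs, ← RingHom.ker_eq_comap_bot, Ideal.mk_ker,
      Ideal.comap_top, sup_eq_left.mpr ((Ideal.span_singleton_le_iff_mem _).mpr hx)] at h1
    exact (inferInstance : (maximalIdeal P).IsMaximal).ne_top h1
  · exact IsLocalRing.eq_maximalIdeal h

lemma aux_local {P : Type} [CommRing P] [IsLocalRing P] (x : P) (hx : x ∈ maximalIdeal P) :
    IsLocalRing (P ⧸ Ideal.span {x}) := by
  have : Nontrivial (P ⧸ Ideal.span {x}) := by
    apply Ideal.Quotient.nontrivial_iff.mpr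
    rw [Ne, Ideal.span_singleton_eq_top]
    exact hx
  exact IsLocalRing.of_surjective' _ Ideal.Quotient.mk_surjective

lemma aux_reg_quot {P : Type} [CommRing P] [IsRegularLocalRing P] (d : ℕ)
    (hd : ringKrullDim P = (d + 1 : ℕ)) (x : P) (hx : x ∈ maximalIdeal P)
    (hx2 : x ∉ maximalIdeal P ^ 2) :
    IsRegularLocalRing (P ⧸ Ideal.span {x}) ∧ ringKrullDim (P ⧸ Ideal.span {x}) = d := by
  have := aux_local x hx
  have h1 : ringKrullDim P ≤ ringKrullDim (P ⧸ Ideal.span {x}) + 1 := by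
    have := ringKrullDim_le_ringKrullDim_quotient_add_card (R := P) {x} (by
      rw [IsLocalRing.ringJacobson_eq_maximalIdeal]; simpa using hx)
    rw [Finset.coe_singleton, Finset.card_singleton, Nat.cast_one] at this
    exact this
  have hfr : Module.finrank (ResidueField P) (CotangentSpace P) = d + 1 := by
    have := (IsRegularLocalRing.iff_finrank_cotangentSpace P).mp inferInstance
    rw [hd] at this
    exact_mod_cast this
  have h2 : (maximalIdeal (P ⧸ Ideal.span {x})).spanFinrank ≤ d := by
    let v : CotangentSpace P := (maximalIdeal P).toCotangent ⟨x, hx⟩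
    have hv : v ≠ 0 := fun h => hx2 (((maximalIdeal P).toCotangent_eq_zero _).mp h)
    have hli : LinearIndepOn (ResidueField P) id ({v} : Set (CotangentSpace P)) :=
      LinearIndepOn.singleton hv
    let B := Module.Basis.extend hli
    have hB : ∀ i, B i = i.1 := fun i => Module.Basis.extend_apply_self hli i
    let ι := hli.extend (Set.subset_univ _)
    have hvι : v ∈ ι := hli.subset_extend _ rfl
    have hfin : Fintype ι := Module.Basis.fintypeIndexOfRankLtAleph0 B (Module.rank_lt_aleph0 _ _)
    have hcard : Fintype.card ι = d + 1 := by rw [← hfr, Module.finrank_eq_card_basis B]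
    have hlift : ∀ i : ι, ∃ y : maximalIdeal P, (maximalIdeal P).toCotangent y = i.1 ∧
        (i.1 = v → y = ⟨x, hx⟩) := by
      intro i
      by_cases h : i.1 = v
      · exact ⟨⟨x, hx⟩, h.symm, fun _ => rfl⟩
      · obtain ⟨y, hy⟩ := (maximalIdeal P).toCotangent_surjective i.1
        exact ⟨y, hy, fun h' => absurd h' h⟩
    choose y hy hyv using hlift
    have hspan : Submodule.span P (Set.range y) = ⊤ := by
      rw [← CotangentSpace.span_image_eq_top_iff, ← Set.range_comp]
      have : ((maximalIdeal P).toCotangent ∘ y) = B := by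
        ext i; rw [hB]; exact hy i
      rw [this]; exact B.span_eq
    have hspan2 : Ideal.span (Set.range fun i => (y i : P)) = maximalIdeal P := by
      have := congrArg (Submodule.map (Submodule.subtype (maximalIdeal P))) hspan
      rw [Submodule.map_span, ← Set.range_comp, Submodule.map_subtype_top] at this
      exact this
    let S : Set (P ⧸ Ideal.span {x}) :=
      (fun i => Ideal.Quotient.mk (Ideal.span {x}) (y i : P)) '' {i | i ≠ ⟨v, hvι⟩}
    have hS : Ideal.span S = maximalIdeal (P ⧸ Ideal.span {x}) := by
      rw [← aux_map_max x hx, ← hspan2, Ideal.map_span, ← Set.range_comp]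
      apply le_antisymm
      · apply Ideal.span_mono
        rintro _ ⟨i, -, rfl⟩
        exact ⟨i, rfl⟩
      · rw [Ideal.span_le]
        rintro _ ⟨i, rfl⟩
        by_cases h : i = ⟨v, hvι⟩
        · have : (y i : P) = x := by rw [hyv i (by rw [h])]
          simp only [Function.comp_apply, this]
          rw [Ideal.Quotient.eq_zero_iff_mem.mpr (Ideal.mem_span_singleton_self x)]
          exact zero_mem _
        · exact Ideal.subset_span ⟨i, h, rfl⟩
    rw [← hS]
    refine (Submodule.spanFinrank_span_le_ncard_of_finite (Set.toFinite S)).trans ?_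
    refine (Set.ncard_image_le (Set.toFinite _)).trans ?_
    have : ({i | i ≠ ⟨v, hvι⟩} : Set ι) = {⟨v, hvι⟩}ᶜ := rfl
    rw [this, Set.ncard_compl, Set.ncard_singleton, Nat.card_eq_fintype_card, hcard]
    simp
  have h3 := ringKrullDim_le_spanFinrank_maximalIdeal (P ⧸ Ideal.span {x})
  have h4 : ((maximalIdeal (P ⧸ Ideal.span {x})).spanFinrank : WithBot ℕ∞) ≤ d := by
    exact_mod_cast h2
  have h5 : (d : WithBot ℕ∞) ≤ ringKrullDim (P ⧸ Ideal.span {x}) := by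
    rw [hd] at h1
    push_cast at h1
    exact ENat.WithBot.add_le_add_one_right_iff.mp h1
  refine ⟨IsRegularLocalRing.of_spanFinrank_maximalIdeal_le _ (h4.trans h5),
    le_antisymm (h3.trans h4) h5⟩

lemma aux_sq_lt {P : Type} [CommRing P] [IsRegularLocalRing P] (d : ℕ)
    (hd : ringKrullDim P = (d + 1 : ℕ)) : ¬ maximalIdeal P ≤ maximalIdeal P ^ 2 := by
  intro h
  have hb : maximalIdeal P = ⊥ := by
    apply Submodule.eq_bot_of_le_smul_of_le_jacobson_bot (maximalIdeal P) _
      (IsNoetherian.noetherian _)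
    · rw [smul_eq_mul, ← pow_two]; exact h
    · exact IsLocalRing.maximalIdeal_le_jacobson _
  have := ringKrullDim_eq_zero_of_isField (IsLocalRing.isField_iff_maximalIdeal_eq.mpr hb)
  rw [hd] at this
  exact absurd (by exact_mod_cast this) (Nat.succ_ne_zero d)

lemma aux_avoid {P : Type} [CommRing P] [IsLocalRing P] (S : Set (Ideal P)) (hS : S.Finite)
    (hp : ∀ p ∈ S, p.IsPrime ∧ ¬ maximalIdeal P ≤ p)
    (h : ¬ maximalIdeal P ≤ maximalIdeal P ^ 2) :
    ∃ x ∈ maximalIdeal P, x ∉ maximalIdeal P ^ 2 ∧ ∀ p ∈ S, x ∉ p := by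
  by_contra! hc
  have := (Ideal.subset_union_prime_finite (s := insert (maximalIdeal P ^ 2) S) (hS.insert _)
    (f := id) (maximalIdeal P ^ 2) (maximalIdeal P ^ 2) (I := maximalIdeal P) (by
      rintro i (rfl | hi) h1 _
      · exact absurd rfl h1
      · exact (hp i hi).1)).mp (by
      intro x hx
      by_cases h2 : x ∈ maximalIdeal P ^ 2
      · exact Set.mem_biUnion (Set.mem_insert _ _) h2
      · obtain ⟨p, hpS, hxp⟩ := hc x hx h2
        exact Set.mem_biUnion (Set.mem_insert_of_mem _ hpS) hxp)
  obtain ⟨i, rfl | hi, hle⟩ := this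
  · exact h hle
  · exact (hp i hi).2 hle

lemma aux_reg_domain (d : ℕ) : ∀ (P : Type) [CommRing P] [IsRegularLocalRing P],
    ringKrullDim P = d → IsDomain P := by
  induction d with
  | zero =>
    intro P _ _ hd
    have hb : maximalIdeal P = ⊥ := by
      have h1 := (inferInstance : IsRegularLocalRing P).spanFinrank_maximalIdeal
      rw [hd] at h1
      have h2 : (maximalIdeal P).spanFinrank = 0 := by exact_mod_cast h1
      exact (Submodule.spanFinrank_eq_zero_iff_eq_bot (IsNoetherian.noetherian _)).mp h2
    exact (IsLocalRing.isField_iff_maximalIdeal_eq.mpr hb).isDomain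
  | succ d ih =>
    intro P _ _ hd
    obtain ⟨x, hx, hx2, hxm⟩ := aux_avoid (minimalPrimes P)
      (minimalPrimes.finite_of_isNoetherianRing P) (by
        intro p hp
        refine ⟨hp.1.1, fun hle => ?_⟩
        have hpp := hp.1.1
        have : Ring.KrullDimLE 0 P := by
          rw [Ring.krullDimLE_zero_iff]
          intro I hI
          have h1 : I ≤ p := (IsLocalRing.le_maximalIdeal hI.ne_top).trans hle
          have h2 : p ≤ I := hp.2 ⟨hI, bot_le⟩ h1
          have h3 : I = maximalIdeal P :=
            le_antisymm (IsLocalRing.le_maximalIdeal hI.ne_top) (hle.trans h2)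
          rw [h3]; infer_instance
        have h4 : ringKrullDim P ≤ 0 := (Ring.krullDimLE_iff (n := 0)).mp this
        rw [hd] at h4
        have h5 : d + 1 ≤ 0 := by exact_mod_cast h4
        omega) (aux_sq_lt d hd)
    obtain ⟨hreg, hdim⟩ := aux_reg_quot d hd x hx hx2
    have hdom := ih (P ⧸ Ideal.span {x}) hdim
    have hprime : (Ideal.span {x}).IsPrime := (Ideal.Quotient.isDomain_iff_prime _).mp hdom
    obtain ⟨q, hq, hqx⟩ := Ideal.exists_minimalPrimes_le (I := (⊥ : Ideal P))
      (J := Ideal.span {x}) bot_le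
    have hqp := hq.1.1
    have hqb : q = ⊥ := by
      apply Submodule.eq_bot_of_le_smul_of_le_jacobson_bot (maximalIdeal P) _
        (IsNoetherian.noetherian _) ?_ (IsLocalRing.maximalIdeal_le_jacobson _)
      intro z hz
      obtain ⟨w, rfl⟩ := Ideal.mem_span_singleton.mp (hqx hz)
      have hw : w ∈ q := (hqp.mem_or_mem hz).resolve_left (hxm q hq)
      exact Submodule.smul_mem_smul hx hw
    rw [hqb] at hqp
    exact IsDomain.of_bot_isPrime P

open Pointwise in
lemma aux_depth_quot {A : Type} [CommRing A] [IsLocalRing A] [IsNoetherianRing A]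
    (M : Type) [AddCommGroup M] [Module A M] [Module.Finite A M] (c : ℕ) (rs : List A)
    (hlen : rs.length = c + 1) (hmem : ∀ r ∈ rs, r ∈ maximalIdeal A) (hrs : IsRegular M rs)
    (y : A) (hy : y ∈ maximalIdeal A) (hreg : IsSMulRegular M y) :
    ∃ rs' : List A, rs'.length = c ∧ (∀ r ∈ rs', r ∈ maximalIdeal A) ∧
      IsRegular (QuotSMulTop y M) rs' := by
  have hnt : Nontrivial M := hrs.nontrivial
  have hlt : ∀ (L : Type) [AddCommGroup L] [Module A L] [Module.Finite A L] [Nontrivial L],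
      maximalIdeal A • (⊤ : Submodule A L) < ⊤ := by
    intro L _ _ _ _
    exact (Submodule.top_ne_ideal_smul_of_le_jacobson_annihilator
      ((IsLocalRing.maximalIdeal_le_jacobson _))).symm.lt_top
  have hntq : Nontrivial (QuotSMulTop y M) := nontrivial_quotSMulTop_of_mem_maximalIdeal _ hy
  have hsupp : Module.support A (ModuleCat.of A (A ⧸ maximalIdeal A)) =
      PrimeSpectrum.zeroLocus (maximalIdeal A) := by
    rw [Module.support_eq_zeroLocus, Ideal.annihilator_quotient]
  have hext := ModuleCat.subsingleton_ext_of_exists_isRegular (maximalIdeal A)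
    (ModuleCat.of A (A ⧸ maximalIdeal A)) hsupp.subset (ModuleCat.of A M) (hlt M) rs hmem hrs
  refine ModuleCat.exists_isRegular_of_exists_subsingleton_ext (maximalIdeal A) c
    (ModuleCat.of A (QuotSMulTop y M)) (hlt _) (ModuleCat.of A (A ⧸ maximalIdeal A)) hsupp ?_
  intro i hi
  have zero1 := AddCommGrpCat.isZero_of_iff_subsingleton.mpr (hext i (by omega))
  have zero2 := AddCommGrpCat.isZero_of_iff_subsingleton.mpr (hext (i + 1) (by omega))
  exact AddCommGrpCat.subsingleton_of_isZero <| ShortComplex.Exact.isZero_of_both_zeros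
    ((Abelian.Ext.covariant_sequence_exact₃' (ModuleCat.of A (A ⧸ maximalIdeal A))
      (IsSMulRegular.smulShortComplex_shortExact (M := ModuleCat.of A M) hreg)) i (i + 1) rfl)
    (zero1.eq_zero_of_src _) (zero2.eq_zero_of_tgt _)

/-- transfer of regular sequences along a finite local extension -/
lemma aux_change {P R : Type} [CommRing P] [IsLocalRing P] [IsNoetherianRing P]
    [CommRing R] [IsLocalRing R] [Algebra P R] [Module.Finite P R] (c : ℕ) :
    ∀ (M : Type) [AddCommGroup M] [Module R M] [Module P M] [IsScalarTower P R M]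
    [Module.Finite R M] (rs : List R), rs.length = c → (∀ r ∈ rs, r ∈ maximalIdeal R) →
    IsRegular M rs → ∃ ps : List P, ps.length = c ∧ (∀ r ∈ ps, r ∈ maximalIdeal P) ∧
      IsWeaklyRegular M (ps.map (algebraMap P R)) := by
  have hnR : IsNoetherianRing R := IsNoetherianRing.of_finite P R
  have hint : Algebra.IsIntegral P R := inferInstance
  have hcomap : (maximalIdeal R).comap (algebraMap P R) = maximalIdeal P := by
    have : ((maximalIdeal R).comap (algebraMap P R)).IsMaximal :=
      Ideal.isMaximal_comap_of_isIntegral_of_isMaximal (maximalIdeal R)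
    exact IsLocalRing.eq_maximalIdeal this
  have hrad : ∀ r ∈ maximalIdeal R, ∃ k : ℕ,
      r ^ k ∈ (maximalIdeal P).map (algebraMap P R) := by
    intro r hr
    suffices r ∈ ((maximalIdeal P).map (algebraMap P R)).radical from this
    rw [Ideal.radical_eq_sInf, Ideal.mem_sInf]
    intro J hJJ
    have hJ : (maximalIdeal P).map (algebraMap P R) ≤ J := hJJ.1
    have hJp : J.IsPrime := hJJ.2
    have h1 : maximalIdeal P ≤ J.comap (algebraMap P R) := Ideal.map_le_iff_le_comap.mp hJ
    have h2 : J.comap (algebraMap P R) = maximalIdeal P :=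
      le_antisymm (IsLocalRing.le_maximalIdeal (hJp.comap _).ne_top) h1
    have h3 : J.IsMaximal := by
      apply Ideal.isMaximal_of_isIntegral_of_isMaximal_comap (R := P)
      rw [h2]; infer_instance
    rw [IsLocalRing.eq_maximalIdeal h3]; exact hr
  induction c with
  | zero =>
    intro M _ _ _ _ _ rs _ _ _
    exact ⟨[], rfl, by simp, by simp⟩
  | succ c ih =>
    intro M _ _ _ _ _ rs hlen hmem hrs
    have hfP : Module.Finite P M := Module.Finite.trans R M
    have hy : ∃ y ∈ maximalIdeal P, IsSMulRegular M y := by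
      by_contra! hc
      match rs, hlen with
      | r :: rs', _ =>
        have hrr : IsSMulRegular M r := ((isRegular_cons_iff M r rs').mp hrs).1
        obtain ⟨p, hpA, hp⟩ := (Ideal.subset_union_prime_finite (associatedPrimes.finite P M)
          (f := id) ⊥ ⊥ (I := maximalIdeal P)
          (fun i hi _ _ => IsAssociatedPrime.isPrime hi)).mp (by
            have := biUnion_associatedPrimes_eq_compl_regular P M
            simp only [id]
            rw [this]
            exact fun y hy => hc y hy)
        have hpm : p = maximalIdeal P := le_antisymm
          (IsLocalRing.le_maximalIdeal (IsAssociatedPrime.isPrime hpA).ne_top) hp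
        obtain ⟨z, hz0, hz⟩ : ∃ z : M, z ≠ 0 ∧ ∀ a ∈ maximalIdeal P, a • z = 0 := by
          obtain ⟨hp1, f, hf⟩ := (isAssociatedPrime_iff_exists_injective_linearMap p M).mp hpA
          refine ⟨f (Ideal.Quotient.mk p 1), ?_, ?_⟩
          · intro h0
            have h1 : Ideal.Quotient.mk p 1 = 0 := hf (by rw [h0, map_zero])
            exact hp1.ne_top ((Ideal.eq_top_iff_one p).mpr (Ideal.Quotient.eq_zero_iff_mem.mp h1))
          · intro a ha
            rw [← map_smul]
            have : a • (Ideal.Quotient.mk p 1) = 0 := by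
              rw [← Ideal.Quotient.mk_eq_mk, ← Submodule.Quotient.mk_smul, smul_eq_mul, mul_one,
                Ideal.Quotient.mk_eq_mk]
              exact Ideal.Quotient.eq_zero_iff_mem.mpr (hp ha)
            rw [this, map_zero]
        obtain ⟨k, hk⟩ := hrad r (hmem r (by simp))
        have hle : (maximalIdeal P).map (algebraMap P R) ≤ LinearMap.ker (LinearMap.toSpanSingleton R M z) := by
          rw [Ideal.map_le_iff_le_comap]
          intro a ha
          change algebraMap P R a • z = 0
          rw [algebraMap_smul]
          exact hz a ha
        have h1 : r ^ k • z = 0 := hle hk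
        exact hz0 ((hrr.pow k).right_eq_zero_of_smul h1)
    obtain ⟨y, hym, hyr⟩ := hy
    have hyR : IsSMulRegular M (algebraMap P R y) := by
      intro a b hab
      simp only [algebraMap_smul] at hab
      exact hyr hab
    have hyRm : algebraMap P R y ∈ maximalIdeal R := by
      rw [← hcomap] at hym; exact hym
    obtain ⟨rs', hl', hm', hr'⟩ := aux_depth_quot M c rs hlen hmem hrs _ hyRm hyR
    obtain ⟨ps, hpl, hpm, hpr⟩ := ih (QuotSMulTop (algebraMap P R y) M) rs' hl' hm' hr'
    refine ⟨y :: ps, by simp [hpl], ?_, ?_⟩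
    · exact List.forall_mem_cons.mpr ⟨hym, hpm⟩
    · rw [List.map_cons, isWeaklyRegular_cons_iff]
      exact ⟨hyR, hpr⟩

/-- Over a regular local ring of dimension `n + 1`, a finite module with a regular sequence of
length `n` has free first syzygies. -/
lemma aux_syz (n : ℕ) : ∀ (P : Type) [CommRing P] [IsRegularLocalRing P],
    ringKrullDim P = (n + 1 : ℕ) → ∀ (M F : Type) [AddCommGroup M] [Module P M]
    [Module.Finite P M] [AddCommGroup F] [Module P F] [Module.Finite P F] [Module.Free P F]
    (rs : List P), rs.length = n → (∀ r ∈ rs, r ∈ maximalIdeal P) → IsRegular M rs →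
    ∀ (f : F →ₗ[P] M), Function.Surjective f → Module.Free P (LinearMap.ker f) := by
  induction n with
  | zero =>
    intro P _ _ hdim M F _ _ _ _ _ _ _ rs _ _ _ f _
    have hdom : IsDomain P := aux_reg_domain 1 P (by simpa using hdim)
    have hpid : IsPrincipalIdealRing P := by
      have hfr : Module.finrank (ResidueField P) (CotangentSpace P) = 1 := by
        have := (IsRegularLocalRing.iff_finrank_cotangentSpace P).mp inferInstance
        rw [hdim] at this
        exact_mod_cast this
      exact ((tfae_of_isNoetherianRing_of_isLocalRing_of_isDomain P).out 0 5).mpr hfr.le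
    infer_instance
  | succ n ih =>
    intro P _ _ hdim M F _ _ _ _ _ _ _ rs hlen hmem hrs f hf
    have hdom : IsDomain P := aux_reg_domain (n + 2) P hdim
    obtain ⟨x, hx, hx2, hxA⟩ := aux_avoid (associatedPrimes P M) (associatedPrimes.finite P M) (by
      intro p hp
      refine ⟨IsAssociatedPrime.isPrime hp, fun hle => ?_⟩
      match rs, hlen with
      | r :: rs', _ =>
        have hrr : IsSMulRegular M r := ((isRegular_cons_iff M r rs').mp hrs).1
        have h1 : r ∈ ⋃ p ∈ associatedPrimes P M, (p : Set P) :=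
          Set.mem_biUnion hp (hle (hmem r (by simp)))
        rw [biUnion_associatedPrimes_eq_compl_regular] at h1
        exact h1 hrr) (aux_sq_lt (n + 1) hdim)
    have hxM : IsSMulRegular M x := by
      by_contra hc
      have h1 : x ∈ ⋃ p ∈ associatedPrimes P M, (p : Set P) := by
        rw [biUnion_associatedPrimes_eq_compl_regular]; exact hc
      obtain ⟨p, hp, hxp⟩ := Set.mem_iUnion₂.mp h1
      exact hxA p hp hxp
    have hx0 : x ≠ 0 := fun h => hx2 (h ▸ zero_mem _)
    have hxF : IsSMulRegular F x := by
      intro a b hab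
      exact smul_right_injective F hx0 hab
    have hxN : IsSMulRegular (LinearMap.ker f) x := hxF.submodule _ x
    obtain ⟨hreg, hdim'⟩ := aux_reg_quot (n + 1) hdim x hx hx2
    obtain ⟨rs', hl', hm', hr'⟩ := aux_depth_quot M n rs hlen hmem hrs x hx hxM
    let Q := P ⧸ Ideal.span {x}
    have hnt : Nontrivial (QuotSMulTop x M) := hr'.nontrivial
    have hsurj : Function.Surjective (algebraMap P Q) := Ideal.Quotient.mk_surjective
    have hfQ : Module.Finite Q (QuotSMulTop x M) :=
      Module.Finite.of_restrictScalars_finite P Q (QuotSMulTop x M)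
    have hfQ' : Module.Finite Q (QuotSMulTop x F) :=
      Module.Finite.of_restrictScalars_finite P Q (QuotSMulTop x F)
    have hmQ : ∀ r ∈ rs'.map (algebraMap P Q), r ∈ maximalIdeal Q := by
      intro r hr
      obtain ⟨r', hr', rfl⟩ := List.mem_map.mp hr
      rw [← aux_map_max x hx]
      exact Ideal.mem_map_of_mem _ (hm' r' hr')
    have hrQ : IsRegular (QuotSMulTop x M) (rs'.map (algebraMap P Q)) := by
      rw [IsLocalRing.isRegular_iff_isWeaklyRegular_of_subset_maximalIdeal hmQ,
        isWeaklyRegular_map_algebraMap_iff]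
      exact hr'.toIsWeaklyRegular
    let g := QuotSMulTop.map x f
    have hg : Function.Surjective g := QuotSMulTop.map_surjective x hf
    let gQ : QuotSMulTop x F →ₗ[Q] QuotSMulTop x M :=
      LinearMap.extendScalarsOfSurjective hsurj g
    have hgQ : Function.Surjective gQ := hg
    have hfree := ih Q hdim' (QuotSMulTop x M) (QuotSMulTop x F) (rs'.map (algebraMap P Q))
      (by simp [hl']) hmQ hrQ gQ hgQ
    let ι := QuotSMulTop.map x (LinearMap.ker f).subtype
    have hex : Function.Exact ι g :=
      QuotSMulTop.map_exact x (LinearMap.exact_subtype_ker_map f) hf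
    have hinj : Function.Injective ι := by
      have h1 : Function.Exact (0 : PUnit →ₗ[P] LinearMap.ker f) (LinearMap.ker f).subtype := by
        intro z
        simp
        exact eq_comm
      have := QuotSMulTop.map_first_exact_on_four_term_exact_of_isSMulRegular_last
        h1 (LinearMap.exact_subtype_ker_map f) hxM
      rw [← LinearMap.ker_eq_bot, eq_bot_iff]
      intro z hz
      obtain ⟨w, rfl⟩ := (this z).mp hz
      simp
    let ιQ : QuotSMulTop x (LinearMap.ker f) →ₗ[Q] QuotSMulTop x F :=
      LinearMap.extendScalarsOfSurjective hsurj ι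
    have hker : LinearMap.range ιQ = LinearMap.ker gQ := by
      ext z
      exact (hex z).symm
    let e : QuotSMulTop x (LinearMap.ker f) ≃ₗ[Q] LinearMap.ker gQ :=
      (LinearEquiv.ofInjective ιQ hinj).trans (LinearEquiv.ofEq _ _ hker)
    have hfree' : Module.Free Q (QuotSMulTop x (LinearMap.ker f)) := Module.Free.of_equiv e.symm
    have hfp : Module.FinitePresentation P (LinearMap.ker f) :=
      Module.finitePresentation_of_finite P _
    exact (Module.free_quotSMulTop_iff_free P (LinearMap.ker f)
      (IsLocalRing.maximalIdeal_le_jacobson _ hx) hxN).mp hfree'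

section DetForm

variable {A : Type} [CommRing A] {κ : Type} [Fintype κ] [DecidableEq κ]

lemma aux_upd0 (n : κ → (κ ⊕ Fin 2 → A)) (x y : κ ⊕ Fin 2 → A) :
    (Sum.elim n ![x, y] : κ ⊕ Fin 2 → (κ ⊕ Fin 2 → A)) =
      Function.update (Sum.elim n ![0, y]) (Sum.inr 0) x := by
  funext i
  rcases i with i | i
  · simp
  · fin_cases i <;> simp [Function.update]

lemma aux_upd1 (n : κ → (κ ⊕ Fin 2 → A)) (x y : κ ⊕ Fin 2 → A) :
    (Sum.elim n ![x, y] : κ ⊕ Fin 2 → (κ ⊕ Fin 2 → A)) =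
      Function.update (Sum.elim n ![x, 0]) (Sum.inr 1) y := by
  funext i
  rcases i with i | i
  · simp
  · fin_cases i <;> simp [Function.update]

/-- the alternating form `det (n, x, y)` -/
noncomputable def auxDetForm (n : κ → (κ ⊕ Fin 2 → A)) :
    (κ ⊕ Fin 2 → A) →ₗ[A] (κ ⊕ Fin 2 → A) →ₗ[A] A :=
  LinearMap.mk₂ A (fun x y => Matrix.detRowAlternating (Sum.elim n ![x, y]))
    (by
      intro x x' y
      rw [aux_upd0, AlternatingMap.map_update_add, ← aux_upd0, ← aux_upd0])
    (by
      intro c x y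
      rw [aux_upd0, AlternatingMap.map_update_smul, ← aux_upd0])
    (by
      intro x x' y
      rw [aux_upd1, AlternatingMap.map_update_add, ← aux_upd1, ← aux_upd1])
    (by
      intro c x y
      rw [aux_upd1, AlternatingMap.map_update_smul, ← aux_upd1])

lemma auxDetForm_apply (n : κ → (κ ⊕ Fin 2 → A)) (x y : κ ⊕ Fin 2 → A) :
    auxDetForm n x y = Matrix.det (Matrix.of (Sum.elim n ![x, y])) := rfl

lemma auxDetForm_self (n : κ → (κ ⊕ Fin 2 → A)) (x : κ ⊕ Fin 2 → A) :
    auxDetForm n x x = 0 := by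
  apply Matrix.detRowAlternating.map_eq_zero_of_eq (i := Sum.inr 0) (j := Sum.inr 1)
  · simp
  · simp

lemma auxDetForm_left (n : κ → (κ ⊕ Fin 2 → A)) (i : κ) (y : κ ⊕ Fin 2 → A) :
    auxDetForm n (n i) y = 0 := by
  apply Matrix.detRowAlternating.map_eq_zero_of_eq (i := Sum.inr 0) (j := Sum.inl i)
  · simp
  · simp

lemma auxDetForm_right (n : κ → (κ ⊕ Fin 2 → A)) (i : κ) (x : κ ⊕ Fin 2 → A) :
    auxDetForm n x (n i) = 0 := by
  apply Matrix.detRowAlternating.map_eq_zero_of_eq (i := Sum.inr 1) (j := Sum.inl i)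
  · simp
  · simp

lemma auxDetForm_map {B : Type} [CommRing B] (ρ : A →+* B) (n : κ → (κ ⊕ Fin 2 → A))
    (x y : κ ⊕ Fin 2 → A) :
    ρ (auxDetForm n x y) = auxDetForm (fun i => ρ ∘ n i) (ρ ∘ x) (ρ ∘ y) := by
  rw [auxDetForm_apply, auxDetForm_apply, RingHom.map_det]
  congr 1
  ext i j
  rcases i with i | i
  · simp
  · fin_cases i <;> simp

lemma aux_field {K : Type} [Field K] (n : κ → (κ ⊕ Fin 2 → K)) (h : LinearIndependent K n) :
    auxDetForm n ≠ 0 := by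
  intro h0
  let W := Submodule.span K (Set.range n)
  have hW : Module.finrank K W = Fintype.card κ := finrank_span_eq_card h
  have hQ : Module.finrank K ((κ ⊕ Fin 2 → K) ⧸ W) = 2 := by
    have := W.finrank_quotient_add_finrank
    rw [hW, Module.finrank_fintype_fun_eq_card, Fintype.card_sum, Fintype.card_fin] at this
    omega
  let b := Module.finBasisOfFinrankEq K _ hQ
  obtain ⟨u, hu⟩ : ∃ u : Fin 2 → (κ ⊕ Fin 2 → K), ∀ i, W.mkQ (u i) = b i :=
    ⟨fun i => (W.mkQ_surjective (b i)).choose, fun i => (W.mkQ_surjective (b i)).choose_spec⟩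
  have hli : LinearIndependent K (Sum.elim n u) := by
    have hn' : LinearIndependent K (fun i => (⟨n i, Submodule.subset_span ⟨i, rfl⟩⟩ : W)) :=
      LinearIndependent.of_comp W.subtype h
    have hu' : LinearIndependent K (Submodule.Quotient.mk (p := W) ∘ u) := by
      have : (Submodule.Quotient.mk (p := W) ∘ u) = b := funext hu
      rw [this]; exact b.linearIndependent
    exact hn'.sumElim_of_quotient (M' := W) u hu'
  have hu2 : u = ![u 0, u 1] := by
    funext i; fin_cases i <;> rfl
  rw [hu2] at hli
  have h1 : IsUnit (Matrix.of (Sum.elim n ![u 0, u 1])) :=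
    Matrix.linearIndependent_rows_iff_isUnit.mp hli
  rw [Matrix.isUnit_iff_isUnit_det, ← auxDetForm_apply, h0] at h1
  simp at h1

end DetForm

lemma aux_form {P : Type} [CommRing P] [IsDomain P] [IsNoetherianRing P]
    {κ : Type} [Fintype κ] [DecidableEq κ] (I : Type) [AddCommGroup I] [Module P I]
    (htf : ∀ (d : P) (x : I), d ≠ 0 → d • x = 0 → x = 0)
    (f : (κ ⊕ Fin 2 → P) →ₗ[P] I) (hf : Function.Surjective f)
    (bN : Module.Basis κ P (LinearMap.ker f)) :
    ∃ φ : I →ₗ[P] I →ₗ[P] P, (∀ x, φ x x = 0) ∧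
      ∀ d c : P, d ≠ 0 → (∀ x y, d ∣ c * φ x y) → d ∣ c := by
  let n : κ → (κ ⊕ Fin 2 → P) := fun i => (bN i).1
  let Φ := auxDetForm n
  have hl : ∀ x ∈ LinearMap.ker f, Φ x = 0 := by
    have : Φ ∘ₗ (LinearMap.ker f).subtype = 0 := by
      apply bN.ext
      intro i
      exact LinearMap.ext fun y => auxDetForm_left n i y
    intro x hx
    exact LinearMap.congr_fun this ⟨x, hx⟩
  have hr : ∀ x, ∀ y ∈ LinearMap.ker f, Φ x y = 0 := by
    intro x y hy
    have : (Φ x) ∘ₗ (LinearMap.ker f).subtype = 0 := by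
      apply bN.ext
      intro i
      exact auxDetForm_right n i x
    exact LinearMap.congr_fun this ⟨y, hy⟩
  have hwd : ∀ x x' y y', f x = f x' → f y = f y' → Φ x y = Φ x' y' := by
    intro x x' y y' h1 h2
    have h3 := hl (x - x') (by simp [h1])
    have h4 := hr x' (y - y') (by simp [h2])
    rw [map_sub, sub_eq_zero] at h3 h4
    rw [h3, h4]
  let s := Function.surjInv hf
  have hs : ∀ x, f (s x) = x := Function.surjInv_eq hf
  let φ : I →ₗ[P] I →ₗ[P] P := LinearMap.mk₂ P (fun x y => Φ (s x) (s y))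
    (by
      intro x x' y
      rw [← LinearMap.add_apply, ← map_add]
      exact hwd _ _ _ _ (by simp [hs]) rfl)
    (by
      intro c x y
      rw [← LinearMap.smul_apply, ← map_smul]
      exact hwd _ _ _ _ (by simp [hs]) rfl)
    (by
      intro x y y'
      rw [← map_add]
      exact hwd _ _ _ _ rfl (by simp [hs]))
    (by
      intro c x y
      rw [← map_smul]
      exact hwd _ _ _ _ rfl (by simp [hs]))
  have hφ : ∀ x y, φ (f x) (f y) = Φ x y := fun x y => hwd _ _ _ _ (hs _) (hs _)
  refine ⟨φ, fun x => auxDetForm_self n _, ?_⟩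
  intro d c hd hdc
  by_contra hc
  have hc0 : (Ideal.Quotient.mk (Ideal.span {d}) c) ≠ 0 := by
    rw [Ne, Ideal.Quotient.eq_zero_iff_mem, Ideal.mem_span_singleton]; exact hc
  obtain ⟨p, hp, hle⟩ := exists_le_isAssociatedPrime_of_isNoetherianRing P
    (Ideal.Quotient.mk (Ideal.span {d}) c) hc0
  obtain ⟨hpp, c', hc'⟩ := isAssociatedPrime_iff.mp hp
  obtain ⟨c', rfl⟩ := Ideal.Quotient.mk_surjective c'
  have hmem : ∀ (a e : P), a ∈ (⊥ : Submodule P (P ⧸ Ideal.span {d})).colon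
      {Ideal.Quotient.mk (Ideal.span {d}) e} ↔ d ∣ a * e := by
    intro a e
    rw [Submodule.mem_colon_singleton, Submodule.mem_bot, ← Ideal.mem_span_singleton,
      ← Ideal.Quotient.eq_zero_iff_mem]
    rfl
  have hpmem : ∀ a, a ∈ p ↔ d ∣ a * c' := by
    intro a; rw [hc']; exact hmem a c'
  have hΦp : ∀ x y, Φ x y ∈ p := by
    intro x y
    apply hle
    rw [hmem, ← hφ, mul_comm]
    exact hdc _ _
  let ρ := Ideal.Quotient.mk p
  have hli : LinearIndependent (P ⧸ p) (fun i => ρ ∘ n i) := by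
    rw [Fintype.linearIndependent_iff]
    intro g hg
    choose g' hg' using fun i => Ideal.Quotient.mk_surjective (g i)
    have h1 : ∀ j, ∑ i, g' i * n i j ∈ p := by
      intro j
      rw [← Ideal.Quotient.eq_zero_iff_mem]
      have := congrFun hg j
      simpa [← hg', ρ] using this
    have h2 : ∀ j, d ∣ (∑ i, g' i * n i j) * c' := fun j => (hpmem _).mp (h1 j)
    choose w hw using h2
    have h3 : d • w = ∑ i, (g' i * c') • n i := by
      funext j
      simp only [Pi.smul_apply, smul_eq_mul, Finset.sum_apply, ← hw, Finset.sum_mul]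
      exact Finset.sum_congr rfl fun i _ => by ring
    have h4 : w ∈ LinearMap.ker f := by
      rw [LinearMap.mem_ker]
      apply htf d _ hd
      rw [← map_smul, h3, map_sum]
      apply Finset.sum_eq_zero
      intro i _
      rw [map_smul, LinearMap.mem_ker.mp (bN i).2, smul_zero]
    have h5 : d • (⟨w, h4⟩ : LinearMap.ker f) = ∑ i, (g' i * c') • bN i := by
      apply Subtype.ext
      rw [Submodule.coe_smul, h3]
      simp [n]
    intro i
    have h6 := congrArg (fun z => bN.repr z i) h5
    simp only [map_smul, map_sum, Module.Basis.repr_self, Finsupp.smul_apply,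
      Finsupp.finsetSum_apply, smul_eq_mul] at h6
    rw [Finset.sum_eq_single i (by intro j _ hj; simp [hj]) (by simp)] at h6
    rw [← hg', Ideal.Quotient.eq_zero_iff_mem, hpmem]
    exact ⟨_, by simpa using h6.symm⟩
  have hdom : IsDomain (P ⧸ p) := Ideal.Quotient.isDomain p
  let K := FractionRing (P ⧸ p)
  let τ : P →+* K := (algebraMap (P ⧸ p) K).comp ρ
  have hliK : LinearIndependent K (fun i => τ ∘ n i) := by
    rw [← LinearIndependent.iff_fractionRing (P ⧸ p) K]
    let L : (κ ⊕ Fin 2 → P ⧸ p) →ₗ[P ⧸ p] (κ ⊕ Fin 2 → K) :=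
      LinearMap.compLeft (Algebra.linearMap (P ⧸ p) K) _
    have hL : Function.Injective L := by
      intro x y hxy
      funext j
      exact IsFractionRing.injective (P ⧸ p) K (congrFun hxy j)
    exact hli.map' L (LinearMap.ker_eq_bot.mpr hL)
  apply aux_field _ hliK
  apply (Pi.basisFun K (κ ⊕ Fin 2)).ext
  intro i
  apply (Pi.basisFun K (κ ⊕ Fin 2)).ext
  intro j
  have h7 := auxDetForm_map τ n (Pi.single i 1) (Pi.single j 1)
  have h8 : ∀ i : κ ⊕ Fin 2, τ ∘ (Pi.single i (1 : P)) = Pi.single i 1 := by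
    intro i
    funext j
    by_cases h : j = i
    · subst h; simp
    · simp [h]
  rw [h8, h8] at h7
  simp only [Pi.basisFun_apply]
  rw [← h7]
  simp only [τ, RingHom.comp_apply]
  rw [show ρ (auxDetForm n (Pi.single i 1) (Pi.single j 1)) = 0 from
    Ideal.Quotient.eq_zero_iff_mem.mpr (hΦp _ _)]
  simp

section Core

variable {P : Type} [CommRing P] [IsDomain P] {I : Type} [AddCommGroup I] [Module P I]

lemma aux_alt_swap (ψ : I →ₗ[P] I →ₗ[P] P) (h : ∀ x, ψ x x = 0) (x y : I) :
    ψ y x = - ψ x y := by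
  have := h (x + y)
  simp only [map_add, LinearMap.add_apply, h, zero_add, add_zero] at this
  linear_combination this

lemma aux_alt_two (ψ : I →ₗ[P] I →ₗ[P] P) (h : ∀ x, ψ x x = 0) (e e' x y : I)
    (d d' p q p' q' : P) (hx : d • x = p • e + q • e') (hy : d' • y = p' • e + q' • e') :
    d * d' * ψ x y = (p * q' - q * p') * ψ e e' := by
  have h1 : ψ (d • x) (d' • y) = d * d' * ψ x y := by
    simp; ring
  rw [← h1, hx, hy]
  simp only [map_add, map_smul, LinearMap.add_apply, LinearMap.smul_apply, smul_eq_mul, h,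
    aux_alt_swap ψ h e e']
  ring

lemma aux_delta
    (T : I →ₗ[P] I)
    (hspan : ∀ e : I, e ≠ 0 → ∀ x, ∃ d p q : P, d ≠ 0 ∧ d • x = p • e + q • T e)
    (φ : I →ₗ[P] I →ₗ[P] P) (halt : ∀ x, φ x x = 0)
    (hprim : ∀ d c : P, d ≠ 0 → (∀ x y, d ∣ c * φ x y) → d ∣ c)
    (hnu : ∃ d : P, d ≠ 0 ∧ ¬ IsUnit d)
    (e : I) (he : e ≠ 0) : φ e (T e) ≠ 0 := by
  intro h0
  obtain ⟨d, hd, hu⟩ := hnu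
  apply hu
  rw [isUnit_iff_dvd_one]
  apply hprim d 1 hd
  intro x y
  obtain ⟨d1, p, q, h1, h2⟩ := hspan e he x
  obtain ⟨d1', p', q', h1', h2'⟩ := hspan e he y
  have := aux_alt_two φ halt e (T e) x y _ _ _ _ _ _ h2 h2'
  rw [h0, mul_zero] at this
  have : φ x y = 0 := by simpa [h1, h1'] using this
  simp [this]

lemma aux_cyc
    (T : I →ₗ[P] I)
    (hspan : ∀ e : I, e ≠ 0 → ∀ x, ∃ d p q : P, d ≠ 0 ∧ d • x = p • e + q • T e)
    (φ : I →ₗ[P] I →ₗ[P] P) (halt : ∀ x, φ x x = 0)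
    (hprim : ∀ d c : P, d ≠ 0 → (∀ x y, d ∣ c * φ x y) → d ∣ c)
    (hnu : ∃ d : P, d ≠ 0 ∧ ¬ IsUnit d)
    (hne : ∃ e : I, e ≠ 0) (ψ : I →ₗ[P] I →ₗ[P] P) (hψ : ∀ x, ψ x x = 0) :
    ∃ c : P, ∀ x y, ψ x y = c * φ x y := by
  obtain ⟨e, he⟩ := hne
  have hδ := aux_delta T hspan φ halt hprim hnu e he
  have key : ∀ x y, φ e (T e) * ψ x y = ψ e (T e) * φ x y := by
    intro x y
    obtain ⟨d1, p, q, h1, h2⟩ := hspan e he x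
    obtain ⟨d1', p', q', h1', h2'⟩ := hspan e he y
    have k1 := aux_alt_two φ halt e (T e) x y _ _ _ _ _ _ h2 h2'
    have k2 := aux_alt_two ψ hψ e (T e) x y _ _ _ _ _ _ h2 h2'
    apply mul_left_cancel₀ (mul_ne_zero h1 h1')
    linear_combination φ e (T e) * k2 - ψ e (T e) * k1
  obtain ⟨c, hc⟩ := hprim _ (ψ e (T e)) hδ (fun x y => ⟨_, (key x y).symm⟩)
  refine ⟨c, fun x y => mul_left_cancel₀ hδ ?_⟩
  rw [key, hc]; ring

lemma aux_trace
    (T : I →ₗ[P] I)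
    (hspan : ∀ e : I, e ≠ 0 → ∀ x, ∃ d p q : P, d ≠ 0 ∧ d • x = p • e + q • T e)
    (φ : I →ₗ[P] I →ₗ[P] P) (halt : ∀ x, φ x x = 0)
    (a b : P) (hT : ∀ x, T (T x) = a • T x + b • x) (x y : I) :
    φ (T x) y + φ x (T y) = a * φ x y := by
  by_cases hx : x = 0
  · simp [hx]
  obtain ⟨d, p, q, h1, h2⟩ := hspan x hx y
  apply mul_left_cancel₀ h1
  have k1 : d * φ (T x) y = φ (T x) (d • y) := by simp
  have k2 : d * φ x (T y) = φ x (T (d • y)) := by simp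
  have k3 : d * φ x y = φ x (d • y) := by simp
  rw [mul_add, k1, k2, show d * (a * φ x y) = a * (d * φ x y) by ring, k3, h2]
  simp only [map_add, map_smul, hT, smul_eq_mul, halt, aux_alt_swap φ halt x (T x)]
  ring

lemma aux_trace2
    (T : I →ₗ[P] I)
    (hspan : ∀ e : I, e ≠ 0 → ∀ x, ∃ d p q : P, d ≠ 0 ∧ d • x = p • e + q • T e)
    (φ : I →ₗ[P] I →ₗ[P] P) (halt : ∀ x, φ x x = 0)
    (a b : P) (hT : ∀ x, T (T x) = a • T x + b • x) (x y : I) :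
    φ (T x) (T y) = - (b * φ x y) := by
  have := aux_trace T hspan φ halt a b hT x (T y)
  rw [hT] at this
  simp only [map_add, map_smul, smul_eq_mul] at this
  linear_combination this

lemma aux_surj
    (T : I →ₗ[P] I)
    (hspan : ∀ e : I, e ≠ 0 → ∀ x, ∃ d p q : P, d ≠ 0 ∧ d • x = p • e + q • T e)
    (φ : I →ₗ[P] I →ₗ[P] P) (halt : ∀ x, φ x x = 0)
    (hprim : ∀ d c : P, d ≠ 0 → (∀ x y, d ∣ c * φ x y) → d ∣ c)
    (hnu : ∃ d : P, d ≠ 0 ∧ ¬ IsUnit d)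
    (hne : ∃ e : I, e ≠ 0)
    (hdiv : ∀ (d : P) (y : I), d ≠ 0 → (∀ g : I →ₗ[P] P, d ∣ g y) → ∃ z, y = d • z)
    (f : I →ₗ[P] P) : ∃ z, φ z = f := by
  have hne' := hne
  obtain ⟨e, he⟩ := hne
  have hδ := aux_delta T hspan φ halt hprim hnu e he
  let X : I := f (T e) • e - f e • T e
  have hX : ∀ y, φ X y = φ e (T e) * f y := by
    intro y
    obtain ⟨d, p, q, h1, h2⟩ := hspan e he y
    apply mul_left_cancel₀ h1
    have k1 : d * φ X y = φ X (d • y) := by simp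
    have k2 : d * (φ e (T e) * f y) = φ e (T e) * f (d • y) := by simp; ring
    rw [k1, k2, h2]
    simp only [X, map_add, map_sub, map_smul, LinearMap.sub_apply, LinearMap.smul_apply,
      smul_eq_mul, halt, aux_alt_swap φ halt e (T e)]
    ring
  obtain ⟨z, hz⟩ := hdiv _ X hδ (by
    intro g
    let ψ : I →ₗ[P] I →ₗ[P] P := LinearMap.mk₂ P (fun x y => f x * g y - f y * g x)
      (by intros; simp; ring) (by intros; simp; ring) (by intros; simp; ring)
      (by intros; simp; ring)
    obtain ⟨c, hc⟩ := aux_cyc T hspan φ halt hprim hnu hne' ψ (by intro x; simp [ψ])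
    have := hc e (T e)
    simp only [ψ, LinearMap.mk₂_apply] at this
    refine ⟨-c, ?_⟩
    simp only [X, map_sub, map_smul, smul_eq_mul]
    linear_combination -this)
  refine ⟨z, LinearMap.ext fun y => mul_left_cancel₀ hδ ?_⟩
  rw [← hX, hz]; simp

end Core

section Core2

variable {P R : Type} [CommRing P] [CommRing R] [Algebra P R]

lemma aux_B (B : Module.Basis (Fin 2) P R) (hB : B 0 = 1) (r : R) :
    r = algebraMap P R (B.coord 0 r) + algebraMap P R (B.coord 1 r) * B 1 := by
  conv_lhs => rw [← B.sum_repr r]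
  simp [Fin.sum_univ_two, hB, Algebra.smul_def]

lemma aux_coord (B : Module.Basis (Fin 2) P R) (hB : B 0 = 1) (p q : P) :
    B.coord 0 (algebraMap P R p + algebraMap P R q * B 1) = p ∧
    B.coord 1 (algebraMap P R p + algebraMap P R q * B 1) = q := by
  have : algebraMap P R p + algebraMap P R q * B 1 = p • B 0 + q • B 1 := by
    simp [hB, Algebra.smul_def]
  rw [this]
  simp

lemma aux_Rlin (B : Module.Basis (Fin 2) P R) (hB : B 0 = 1)
    {M N : Type} [AddCommGroup M] [AddCommGroup N] [Module R M] [Module R N] [Module P M]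
    [IsScalarTower P R M] (f : M → N) (h1 : ∀ x y, f (x + y) = f x + f y)
    (h2 : ∀ (p : P) x, f (p • x) = algebraMap P R p • f x) (h3 : ∀ x, f (B 1 • x) = B 1 • f x)
    (r : R) (x : M) : f (r • x) = r • f x := by
  rw [aux_B B hB r]
  rw [add_smul, add_smul, mul_smul, mul_smul, h1, algebraMap_smul, algebraMap_smul, h2, h2, h3]

variable [IsDomain P] [IsDomain R] {I : Type} [AddCommGroup I] [Module R I] [Module P I]
  [IsScalarTower P R I]

lemma aux_hdiv (B : Module.Basis (Fin 2) P R) (hB : B 0 = 1) [hI : Module.IsReflexive R I]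
    (d : P) (y : I) (hd : d ≠ 0) (hg : ∀ g : I →ₗ[P] P, d ∣ g y) : ∃ z, y = d • z := by
  have hd' : algebraMap P R d ≠ 0 := by
    intro h0
    have := (aux_coord B hB d 0).1
    rw [h0] at this
    apply hd
    rw [← this]; simp
  have h1 : ∀ h : Module.Dual R I, ∃ r : R, h y = algebraMap P R d * r := by
    intro h
    obtain ⟨u, hu⟩ := hg (B.coord 0 ∘ₗ h.restrictScalars P)
    obtain ⟨v, hv⟩ := hg (B.coord 1 ∘ₗ h.restrictScalars P)
    refine ⟨algebraMap P R u + algebraMap P R v * B 1, ?_⟩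
    rw [aux_B B hB (h y)]
    simp only [LinearMap.comp_apply, LinearMap.restrictScalars_apply] at hu hv
    rw [hu, hv, map_mul, map_mul]; ring
  choose w hw using h1
  let W : Module.Dual R (Module.Dual R I) :=
    { toFun := w
      map_add' := by
        intro g h
        apply mul_left_cancel₀ hd'
        rw [← hw, mul_add, ← hw, ← hw]; simp
      map_smul' := by
        intro r h
        apply mul_left_cancel₀ hd'
        rw [← hw, RingHom.id_apply, smul_eq_mul, mul_left_comm, ← hw]; simp }
  obtain ⟨z, hz⟩ := (Module.bijective_dual_eval R I).2 W
  refine ⟨z, (Module.bijective_dual_eval R I).1 ?_⟩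
  ext h
  rw [← algebraMap_smul R d z, map_smul, hz]
  simp only [Module.Dual.eval_apply, LinearMap.smul_apply, smul_eq_mul]
  exact hw h

open scoped TensorProduct in
lemma aux_iso (B : Module.Basis (Fin 2) P R) (hB : B 0 = 1)
    (φ : I →ₗ[P] I →ₗ[P] P) (a b : P)
    (ht : B 1 * B 1 = algebraMap P R a * B 1 + algebraMap P R b)
    (htr : ∀ x y : I, φ (B 1 • x) y + φ x (B 1 • y) = a * φ x y)
    (hinj : ∀ y, φ y = 0 → y = 0) (hsurj : ∀ f, ∃ y, φ y = f) :
    Nonempty ((LinearMap.ker ((LinearMap.id : I →ₗ[P] I).liftBaseChange R)) ≃ₗ[R]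
      Module.Dual R I) := by
  have hT : ∀ x : I, B 1 • B 1 • x = a • B 1 • x + b • x := by
    intro x
    rw [smul_smul, ht, add_smul, mul_smul, algebraMap_smul, algebraMap_smul]
  have hφs : ∀ y z, φ y (B 1 • B 1 • z) = a * φ y (B 1 • z) + b * φ y z := by
    intro y z; rw [hT]; simp
  have hcs : ∀ (p : P) (x : I), B 1 • p • x = p • B 1 • x := by
    intro p x
    rw [← algebraMap_smul R p x, ← algebraMap_smul R p (B 1 • x), smul_smul, smul_smul, mul_comm]
  let G : I → Module.Dual R I := fun y =>
    { toFun := fun z => algebraMap P R (φ y (B 1 • z) - a * φ y z)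
        + algebraMap P R (φ y z) * B 1
      map_add' := by
        intro z z'
        simp only [smul_add, map_add, map_sub, map_mul]; ring
      map_smul' := by
        intro r z
        apply aux_Rlin B hB (M := I) (N := R) (fun z => algebraMap P R (φ y (B 1 • z) - a * φ y z)
          + algebraMap P R (φ y z) * B 1)
        · intro z z'
          simp only [smul_add, map_add, map_sub, map_mul]; ring
        · intro p z
          simp only [hcs, map_smul, map_sub, map_mul, smul_eq_mul]; ring
        · intro z
          simp only [hφs, map_add, map_sub, map_mul, smul_eq_mul]
          linear_combination (-algebraMap P R (φ y z)) * ht }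
  have hG : ∀ y z, G y z = algebraMap P R (φ y (B 1 • z) - a * φ y z)
        + algebraMap P R (φ y z) * B 1 := fun y z => rfl
  let Y : Fin 2 → (R ⊗[P] I →ₗ[P] I) := fun i =>
    (TensorProduct.lid P I).toLinearMap ∘ₗ LinearMap.rTensor I (B.coord i)
  have hY : ∀ i r x, Y i (r ⊗ₜ x) = B.coord i r • x := by
    intro i r x; simp [Y]
  have hz : ∀ z : R ⊗[P] I, z = 1 ⊗ₜ (Y 0 z) + B 1 ⊗ₜ (Y 1 z) := by
    intro z
    induction z with
    | zero => simp
    | add x y hx hy =>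
      rw [map_add, map_add, TensorProduct.tmul_add, TensorProduct.tmul_add]
      conv_lhs => rw [hx, hy]
      abel
    | tmul r x =>
      rw [hY, hY, ← TensorProduct.smul_tmul, ← TensorProduct.smul_tmul, ← TensorProduct.add_tmul]
      congr 1
      conv_lhs => rw [aux_B B hB r]
      simp [Algebra.smul_def]
  have hm : ∀ z : R ⊗[P] I, (LinearMap.id : I →ₗ[P] I).liftBaseChange R z
      = Y 0 z + B 1 • Y 1 z := by
    intro z
    conv_lhs => rw [hz z]
    simp
  have hc := fun p q => aux_coord B hB p q
  have hYs : ∀ x y : I, Y 0 ((1 : R) ⊗ₜ x + B 1 ⊗ₜ y) = x ∧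
      Y 1 ((1 : R) ⊗ₜ x + B 1 ⊗ₜ y) = y := by
    intro x y
    have h10 := (hc 1 0); have h01 := hc 0 1
    simp only [map_one, map_zero, zero_mul, add_zero, one_mul, zero_add] at h10 h01
    simp only [map_add, hY, h10.1, h10.2, h01.1, h01.2]
    simp
  have hYt : ∀ z : R ⊗[P] I, Y 1 (B 1 • z) = Y 0 z + a • Y 1 z := by
    intro z
    conv_lhs => rw [hz z]
    have h01 := hc 0 1
    have hba := hc b a
    rw [add_comm, ← ht] at hba
    simp only [map_one, map_zero, one_mul, zero_add] at h01
    simp only [smul_add, TensorProduct.smul_tmul', smul_eq_mul, mul_one, map_add, hY, h01.2, hba.2,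
      one_smul]
  have hK : ∀ z : LinearMap.ker ((LinearMap.id : I →ₗ[P] I).liftBaseChange R),
      Y 0 z.1 = - (B 1 • Y 1 z.1) := by
    intro z
    have := z.2
    rw [LinearMap.mem_ker, hm] at this
    exact eq_neg_of_add_eq_zero_left this
  have hGadd : ∀ y y', G (y + y') = G y + G y' := by
    intro y y'
    ext z
    simp only [hG, LinearMap.add_apply, map_add, map_sub, map_mul]; ring
  have hGsmul : ∀ (p : P) y, G (p • y) = algebraMap P R p • G y := by
    intro p y
    ext z
    simp only [hG, LinearMap.smul_apply, map_smul, map_sub, map_mul, smul_eq_mul]; ring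
  have hGt : ∀ y, G (a • y - B 1 • y) = B 1 • G y := by
    intro y
    ext z
    have e1 : ∀ w, φ (a • y - B 1 • y) w = φ y (B 1 • w) := by
      intro w
      simp only [map_sub, map_smul, LinearMap.sub_apply, LinearMap.smul_apply, smul_eq_mul]
      linear_combination - htr y w
    rw [LinearMap.smul_apply, hG, hG, e1, e1, hφs]
    simp only [map_sub, map_add, map_mul, smul_eq_mul]
    linear_combination (-algebraMap P R (φ y z)) * ht
  let Ψ : (LinearMap.ker ((LinearMap.id : I →ₗ[P] I).liftBaseChange R)) →ₗ[R] Module.Dual R I :=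
    { toFun := fun z => G (Y 1 z.1)
      map_add' := by
        intro z z'
        rw [Submodule.coe_add, map_add, hGadd]
      map_smul' := by
        intro r z
        apply aux_Rlin B hB (fun z : LinearMap.ker ((LinearMap.id : I →ₗ[P] I).liftBaseChange R) =>
          G (Y 1 z.1))
        · intro z z'
          rw [Submodule.coe_add, map_add, hGadd]
        · intro p z
          rw [← hGsmul, ← map_smul]
          rfl
        · intro z
          rw [← hGt, Submodule.coe_smul, hYt, hK]
          congr 1
          abel }
  refine ⟨LinearEquiv.ofBijective Ψ ⟨?_, ?_⟩⟩
  · intro z z' h0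
    have h1 : G (Y 1 z.1) = G (Y 1 z'.1) := h0
    have h2 : Y 1 z.1 = Y 1 z'.1 := by
      rw [← sub_eq_zero]
      apply hinj
      ext x
      have := LinearMap.congr_fun h1 x
      rw [hG, hG] at this
      have h3 := (hc (φ (Y 1 z.1) (B 1 • x) - a * φ (Y 1 z.1) x) (φ (Y 1 z.1) x)).2
      rw [this, (hc _ _).2] at h3
      rw [map_sub, LinearMap.sub_apply, h3, sub_self]; rfl
    apply Subtype.ext
    rw [hz z.1, hz z'.1, hK, hK, h2]
  · intro h
    obtain ⟨y, hy⟩ := hsurj (B.coord 1 ∘ₗ h.restrictScalars P)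
    have hy' : ∀ x, φ y x = B.coord 1 (h x) := fun x => by rw [hy]; rfl
    refine ⟨⟨1 ⊗ₜ (-(B 1 • y)) + B 1 ⊗ₜ y, ?_⟩, ?_⟩
    · rw [LinearMap.mem_ker, hm, (hYs _ _).1, (hYs _ _).2]; simp
    · change G (Y 1 _) = h
      rw [(hYs _ _).2]
      ext x
      rw [hG, hy', hy', map_smul, smul_eq_mul]
      have h4 : B 1 * h x = algebraMap P R (b * B.coord 1 (h x)) +
          algebraMap P R (B.coord 0 (h x) + a * B.coord 1 (h x)) * B 1 := by
        conv_lhs => rw [aux_B B hB (h x)]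
        simp only [map_add, map_mul]
        linear_combination (algebraMap P R (B.coord 1 (h x))) * ht
      rw [h4, (hc _ _).2, add_sub_cancel_right]
      exact (aux_B B hB (h x)).symm

end Core2

lemma aux_basis {P R : Type} [CommRing P] [IsLocalRing P] [CommRing R] [Nontrivial R]
    [Algebra P R] [Module.Free P R] [Module.Finite P R] (hrk : Module.finrank P R = 2) :
    ∃ B : Module.Basis (Fin 2) P R, B 0 = 1 := by
  have key : ∀ b : Module.Basis (Fin 2) P R, IsUnit (b.repr 1 0) →
      ∃ B : Module.Basis (Fin 2) P R, B 0 = 1 := by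
    intro b hb
    obtain ⟨u, hu⟩ := hb
    have h1 : (1 : R) = b.repr 1 0 • b 0 + b.repr 1 1 • b 1 := by
      exact (Fin.sum_univ_two (fun i => b.repr 1 i • b i)) ▸ (b.sum_repr 1).symm
    have hli : LinearIndependent P ![(1 : R), b 1] := by
      rw [LinearIndependent.pair_iff]
      intro s t h
      have e0 := congrArg (fun z => b.repr z 0) h
      have e1 := congrArg (fun z => b.repr z 1) h
      simp [← hu] at e0 e1
      subst e0
      simpa using e1
    have hsp : ⊤ ≤ Submodule.span P (Set.range ![(1 : R), b 1]) := by
      have m0 : (1 : R) ∈ Submodule.span P (Set.range ![(1 : R), b 1]) :=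
        Submodule.subset_span ⟨0, rfl⟩
      have m1 : b 1 ∈ Submodule.span P (Set.range ![(1 : R), b 1]) :=
        Submodule.subset_span ⟨1, rfl⟩
      rw [← b.span_eq, Submodule.span_le]
      rintro _ ⟨i, rfl⟩
      fin_cases i
      · have : b 0 = (↑u⁻¹ : P) • ((1 : R) - b.repr 1 1 • b 1) := by
          conv_rhs => rw [h1]
          rw [← hu]
          simp [smul_smul]
        simp only [Fin.zero_eta, SetLike.mem_coe]
        rw [this]
        exact Submodule.smul_mem _ _ (Submodule.sub_mem _ m0 (Submodule.smul_mem _ _ m1))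
      · exact m1
    exact ⟨Module.Basis.mk hli hsp, by simp⟩
  let b := Module.finBasisOfFinrankEq P R hrk
  by_cases h0 : IsUnit (b.repr 1 0)
  · exact key b h0
  by_cases h1 : IsUnit (b.repr 1 1)
  · exact key (b.reindex (Equiv.swap 0 1)) (by simpa using h1)
  exfalso
  have hx : (1 : R) = b.repr 1 0 • b 0 + b.repr 1 1 • b 1 := by
    exact (Fin.sum_univ_two (fun i => b.repr 1 i • b i)) ▸ (b.sum_repr 1).symm
  have := Submodule.eq_bot_of_le_smul_of_le_jacobson_bot (maximalIdeal P) (⊤ : Submodule P R)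
    Module.Finite.fg_top (by
      intro r _
      have : r = b.repr 1 0 • (b 0 * r) + b.repr 1 1 • (b 1 * r) := by
        rw [← smul_mul_assoc, ← smul_mul_assoc, ← add_mul, ← hx, one_mul]
      rw [this]
      exact Submodule.add_mem _ (Submodule.smul_mem_smul h0 trivial)
        (Submodule.smul_mem_smul h1 trivial))
    (by rw [IsLocalRing.jacobson_eq_maximalIdeal _ bot_ne_top])
  have h2 : (1 : R) ∈ (⊤ : Submodule P R) := trivial
  rw [this] at h2
  exact one_ne_zero ((Submodule.mem_bot P).mp h2)

lemma aux_dep {R I : Type} [CommRing R] [IsDomain R] [AddCommGroup I] [Module R I]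
    [Module.IsTorsionFree R I] (hrank : Module.rank R I = 1) (e : I) (he : e ≠ 0) (x : I) :
    ∃ s r : R, s ≠ 0 ∧ s • x = r • e := by
  by_contra hcon
  push Not at hcon
  have : LinearIndependent R ![x, e] := by
    rw [LinearIndependent.pair_iff]
    intro s t h
    have hs : s = 0 := by
      by_contra hs
      exact hcon s (-t) hs (by rw [neg_smul]; exact eq_neg_of_add_eq_zero_left h)
    subst hs
    simpa [he] using h
  have := this.cardinal_le_rank
  rw [hrank] at this
  simp at this

lemma aux_hspan {P R I : Type} [CommRing P] [IsDomain P] [CommRing R] [IsDomain R] [Algebra P R]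
    [Module.Finite P R] [AddCommGroup I] [Module R I] [Module P I] [IsScalarTower P R I]
    [Module.IsTorsionFree R I] (hrank : Module.rank R I = 1)
    (e : I) (he : e ≠ 0) (x : I) : ∃ (d : P) (r : R), d ≠ 0 ∧ d • x = r • e := by
  obtain ⟨s, r, hs, hsr⟩ := aux_dep hrank e he x
  have := Ideal.comap_ne_bot_of_integral_mem (R := P) hs (Ideal.mem_span_singleton_self s)
    (Algebra.IsIntegral.isIntegral s)
  obtain ⟨d, hd, hd0⟩ := Submodule.exists_mem_ne_zero_of_ne_bot this
  rw [Ideal.mem_comap, Ideal.mem_span_singleton] at hd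
  obtain ⟨s', hs'⟩ := hd
  refine ⟨d, s' * r, hd0, ?_⟩
  rw [← algebraMap_smul R d x, hs', mul_comm, mul_smul, hsr, mul_smul]

lemma aux_finrank {P R I : Type} [CommRing P] [IsDomain P] [CommRing R] [IsDomain R] [Algebra P R]
    [Module.Finite P R] (hrk : Module.finrank P R = 2)
    [AddCommGroup I] [Module R I] [Module P I] [IsScalarTower P R I] [Module.Finite P I]
    [Module.IsTorsionFree R I] (hrank : Module.rank R I = 1)
    (e : I) (he : e ≠ 0) : Module.finrank P I = 2 := by
  let g : R →ₗ[P] I := (LinearMap.toSpanSingleton R I e).restrictScalars P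
  have hg : Function.Injective g := by
    intro r r' h
    have : r • e = r' • e := h
    exact smul_left_injective R he this
  have h1 := Submodule.finrank_quotient_add_finrank (LinearMap.range g)
  rw [LinearMap.finrank_range_of_inj hg, hrk] at h1
  rw [← h1, add_eq_right, Module.finrank_eq_zero_iff]
  intro y
  obtain ⟨x, rfl⟩ := Submodule.Quotient.mk_surjective _ y
  obtain ⟨d, r, hd, h⟩ := aux_hspan (P := P) hrank e he x
  refine ⟨d, hd, ?_⟩
  rw [← Submodule.Quotient.mk_smul, Submodule.Quotient.mk_eq_zero, h]
  exact ⟨r, rfl⟩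

lemma aux_rank_dual {R I : Type} [CommRing R] [IsDomain R] [AddCommGroup I] [Module R I]
    [Module.IsReflexive R I] (hrank : Module.rank R I = 1) (e : I) (he : e ≠ 0) :
    Module.rank R (Module.Dual R I) = 1 := by
  apply le_antisymm
  · have hinj : Function.Injective (Module.Dual.eval R I e) := by
      rw [injective_iff_map_eq_zero]
      intro h hh
      ext x
      obtain ⟨s, r, hs, hsr⟩ := aux_dep hrank e he x
      apply mul_left_cancel₀ hs
      have := congrArg h hsr
      rw [map_smul, map_smul] at this
      rw [← smul_eq_mul, this]
      rw [Module.Dual.eval_apply] at hh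
      simp [hh]
    simpa using LinearMap.rank_le_of_injective _ hinj
  · rw [Cardinal.one_le_iff_ne_zero, Ne, rank_eq_zero_iff]
    intro h
    apply he
    apply (Module.bijective_dual_eval R I).1
    ext g
    obtain ⟨a, ha, hag⟩ := h g
    have := LinearMap.congr_fun hag e
    simpa [ha] using this

/-- Let `P` be a regular complete local ring of dimension `n ≥ 3` and `R`
a normal Gorenstein complete local domain, finite free of rank two over `P`.  Let `I` be a
rank one reflexive `R`-module of depth `≥ n − 1`.  Then the kernel `K` of the natural
surjection `R ⊗_P I → I` is a rank one reflexive `R`-module isomorphic to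
`I⁻¹ = Hom_R(I, R)` (the inverse of `I` in the class group `Cl(R)`). -/
theorem stmt12
    (P : Type) [CommRing P] [IsLocalRing P] [IsNoetherianRing P]
    (hreg : IsRegLocal P) [IsAdicComplete (maximalIdeal P) P]
    (n : ℕ) (hn : 3 ≤ n) (hdim : ringKrullDim P = (n : ℕ))
    (R : Type) [CommRing R] [IsDomain R] [IsIntegrallyClosed R] [IsLocalRing R]
    (hGor : IsGorLocal R)
    [Algebra P R] [Module.Free P R] [Module.Finite P R] (hrk : Module.finrank P R = 2)
    (I : Type) [AddCommGroup I] [Module R I] [Module P I] [IsScalarTower P R I]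
    [Module.Finite R I] (hrefl : Module.IsReflexive R I) (hrank : Module.rank R I = 1)
    (hdepth : DepthGE R I (n - 1)) :
    Module.IsReflexive R (LinearMap.ker ((LinearMap.id : I →ₗ[P] I).liftBaseChange R)) ∧
    Module.rank R (LinearMap.ker ((LinearMap.id : I →ₗ[P] I).liftBaseChange R)) = 1 ∧
    Nonempty ((LinearMap.ker ((LinearMap.id : I →ₗ[P] I).liftBaseChange R)) ≃ₗ[R]
      Module.Dual R I) := by
  have hregP : IsRegularLocalRing P := by
    obtain ⟨_, s, hs, hcard⟩ := hreg
    apply IsRegularLocalRing.of_spanFinrank_maximalIdeal_le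
    rw [← hcard, ← hs]
    have := Submodule.spanFinrank_span_le_ncard_of_finite (R := P) s.finite_toSet
    rw [Set.ncard_coe_finset] at this
    change ((Submodule.span P (s : Set P)).spanFinrank : WithBot ℕ∞) ≤ (s.card : WithBot ℕ∞)
    exact Nat.cast_le.mpr this
  have hdomP : IsDomain P := aux_reg_domain n P hdim
  have hfin : Module.Finite P I := Module.Finite.trans R I
  have htfR : Module.IsTorsionFree R I := inferInstance
  obtain ⟨B, hB⟩ := aux_basis hrk
  have hinjP : ∀ d : P, d ≠ 0 → algebraMap P R d ≠ 0 := by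
    intro d hd h0
    apply hd
    have := (aux_coord B hB d 0).1
    rw [h0] at this
    rw [← this]; simp
  have htf : ∀ (d : P) (x : I), d ≠ 0 → d • x = 0 → x = 0 := by
    intro d x hd h
    rw [← algebraMap_smul R d x] at h
    exact (smul_eq_zero.mp h).resolve_left (hinjP d hd)
  have hne : ∃ e : I, e ≠ 0 := by
    by_contra hcon
    push Not at hcon
    have : Module.rank R I = 0 := rank_eq_zero_iff.mpr fun x => ⟨1, one_ne_zero, by simp [hcon x]⟩
    rw [hrank] at this
    exact one_ne_zero this
  obtain ⟨e, he⟩ := hne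
  have hnt : Nontrivial I := ⟨e, 0, he⟩
  obtain ⟨rs, hlen, hmem, hrs⟩ := hdepth
  obtain ⟨ps, hpl, hpm, hps⟩ := aux_change (P := P) (n - 1) I rs hlen hmem hrs
  rw [isWeaklyRegular_map_algebraMap_iff] at hps
  have hps' : IsRegular I ps := IsRegular.of_isWeaklyRegular_of_mem_maximalIdeal I hpm hps
  obtain ⟨m, f, hf⟩ := Module.Finite.exists_fin' P I
  have hfree : Module.Free P (LinearMap.ker f) :=
    aux_syz (n - 1) P (by rw [hdim]; congr 1; omega) I (Fin m → P) ps hpl hpm hps' f hf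
  have hm : m = Module.finrank P (LinearMap.ker f) + 2 := by
    have h1 := Submodule.finrank_quotient_add_finrank (LinearMap.ker f)
    rw [(f.quotKerEquivOfSurjective hf).finrank_eq,
      aux_finrank hrk hrank e he, Module.finrank_fin_fun] at h1
    omega
  obtain ⟨k, hk⟩ : ∃ k, k = Module.finrank P (LinearMap.ker f) := ⟨_, rfl⟩
  rw [← hk] at hm
  let ε : (Fin k ⊕ Fin 2) ≃ Fin m := finSumFinEquiv.trans (finCongr hm.symm)
  let E : (Fin k ⊕ Fin 2 → P) ≃ₗ[P] (Fin m → P) := LinearEquiv.funCongrLeft P P ε.symm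
  let f' : (Fin k ⊕ Fin 2 → P) →ₗ[P] I := f ∘ₗ E.toLinearMap
  have hf' : Function.Surjective f' := hf.comp E.surjective
  have hker : LinearMap.ker f = (LinearMap.ker f').map E.toLinearMap := by
    ext x
    rw [Submodule.mem_map]
    constructor
    · intro hx
      exact ⟨E.symm x, by simpa [f'] using hx, by simp⟩
    · rintro ⟨y, hy, rfl⟩
      exact hy
  let Eker : LinearMap.ker f ≃ₗ[P] LinearMap.ker f' :=
    (LinearEquiv.ofEq _ _ hker).trans (E.submoduleMap (LinearMap.ker f')).symm
  let bN : Module.Basis (Fin k) P (LinearMap.ker f') :=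
    (Module.finBasisOfFinrankEq P (LinearMap.ker f) hk.symm).map Eker
  obtain ⟨φ, halt, hprim⟩ := aux_form I htf f' hf' bN
  have hnu : ∃ d : P, d ≠ 0 ∧ ¬ IsUnit d := by
    by_contra hcon
    push Not at hcon
    have hfld : IsField P := ⟨⟨0, 1, zero_ne_one⟩, mul_comm, fun {a} ha =>
      (hcon a ha).exists_right_inv⟩
    have := ringKrullDim_eq_zero_of_isField hfld
    rw [hdim] at this
    have : n = 0 := by exact_mod_cast this
    omega
  let T : I →ₗ[P] I := Algebra.lsmul P P I (B 1)
  have hTa : ∀ x, T x = B 1 • x := fun x => rfl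
  have hspan : ∀ e : I, e ≠ 0 → ∀ x, ∃ d p q : P, d ≠ 0 ∧ d • x = p • e + q • T e := by
    intro e he x
    obtain ⟨d, r, hd, h⟩ := aux_hspan (P := P) hrank e he x
    refine ⟨d, B.coord 0 r, B.coord 1 r, hd, ?_⟩
    rw [h]
    conv_lhs => rw [aux_B B hB r]
    rw [add_smul, mul_smul, algebraMap_smul, algebraMap_smul, hTa]
  let a : P := B.coord 1 (B 1 * B 1)
  let b : P := B.coord 0 (B 1 * B 1)
  have ht : B 1 * B 1 = algebraMap P R a * B 1 + algebraMap P R b := by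
    rw [add_comm]; exact aux_B B hB (B 1 * B 1)
  have hT : ∀ x, T (T x) = a • T x + b • x := by
    intro x
    rw [hTa, hTa, smul_smul, ht, add_smul, mul_smul, algebraMap_smul, algebraMap_smul]
  have htr := aux_trace T hspan φ halt a b hT
  have hinj : ∀ y, φ y = 0 → y = 0 := by
    intro y hy
    by_contra h0
    exact aux_delta T hspan φ halt hprim hnu y h0 (by rw [hy]; rfl)
  have hsurj := aux_surj T hspan φ halt hprim hnu ⟨e, he⟩
    (fun d y hd hg => aux_hdiv B hB d y hd hg)
  obtain ⟨Θ⟩ := aux_iso B hB φ a b ht htr hinj hsurj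
  exact ⟨Module.equiv Θ.symm, by rw [Θ.rank_eq]; exact aux_rank_dual hrank e he, ⟨Θ⟩⟩
end

section
/- Let R = k[[x,y,z,t]]/(x² + y² + z² − t^{2b+1}) with k algebraically closed of characteristic zero and b ≥ 1. Then R is a factorial (UFD) complete local domain, i.e. Cl(R) = 0. -/
open MvPowerSeries

/-- The equation `x² + y² + z² - t^(2b+1)` in `k⟦x,y,z,t⟧`. -/
noncomputable def cDVeqn (k : Type) [Field k] (b : ℕ) : MvPowerSeries (Fin 4) k :=
  X 0 ^ 2 + X 1 ^ 2 + X 2 ^ 2 - X 3 ^ (2 * b + 1)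

/-- The complete local ring `R = k⟦x,y,z,t⟧/(x² + y² + z² − t^{2b+1})`. -/
noncomputable abbrev cDVring (k : Type) [Field k] (b : ℕ) : Type :=
  MvPowerSeries (Fin 4) k ⧸ Ideal.span {cDVeqn k b}

namespace CDV

/-- Precompleteness passes to surjective images. -/
theorem precomplete_of_surjective {P Q : Type*} [CommRing P] [CommRing Q] (f : P →+* Q)
    (hf : Function.Surjective f) (I : Ideal P) [IsPrecomplete I P] :
    IsPrecomplete (I.map f) Q := by
  constructor
  intro s hs
  have key : ∀ n, ∃ d : P, d ∈ I ^ n ∧ f d = s (n + 1) - s n := by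
    intro n
    have h1 := hs (Nat.le_succ n)
    rw [SModEq.sub_mem, smul_eq_mul, Ideal.mul_top, ← Ideal.map_pow,
      Ideal.mem_map_iff_of_surjective f hf] at h1
    obtain ⟨d, hd, hd'⟩ := h1
    exact ⟨-d, neg_mem hd, by rw [map_neg, hd']; simp⟩
  choose d hd hd' using key
  obtain ⟨a0, ha0⟩ := hf (s 0)
  let t : ℕ → P := fun n => a0 + ∑ i ∈ Finset.range n, d i
  have ht : ∀ n, f (t n) = s n := by
    intro n
    induction n with
    | zero => simp [t, ha0]
    | succ n ih =>
      have : t (n + 1) = t n + d n := by simp [t, Finset.sum_range_succ, add_assoc]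
      rw [this, map_add, ih, hd']; ring
  have hc : ∀ {m n : ℕ}, m ≤ n → t m ≡ t n [SMOD (I ^ m • ⊤ : Submodule P P)] := by
    intro m n hmn
    rw [SModEq.sub_mem, smul_eq_mul, Ideal.mul_top]
    induction n, hmn using Nat.le_induction with
    | base => simp
    | succ n hmn ih =>
      have : t m - t (n + 1) = (t m - t n) - d n := by
        simp [t, Finset.sum_range_succ]; ring
      rw [this]
      exact sub_mem ih (Ideal.pow_le_pow_right hmn (hd n))
  obtain ⟨L, hL⟩ := IsPrecomplete.prec ‹_› hc
  refine ⟨f L, fun n => ?_⟩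
  have := hL n
  rw [SModEq.sub_mem, smul_eq_mul, Ideal.mul_top] at this ⊢
  rw [← Ideal.map_pow, ← ht n, ← map_sub]
  exact Ideal.mem_map_of_mem f this

/-- A quotient of a complete noetherian local ring is complete. -/
theorem complete_quotient {P : Type*} [CommRing P] [IsNoetherianRing P] [IsLocalRing P]
    [IsAdicComplete (IsLocalRing.maximalIdeal P) P] (J : Ideal P) [IsLocalRing (P ⧸ J)] :
    IsAdicComplete (IsLocalRing.maximalIdeal (P ⧸ J)) (P ⧸ J) := by
  have hs : Function.Surjective (Ideal.Quotient.mk J) := Ideal.Quotient.mk_surjective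
  have e : IsLocalRing.maximalIdeal (P ⧸ J) =
      (IsLocalRing.maximalIdeal P).map (Ideal.Quotient.mk J) := by
    have := Ideal.comap_isMaximal_of_surjective (Ideal.Quotient.mk J) hs
      (K := IsLocalRing.maximalIdeal (P ⧸ J))
    have h := IsLocalRing.eq_maximalIdeal this
    rw [← h, Ideal.map_comap_of_surjective _ hs]
  have h2 := precomplete_of_surjective (Ideal.Quotient.mk J) hs (IsLocalRing.maximalIdeal P)
  rw [← e] at h2
  exact { toIsHausdorff := inferInstance, toIsPrecomplete := h2 }

theorem mem_span_X {k : Type*} [Field k] (n : ℕ) (F : MvPowerSeries (Fin n) k)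
    (hF : MvPowerSeries.constantCoeff F = 0) :
    F ∈ Ideal.span (Set.range (MvPowerSeries.X : Fin n → MvPowerSeries (Fin n) k)) := by
  induction n with
  | zero =>
    have : F = 0 := by
      ext m
      have : m = 0 := Subsingleton.elim _ _
      subst this
      simpa using hF
    rw [this]; exact zero_mem _
  | succ n ih =>
    set e := MvPowerSeries.finSuccEquiv k n
    have h0 : MvPowerSeries.constantCoeff (PowerSeries.constantCoeff (e F)) = 0 := by
      have h := MvPowerSeries.coeff_coeff_finSuccEquiv (R := k) F (k := 0) (x := 0)
      rw [Finsupp.cons_zero_zero, MvPowerSeries.coeff_zero_eq_constantCoeff_apply,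
        MvPowerSeries.coeff_zero_eq_constantCoeff_apply,
        PowerSeries.coeff_zero_eq_constantCoeff_apply] at h
      rw [h, hF]
    have h1 := ih _ h0
    let φ : MvPowerSeries (Fin n) k →+* MvPowerSeries (Fin (n+1)) k :=
      (e.symm : _ →+* _).comp PowerSeries.C
    have h2 : φ (PowerSeries.constantCoeff (e F)) ∈
        Ideal.span (Set.range (MvPowerSeries.X : Fin (n+1) → MvPowerSeries (Fin (n+1)) k)) := by
      have h3 := Ideal.mem_map_of_mem φ h1
      rw [Ideal.map_span] at h3
      refine Ideal.span_mono ?_ h3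
      rintro _ ⟨_, ⟨j, rfl⟩, rfl⟩
      refine ⟨j.succ, ?_⟩
      change _ = e.symm (PowerSeries.C _)
      rw [AlgEquiv.eq_symm_apply]
      exact MvPowerSeries.finSuccEquiv_X_succ j
    have h4 : e F = (PowerSeries.mk fun p => PowerSeries.coeff (p+1) (e F)) * PowerSeries.X
        + PowerSeries.C (PowerSeries.constantCoeff (e F)) :=
      PowerSeries.eq_shift_mul_X_add_const _
    have h5 : F = e.symm (PowerSeries.mk fun p => PowerSeries.coeff (p+1) (e F)) *
        MvPowerSeries.X 0 + φ (PowerSeries.constantCoeff (e F)) := by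
      apply e.injective
      rw [map_add, map_mul, AlgEquiv.apply_symm_apply]
      change _ = _ + e (e.symm _)
      rw [AlgEquiv.apply_symm_apply, MvPowerSeries.finSuccEquiv_X_zero]
      exact h4
    rw [h5]
    exact add_mem (Ideal.mul_mem_left _ _ (Ideal.subset_span ⟨0, rfl⟩)) h2

theorem mem_maximalIdeal_iff {k : Type*} [Field k] {σ : Type*} (F : MvPowerSeries σ k) :
    F ∈ IsLocalRing.maximalIdeal (MvPowerSeries σ k) ↔ MvPowerSeries.constantCoeff F = 0 := by
  rw [IsLocalRing.mem_maximalIdeal, mem_nonunits_iff, MvPowerSeries.isUnit_iff_constantCoeff,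
    isUnit_iff_ne_zero, not_not]

instance completeMv (k : Type*) [Field k] (n : ℕ) :
    IsAdicComplete (IsLocalRing.maximalIdeal (MvPowerSeries (Fin n) k))
      (MvPowerSeries (Fin n) k) := by
  have : IsLocalRing.maximalIdeal (MvPowerSeries (Fin n) k) =
      Ideal.span (Set.range (MvPowerSeries.X : Fin n → MvPowerSeries (Fin n) k)) := by
    apply le_antisymm
    · intro F hF
      exact mem_span_X n F ((mem_maximalIdeal_iff F).1 hF)
    · rw [Ideal.span_le]
      rintro _ ⟨i, rfl⟩
      exact (mem_maximalIdeal_iff _).2 (by simp)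
  rw [this]
  infer_instance

/-- Distinguished polynomials: prime ideals of `A[X]` containing one extend to primes. -/
theorem distinguished_prime {A : Type*} [CommRing A] [IsLocalRing A]
    [IsAdicComplete (IsLocalRing.maximalIdeal A) A] {P : Polynomial A}
    (hP : P.IsDistinguishedAt (IsLocalRing.maximalIdeal A)) (I : Ideal (Polynomial A))
    (hI : I.IsPrime) (hPI : P ∈ I) :
    (I.map (Polynomial.coeToPowerSeries.ringHom (R := A))).IsPrime := by
  set φ := Polynomial.coeToPowerSeries.ringHom (R := A)
  have surj : ∀ F : PowerSeries A, ∃ h : Polynomial A, F - φ h ∈ Ideal.span {φ P} := by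
    intro F
    obtain ⟨y, hy⟩ := hP.algEquivQuotient.surjective (Ideal.Quotient.mk _ F)
    obtain ⟨h, rfl⟩ := Ideal.Quotient.mk_surjective y
    refine ⟨h, ?_⟩
    rw [← Ideal.Quotient.eq]
    exact hy.symm
  have inj : ∀ h : Polynomial A, φ h ∈ Ideal.span {φ P} → h ∈ Ideal.span {P} := by
    intro h hh
    rw [← Ideal.Quotient.eq_zero_iff_mem]
    apply hP.algEquivQuotient.injective
    rw [map_zero]
    exact Ideal.Quotient.eq_zero_iff_mem.2 hh
  have hle : Ideal.span {φ P} ≤ I.map φ := by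
    rw [Ideal.span_singleton_le_iff_mem]
    exact Ideal.mem_map_of_mem φ hPI
  have back : ∀ h : Polynomial A, φ h ∈ I.map φ → h ∈ I := by
    intro h hh
    have claim : ∀ F ∈ I.map φ, ∃ h ∈ I, F - φ h ∈ Ideal.span {φ P} := by
      intro F hF
      refine Submodule.span_induction (p := fun F _ => ∃ h ∈ I, F - φ h ∈ Ideal.span {φ P})
        ?_ ?_ ?_ ?_ hF
      · rintro _ ⟨h, hh, rfl⟩
        exact ⟨h, hh, by simp⟩
      · exact ⟨0, zero_mem _, by simp⟩
      · rintro x y _ _ ⟨h, hh, h1⟩ ⟨h', hh', h1'⟩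
        refine ⟨h + h', add_mem hh hh', ?_⟩
        have := add_mem h1 h1'
        convert this using 1
        rw [map_add]; ring
      · rintro a x _ ⟨h, hh, h1⟩
        obtain ⟨a', ha'⟩ := surj a
        refine ⟨a' * h, Ideal.mul_mem_left _ _ hh, ?_⟩
        have := add_mem (Ideal.mul_mem_left _ a h1) (Ideal.mul_mem_left _ (φ h) ha')
        convert this using 1
        rw [map_mul, smul_eq_mul]; ring
    obtain ⟨h', hh', h1⟩ := claim _ hh
    rw [← map_sub] at h1
    have h2 := inj _ h1
    have h3 : h - h' ∈ I := (Ideal.span_singleton_le_iff_mem I).2 hPI h2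
    simpa using add_mem h3 hh'
  constructor
  · intro htop
    apply hI.ne_top
    rw [Ideal.eq_top_iff_one]
    apply back
    rw [htop]; trivial
  · intro x y hxy
    obtain ⟨x', hx⟩ := surj x
    obtain ⟨y', hy⟩ := surj y
    have hx := hle hx
    have hy := hle hy
    have h1 : φ (x' * y') ∈ I.map φ := by
      have := sub_mem hxy (add_mem (Ideal.mul_mem_left _ y hx) (Ideal.mul_mem_left _ (φ x') hy))
      convert this using 1
      rw [map_mul]; ring
    rcases hI.mem_or_mem (back _ h1) with h | h
    · left; simpa using add_mem hx (Ideal.mem_map_of_mem φ h)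
    · right; simpa using add_mem hy (Ideal.mem_map_of_mem φ h)

/-- The image of `π` in the quotient by `g` is prime. -/
theorem prime_mk {P : Type*} [CommRing P] {g π : P} (h : (Ideal.span {π, g}).IsPrime)
    (hn : π ∉ Ideal.span {g}) : Prime (Ideal.Quotient.mk (Ideal.span {g}) π) := by
  have h0 : Ideal.Quotient.mk (Ideal.span {g}) π ≠ 0 := by
    rwa [Ne, Ideal.Quotient.eq_zero_iff_mem]
  rw [← Ideal.span_singleton_prime h0]
  have : Ideal.span {Ideal.Quotient.mk (Ideal.span {g}) π} =
      (Ideal.span {π, g}).map (Ideal.Quotient.mk (Ideal.span {g})) := by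
    rw [Ideal.map_span, Set.image_pair,
      Ideal.Quotient.eq_zero_iff_mem.2 (Ideal.mem_span_singleton_self g), Set.pair_comm,
      Ideal.span_insert_zero]
  rw [this]
  apply Ideal.map_isPrime_of_surjective Ideal.Quotient.mk_surjective
  rw [Ideal.mk_ker]
  exact Ideal.span_mono (by simp)

theorem prime_of_prime_mk {P : Type*} [CommRing P] {g π : P}
    (h : Prime (Ideal.Quotient.mk (Ideal.span {g}) π)) : (Ideal.span {π, g}).IsPrime := by
  have h1 := (Ideal.span_singleton_prime h.ne_zero).2 h
  have h2 := Ideal.comap_isPrime (Ideal.Quotient.mk (Ideal.span {g}))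
    (Ideal.span {Ideal.Quotient.mk (Ideal.span {g}) π})
  convert h2 using 1
  rw [← Set.image_singleton, ← Ideal.map_span,
    Ideal.comap_map_of_surjective' _ Ideal.Quotient.mk_surjective, Ideal.mk_ker, Ideal.span_insert]

/-- Main Weierstrass lemma. -/
theorem weier {A : Type*} [CommRing A] [IsLocalRing A]
    [IsAdicComplete (IsLocalRing.maximalIdeal A) A] (g : Polynomial A)
    [IsDomain (Polynomial A ⧸ Ideal.span {g})]
    [UniqueFactorizationMonoid (Polynomial A ⧸ Ideal.span {g})]
    (p : Ideal (PowerSeries A)) (hp : p.IsPrime) (hg : (g : PowerSeries A) ∈ p)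
    (r : PowerSeries A) (hr : r ∈ p) (hrg : r ∉ Ideal.span {(g : PowerSeries A)})
    (hreg : r.map (IsLocalRing.residue A) ≠ 0) :
    ∃ π ∈ p, (Ideal.span {π, (g : PowerSeries A)}).IsPrime ∧
      π ∉ Ideal.span {(g : PowerSeries A)} := by
  obtain ⟨P, h, hP⟩ := PowerSeries.exists_isWeierstrassFactorization hreg
  set φ := Polynomial.coeToPowerSeries.ringHom (R := A) with hφ
  have hdist := hP.isDistinguishedAt
  have hPr : r = φ P * h := hP.eq_mul
  have hPp : φ P ∈ p := by
    have h1 : φ P * h ∈ p := hPr ▸ hr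
    rcases hp.mem_or_mem h1 with h2 | h2
    · exact h2
    · exact absurd (Ideal.eq_top_of_isUnit_mem _ h2 hP.isUnit) hp.ne_top
  have hPg : φ P ∉ Ideal.span {φ g} := fun h2 => hrg (by
    rw [hPr]; exact Ideal.mul_mem_right _ _ h2)
  set q := Ideal.Quotient.mk (Ideal.span {g})
  -- the prime of R0
  let p0 : Ideal (Polynomial A ⧸ Ideal.span {g}) := (p.comap φ).map q
  have hp0 : p0.IsPrime := by
    have : (p.comap φ).IsPrime := Ideal.comap_isPrime _ _
    apply Ideal.map_isPrime_of_surjective Ideal.Quotient.mk_surjective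
    rw [Ideal.mk_ker, Ideal.span_singleton_le_iff_mem]
    exact hg
  have hqP : q P ∈ p0 := Ideal.mem_map_of_mem _ hPp
  have hqP0 : q P ≠ 0 := by
    intro h0
    rw [Ideal.Quotient.eq_zero_iff_mem] at h0
    apply hPg
    have := Ideal.mem_map_of_mem φ h0
    rwa [Ideal.map_span, Set.image_singleton] at this
  have : ∃ π0 ∈ p0, Prime π0 ∧ π0 ∣ q P := by
    obtain ⟨u, hu⟩ := UniqueFactorizationMonoid.factors_prod hqP0
    have h1 : (UniqueFactorizationMonoid.factors (q P)).prod ∈ p0 := by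
      have h2 : (UniqueFactorizationMonoid.factors (q P)).prod * u ∈ p0 := by
        rw [hu]; exact hqP
      rcases hp0.mem_or_mem h2 with h3 | h3
      · exact h3
      · exact absurd (Ideal.eq_top_of_isUnit_mem _ h3 u.isUnit) hp0.ne_top
    obtain ⟨π0, h3, h4⟩ := (Ideal.IsPrime.multiset_prod_mem_iff_exists_mem hp0 _).1 h1
    exact ⟨π0, h4, UniqueFactorizationMonoid.prime_of_factor _ h3,
      UniqueFactorizationMonoid.dvd_of_mem_factors h3⟩
  obtain ⟨π0, hπp, hπ, hπd⟩ := this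
  obtain ⟨π, rfl⟩ := Ideal.Quotient.mk_surjective π0
  have hI := prime_of_prime_mk hπ
  have hPI : P ∈ Ideal.span {π, g} := by
    have h1 : q P ∈ Ideal.span {q π} := Ideal.mem_span_singleton.2 hπd
    have h2 : P ∈ (Ideal.span {q π}).comap q := h1
    rwa [← Set.image_singleton, ← Ideal.map_span,
      Ideal.comap_map_of_surjective' _ Ideal.Quotient.mk_surjective, Ideal.mk_ker,
      ← Ideal.span_insert] at h2
  have h5 := distinguished_prime hdist _ hI hPI
  have e5 : (Ideal.span {π, g}).map φ = Ideal.span {φ π, φ g} := by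
    rw [Ideal.map_span, Set.image_pair]
  rw [e5] at h5
  refine ⟨φ π, ?_, h5, ?_⟩
  · have h6 : π ∈ p0.comap q := hπp
    rw [Ideal.comap_map_of_surjective' _ Ideal.Quotient.mk_surjective, Ideal.mk_ker,
      sup_eq_left.2] at h6
    · exact h6
    · rw [Ideal.span_singleton_le_iff_mem]
      exact hg
  · intro h6
    apply hPg
    have h7 := Ideal.mem_map_of_mem φ hPI
    rw [e5] at h7
    refine (Ideal.span_le.2 ?_) h7
    rintro x (rfl | rfl)
    · exact h6
    · exact Ideal.mem_span_singleton_self _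


section subst

variable {k : Type*} [Field k]

/-- The automorphism given by mutually inverse substitutions. -/
noncomputable def substEquiv {n : ℕ} (a b : Fin n → MvPowerSeries (Fin n) k)
    (ha : HasSubst a) (hb : HasSubst b)
    (hab : ∀ i, subst b (a i) = X i) (hba : ∀ i, subst a (b i) = X i) :
    MvPowerSeries (Fin n) k ≃ₐ[k] MvPowerSeries (Fin n) k :=
  AlgEquiv.ofAlgHom (substAlgHom ha) (substAlgHom hb)
    (by
      apply AlgHom.ext
      intro F
      simp only [AlgHom.comp_apply, substAlgHom_apply, AlgHom.id_apply]
      rw [subst_comp_subst_apply hb ha]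
      simp only [hba]
      exact congrFun subst_self F)
    (by
      apply AlgHom.ext
      intro F
      simp only [AlgHom.comp_apply, substAlgHom_apply, AlgHom.id_apply]
      rw [subst_comp_subst_apply ha hb]
      simp only [hab]
      exact congrFun subst_self F)

theorem substEquiv_apply {n : ℕ} (a b : Fin n → MvPowerSeries (Fin n) k)
    (ha : HasSubst a) (hb : HasSubst b)
    (hab : ∀ i, subst b (a i) = X i) (hba : ∀ i, subst a (b i) = X i) (F) :
    substEquiv a b ha hb hab hba F = subst a F := by
  simp [substEquiv, substAlgHom_apply]

/-- The family of substitutions for a linear arc. -/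
noncomputable def arcv {n : ℕ} (a : Fin n → k) : Fin n → MvPowerSeries Unit k :=
  fun i => C (a i) * X ()

theorem arcv_hs {n : ℕ} (a : Fin n → k) : HasSubst (arcv a) :=
  hasSubst_of_constantCoeff_zero (by intro i; simp [arcv])

theorem arcv_prod {n : ℕ} (a : Fin n → k) (e : Fin n →₀ ℕ) :
    (e.prod fun s m => (arcv a s) ^ m) =
      monomial (Finsupp.single () e.degree) (∏ i, a i ^ e i) := by
  rw [Finsupp.prod_fintype _ _ (by simp)]
  simp only [arcv, mul_pow, Finset.prod_mul_distrib]
  rw [Finset.prod_pow_eq_pow_sum, X_pow_eq, ← Finsupp.degree_eq_sum]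
  simp only [← map_pow, ← map_prod]
  rw [← smul_eq_C_mul, ← map_smul, smul_eq_mul, mul_one]

theorem coeff_arc {n : ℕ} (a : Fin n → k) (F : MvPowerSeries (Fin n) k) (d : ℕ) :
    coeff (Finsupp.single () d) (subst (arcv a) F) =
      ∑ e ∈ Finset.finsuppAntidiag Finset.univ d, coeff e F * ∏ i, a i ^ e i := by
  classical
  rw [coeff_subst (arcv_hs a)]
  rw [finsum_eq_sum_of_support_subset (s := Finset.finsuppAntidiag Finset.univ d)]
  · refine Finset.sum_congr rfl fun e he => ?_
    rw [Finset.mem_finsuppAntidiag] at he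
    rw [arcv_prod, coeff_monomial, if_pos, smul_eq_mul]
    rw [Finsupp.degree_eq_sum, he.1]
  · intro e he
    rw [Function.mem_support, arcv_prod, coeff_monomial] at he
    rw [Finset.mem_coe, Finset.mem_finsuppAntidiag]
    by_contra hne
    apply he
    rw [if_neg, smul_zero]
    intro h
    apply hne
    have := Finsupp.single_injective _ h
    rw [Finsupp.degree_eq_sum] at this
    exact ⟨this.symm, by simp⟩

theorem exists_arc [Infinite k] {n : ℕ} (F : MvPowerSeries (Fin (n+1)) k) (hF : F ≠ 0) :
    ∃ a : Fin (n+1) → k, a 0 = 1 ∧ subst (arcv a) F ≠ 0 := by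
  classical
  obtain ⟨e0, he0⟩ : ∃ e, coeff e F ≠ 0 := by
    by_contra! h
    exact hF (MvPowerSeries.ext h)
  set d := ∑ i, e0 i
  let p : MvPolynomial (Fin (n+1)) k :=
    ∑ e ∈ Finset.finsuppAntidiag Finset.univ d, MvPolynomial.monomial e (coeff e F)
  have hp : p ≠ 0 := by
    intro h0
    apply he0
    have h1 : MvPolynomial.coeff e0 p = 0 := by rw [h0]; simp
    simp only [p, MvPolynomial.coeff_sum, MvPolynomial.coeff_monomial] at h1
    rw [Finset.sum_ite_eq' , if_pos] at h1
    · exact h1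
    · rw [Finset.mem_finsuppAntidiag]; exact ⟨rfl, by simp⟩
  have hXp : MvPolynomial.X 0 * p ≠ 0 := mul_ne_zero (MvPolynomial.X_ne_zero 0) hp
  obtain ⟨a, ha⟩ : ∃ a, MvPolynomial.eval a (MvPolynomial.X 0 * p) ≠ 0 := by
    by_contra! h
    exact hXp (MvPolynomial.funext (by intro x; rw [h x]; simp))
  rw [map_mul, MvPolynomial.eval_X] at ha
  have ha0 := left_ne_zero_of_mul ha
  have ha1 := right_ne_zero_of_mul ha
  refine ⟨fun i => (a 0)⁻¹ * a i, inv_mul_cancel₀ ha0, fun h0 => ?_⟩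
  have h1 := coeff_arc (fun i => (a 0)⁻¹ * a i) F d
  rw [h0, map_zero] at h1
  apply ha1
  have h2 : ∑ e ∈ Finset.finsuppAntidiag Finset.univ d,
      coeff e F * ∏ i, ((a 0)⁻¹ * a i) ^ e i = (a 0)⁻¹ ^ d * MvPolynomial.eval a p := by
    simp only [p, map_sum, MvPolynomial.eval_monomial, Finset.mul_sum]
    refine Finset.sum_congr rfl fun e he => ?_
    rw [Finset.mem_finsuppAntidiag] at he
    rw [Finsupp.prod_fintype _ _ (by simp)]
    simp only [mul_pow, Finset.prod_mul_distrib]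
    rw [Finset.prod_pow_eq_pow_sum, he.1]
    ring
  rw [h2] at h1
  exact (mul_eq_zero.1 h1.symm).resolve_left (pow_ne_zero _ (inv_ne_zero ha0))

theorem regular_of_arc {n : ℕ} (F : MvPowerSeries (Fin (n+1)) k)
    (h : subst (arcv (Pi.single 0 (1 : k))) F ≠ 0) :
    (finSuccEquiv k n F).map (IsLocalRing.residue _) ≠ 0 := by
  classical
  intro h0
  apply h
  have h1 : ∀ d, coeff (Finsupp.cons d 0) F = 0 := by
    intro d
    have h2 := congrArg (PowerSeries.coeff d) h0
    rw [PowerSeries.coeff_map, map_zero, IsLocalRing.residue_eq_zero_iff,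
      mem_maximalIdeal_iff] at h2
    rw [← coeff_coeff_finSuccEquiv, coeff_zero_eq_constantCoeff_apply]
    exact h2
  apply MvPowerSeries.ext
  intro m
  have hm : m = Finsupp.single () (m ()) := by ext; simp
  rw [hm, coeff_arc, LinearMap.map_zero]
  apply Finset.sum_eq_zero
  intro e he
  by_cases h3 : ∀ j : Fin n, e j.succ = 0
  · have : e = Finsupp.cons (e 0) 0 := by
      ext i
      refine Fin.cases ?_ (fun j => ?_) i
      · simp
      · simp [h3 j]
    rw [this, h1, zero_mul]
  · push Not at h3
    obtain ⟨j, hj⟩ := h3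
    rw [Finset.prod_eq_zero (Finset.mem_univ j.succ), mul_zero]
    simp [hj]

theorem subst_X_hs {σ τ : Type*} [Finite σ] (a : σ → MvPowerSeries τ k)
    (ha : ∀ i, constantCoeff (a i) = 0) : HasSubst a := hasSubst_of_constantCoeff_zero ha

theorem subst_C_mul {σ τ : Type*} {a : σ → MvPowerSeries τ k} (ha : HasSubst a) (c : k)
    (F : MvPowerSeries σ k) : subst a (C c * F) = C c * subst a F := by
  rw [← smul_eq_C_mul, ← smul_eq_C_mul, subst_smul ha]

theorem exists_shear [Infinite k] {n : ℕ} (F : MvPowerSeries (Fin (n+1)) k) (hF : F ≠ 0) :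
    ∃ e : MvPowerSeries (Fin (n+1)) k ≃ₐ[k] MvPowerSeries (Fin (n+1)) k,
      (finSuccEquiv k n (e F)).map (IsLocalRing.residue _) ≠ 0 := by
  obtain ⟨a, ha0, ha⟩ := exists_arc F hF
  let s : (Fin (n+1) → k) → Fin (n+1) → MvPowerSeries (Fin (n+1)) k :=
    fun c => Fin.cases (X 0) (fun j => X j.succ + C (c j.succ) * X 0)
  have hs : ∀ c, HasSubst (s c) := fun c => hasSubst_of_constantCoeff_zero (by
    intro i
    refine Fin.cases ?_ (fun j => ?_) i <;> simp [s])
  have hinv : ∀ c i, subst (s (-c)) (s c i) = X i := by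
    intro c i
    refine Fin.cases ?_ (fun j => ?_) i
    · simp only [s, Fin.cases_zero]
      rw [subst_X (hs _)]; rfl
    · simp only [s, Fin.cases_succ]
      rw [subst_add (hs _), subst_C_mul (hs _), subst_X (hs _), subst_X (hs _)]
      simp [s]
  refine ⟨substEquiv (s a) (s (-a)) (hs _) (hs _) (hinv a) ?_, ?_⟩
  · intro i
    simpa using hinv (-a) i
  · apply regular_of_arc
    rw [substEquiv_apply, subst_comp_subst_apply (hs _) (arcv_hs (Pi.single 0 (1 : k)))]
    convert ha using 2
    funext i
    refine Fin.cases ?_ (fun j => ?_) i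
    · simp only [s, Fin.cases_zero]
      rw [subst_X (arcv_hs _)]; simp [arcv, ha0]
    · simp only [s, Fin.cases_succ]
      rw [subst_add (arcv_hs _), subst_C_mul (arcv_hs _), subst_X (arcv_hs _),
        subst_X (arcv_hs _)]
      simp [arcv]

instance domMv (n : ℕ) : IsDomain (MvPowerSeries (Fin n) k) := NoZeroDivisors.to_isDomain _

instance ufdMv [Infinite k] (n : ℕ) : UniqueFactorizationMonoid (MvPowerSeries (Fin n) k) := by
  induction n with
  | zero => exact (isEmptyEquiv (Fin 0) k).symm.toMulEquiv.uniqueFactorizationMonoid inferInstance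
  | succ n ih =>
    apply UniqueFactorizationMonoid.iff_exists_prime_mem_of_isPrime.2
    intro p hp0 hp
    obtain ⟨F, hFp, hF⟩ := Submodule.exists_mem_ne_zero_of_ne_bot hp0
    obtain ⟨e, he⟩ := exists_shear F hF
    let ε : MvPowerSeries (Fin (n+1)) k ≃+* PowerSeries (MvPowerSeries (Fin n) k) :=
      (e.trans (finSuccEquiv k n)).toRingEquiv
    have hεF : ε F = finSuccEquiv k n (e F) := rfl
    let E : (Polynomial (MvPowerSeries (Fin n) k) ⧸
        Ideal.span {(0 : Polynomial (MvPowerSeries (Fin n) k))}) ≃+*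
        Polynomial (MvPowerSeries (Fin n) k) :=
      (Ideal.quotEquivOfEq (by simp)).trans (RingEquiv.quotientBot _)
    have : IsDomain (Polynomial (MvPowerSeries (Fin n) k) ⧸
        Ideal.span {(0 : Polynomial (MvPowerSeries (Fin n) k))}) := MulEquiv.isDomain _ E.toMulEquiv
    have : UniqueFactorizationMonoid (Polynomial (MvPowerSeries (Fin n) k) ⧸
        Ideal.span {(0 : Polynomial (MvPowerSeries (Fin n) k))}) :=
      E.symm.toMulEquiv.uniqueFactorizationMonoid inferInstance
    obtain ⟨π, hπ, hπ1, hπ2⟩ := weier (0 : Polynomial (MvPowerSeries (Fin n) k))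
      (p.comap (ε.symm : _ →+* _)) (Ideal.comap_isPrime _ _) (by simp) (ε F)
      (by simpa using hFp) (by simpa using hF) he
    rw [Polynomial.coe_zero, Set.pair_comm, Ideal.span_insert_zero] at hπ1
    rw [Polynomial.coe_zero, Ideal.span_singleton_eq_bot.2 rfl, Ideal.mem_bot] at hπ2
    refine ⟨ε.symm π, hπ, ?_⟩
    rw [MulEquiv.prime_iff]
    exact (Ideal.span_singleton_prime hπ2).1 hπ1

end subst


/-- `X ^ 2 - h` generates a prime ideal in power series if `h` is not a square. -/
theorem quad_prime {A : Type*} [CommRing A] [IsDomain A] [UniqueFactorizationMonoid A]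
    [IsLocalRing A] [IsAdicComplete (IsLocalRing.maximalIdeal A) A] (h : A)
    (hm : h ∈ IsLocalRing.maximalIdeal A) (hs : ∀ r : A, r ^ 2 ≠ h) :
    (Ideal.span {(PowerSeries.X ^ 2 - PowerSeries.C h : PowerSeries A)}).IsPrime := by
  set P : Polynomial A := Polynomial.X ^ 2 - Polynomial.C h with hP
  have hmon : P.Monic := Polynomial.monic_X_pow_sub_C h two_ne_zero
  have hdeg : P.natDegree = 2 := Polynomial.natDegree_X_pow_sub_C
  have hd : P.IsDistinguishedAt (IsLocalRing.maximalIdeal A) := by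
    refine ⟨⟨?_⟩, hmon⟩
    intro n hn
    rw [hdeg] at hn
    interval_cases n
    · simpa [hP] using hm
    · simp [hP, Polynomial.coeff_X_pow]
  have hirr : Irreducible P := by
    rw [hmon.irreducible_iff_roots_eq_zero_of_degree_le_three (by omega) (by omega)]
    rw [Multiset.eq_zero_iff_forall_notMem]
    intro r hr
    have := Polynomial.isRoot_of_mem_roots hr
    apply hs r
    simpa [hP, sub_eq_zero] using this
  have hpr : (Ideal.span {P}).IsPrime := (Ideal.span_singleton_prime hirr.ne_zero).2 hirr.prime
  have h1 := distinguished_prime hd _ hpr (Ideal.mem_span_singleton_self P)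
  rw [Ideal.map_span, Set.image_singleton] at h1
  have h2 : Polynomial.coeToPowerSeries.ringHom P =
      (PowerSeries.X ^ 2 - PowerSeries.C h : PowerSeries A) := by
    rw [hP, map_sub, map_pow]
    simp
  rwa [h2] at h1

/-- Nagata's criterion. -/
theorem nagata {B R : Type*} [CommRing B] [IsDomain B] [UniqueFactorizationMonoid B]
    [CommRing R] [IsDomain R] [IsNoetherianRing R] (ι : B →+* R) (hι : Function.Injective ι)
    (u : B) (hu : Prime (ι u)) (hB : ∀ x, ∃ n b, ι u ^ n * x = ι b) :
    UniqueFactorizationMonoid R := by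
  apply UniqueFactorizationMonoid.iff_exists_prime_mem_of_isPrime.2
  intro q hq0 hq
  by_cases huq : ι u ∈ q
  · exact ⟨_, huq, hu⟩
  obtain ⟨x, hxq, hx⟩ := Submodule.exists_mem_ne_zero_of_ne_bot hq0
  obtain ⟨n, b, hnb⟩ := hB x
  have hb : b ≠ 0 := by
    rintro rfl
    rw [map_zero] at hnb
    rcases mul_eq_zero.1 hnb with h | h
    · exact pow_ne_zero n hu.ne_zero h
    · exact hx h
  have hbq : b ∈ q.comap ι := by
    rw [Ideal.mem_comap, ← hnb]
    exact Ideal.mul_mem_left _ _ hxq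
  obtain ⟨w0, hw0q, hw0⟩ := UniqueFactorizationMonoid.iff_exists_prime_mem_of_isPrime.1 ‹_›
    (q.comap ι) (fun h => hb (by rw [h] at hbq; exact hbq)) (Ideal.comap_isPrime _ _)
  have hne : ι w0 ≠ 0 := fun h => hw0.ne_zero (hι (by rw [h, map_zero]))
  obtain ⟨w, hw, hnd⟩ := (FiniteMultiplicity.of_not_isUnit hu.not_isUnit hne).exists_eq_pow_mul_and_not_dvd
  set m := multiplicity (ι u) (ι w0)
  have hwq : w ∈ q := by
    have : ι u ^ m * w ∈ q := hw ▸ hw0q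
    rcases hq.mem_or_mem this with h | h
    · exact absurd (hq.mem_of_pow_mem _ h) huq
    · exact h
  have hw00 : w ≠ 0 := by
    rintro rfl
    rw [mul_zero] at hw
    exact hne hw
  have key : ∀ x a n, ι u ^ n * x = ι a → w0 ∣ a → w ∣ x := by
    rintro x a n h ⟨d, rfl⟩
    rw [map_mul, hw] at h
    have h1 : ι u ^ n ∣ w * (ι u ^ m * ι d) := ⟨x, by rw [h]; ring⟩
    obtain ⟨e, he⟩ := hu.pow_dvd_of_dvd_mul_left n hnd h1
    refine ⟨e, mul_left_cancel₀ (pow_ne_zero n hu.ne_zero) ?_⟩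
    rw [h, show ι u ^ n * (w * e) = w * (ι u ^ n * e) by ring, ← he]; ring
  refine ⟨w, hwq, hw00, fun h => hq.ne_top (Ideal.eq_top_of_isUnit_mem _ hwq h), ?_⟩
  rintro x y ⟨c, hc⟩
  obtain ⟨n1, a1, h1⟩ := hB x
  obtain ⟨n2, a2, h2⟩ := hB y
  obtain ⟨n3, a3, h3⟩ := hB c
  have h4 : w0 * (u ^ (n1 + n2) * a3) = a1 * a2 * u ^ (m + n3) := by
    apply hι
    simp only [map_mul, map_pow]
    rw [hw, ← h1, ← h2, ← h3]
    calc _ = ι u ^ (m + n1 + n2 + n3) * (w * c) := by ring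
      _ = _ := by rw [← hc]; ring
  have h5 : w0 ∣ a1 * a2 * u ^ (m + n3) := ⟨_, h4.symm⟩
  rcases hw0.dvd_or_dvd h5 with h | h
  · rcases hw0.dvd_or_dvd h with h | h
    · exact Or.inl (key _ _ _ h1 h)
    · exact Or.inr (key _ _ _ h2 h)
  · exfalso
    apply huq
    exact Ideal.mem_of_dvd q (map_dvd ι (hw0.dvd_of_dvd_pow h)) hw0q

theorem linear_prime {B : Type*} [CommRing B] [IsDomain B] [UniqueFactorizationMonoid B]
    (u f : B) (hu : Prime u) (hf : ¬ u ∣ f) :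
    Prime (Polynomial.C u * Polynomial.X + Polynomial.C f) := by
  apply Irreducible.prime
  apply Polynomial.irreducible_of_degree_eq_one_of_isRelPrime_coeff
  · exact Polynomial.degree_linear hu.ne_zero
  · simpa using (hu.irreducible.isRelPrime_iff_not_dvd.2 hf).symm

theorem linear_domain {B : Type*} [CommRing B] [IsDomain B] [UniqueFactorizationMonoid B]
    (u f : B) (hu : Prime u) (hf : ¬ u ∣ f) :
    IsDomain (Polynomial B ⧸ Ideal.span {Polynomial.C u * Polynomial.X + Polynomial.C f}) := by
  rw [Ideal.Quotient.isDomain_iff_prime]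
  have h := linear_prime u f hu hf
  exact (Ideal.span_singleton_prime h.ne_zero).2 h

theorem linear_ufd {B : Type*} [CommRing B] [IsDomain B] [UniqueFactorizationMonoid B]
    [IsNoetherianRing B]
    (u f : B) (hu : Prime u) (huf : (Ideal.span {u, f}).IsPrime)
    [IsDomain (Polynomial B ⧸ Ideal.span {Polynomial.C u * Polynomial.X + Polynomial.C f})] :
    UniqueFactorizationMonoid
      (Polynomial B ⧸ Ideal.span {Polynomial.C u * Polynomial.X + Polynomial.C f}) := by
  set G := Polynomial.C u * Polynomial.X + Polynomial.C f with hG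
  have hinj : ∀ b : B, Polynomial.C b ∈ Ideal.span {G} → b = 0 := by
    intro b hb
    by_contra hne
    have h1 := Polynomial.natDegree_le_of_dvd (Ideal.mem_span_singleton.1 hb)
      (Polynomial.C_ne_zero.2 hne)
    rw [hG, Polynomial.natDegree_linear hu.ne_zero, Polynomial.natDegree_C] at h1
    omega
  let ι : B →+* Polynomial B ⧸ Ideal.span {G} := (Ideal.Quotient.mk _).comp Polynomial.C
  have hrel : ι u * Ideal.Quotient.mk (Ideal.span {G}) Polynomial.X = ι (-f) := by
    change Ideal.Quotient.mk _ _ * Ideal.Quotient.mk _ _ = Ideal.Quotient.mk _ _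
    rw [← map_mul, Ideal.Quotient.eq, map_neg, sub_neg_eq_add]
    exact Ideal.mem_span_singleton_self G
  refine nagata ι ?_ u ?_ ?_
  · rw [injective_iff_map_eq_zero]
    intro b hb
    exact hinj b (Ideal.Quotient.eq_zero_iff_mem.1 hb)
  · apply prime_mk
    · have h1 : ((Ideal.span {u, f}).map Polynomial.C).IsPrime := Ideal.isPrime_map_C_of_isPrime
      suffices h2 : Ideal.span {Polynomial.C u, G} = (Ideal.span {u, f}).map Polynomial.C from
        h2 ▸ h1
      rw [Ideal.map_span, Set.image_pair, hG, add_comm (Polynomial.C u * Polynomial.X),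
        mul_comm (Polynomial.C u), Ideal.span_pair_add_mul_left]
    · intro h
      exact hu.ne_zero (hinj u h)
  · intro x
    obtain ⟨p, rfl⟩ := Ideal.Quotient.mk_surjective x
    induction p using Polynomial.induction_on with
    | C a => exact ⟨0, a, by rw [pow_zero, one_mul]; rfl⟩
    | add p q hp hq =>
      obtain ⟨n, a, h⟩ := hp
      obtain ⟨m, b, h'⟩ := hq
      refine ⟨n + m, u ^ m * a + u ^ n * b, ?_⟩
      rw [map_add, map_add, map_mul, map_mul, ← h, ← h', map_pow, map_pow]
      ring
    | monomial n a h =>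
      refine ⟨n + 1, a * (-f) ^ (n + 1), ?_⟩
      rw [map_mul, map_mul ι, map_pow ι, ← hrel, map_pow]
      change _ * (ι a * _) = _
      ring

section concrete

variable {k : Type*} [Field k]

theorem odd_not_sq (N : ℕ) (hN : Odd N) (s : PowerSeries k) : s ^ 2 ≠ PowerSeries.X ^ N := by
  intro h
  have h1 := congrArg PowerSeries.order h
  rw [PowerSeries.order_pow, PowerSeries.order_X_pow] at h1
  have hs : s ≠ 0 := by
    rintro rfl
    rw [zero_pow two_ne_zero] at h
    exact pow_ne_zero N PowerSeries.X_ne_zero h.symm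
  obtain ⟨m, hm⟩ := ENat.ne_top_iff_exists.1 (fun h => hs (PowerSeries.order_eq_top.1 h))
  rw [← hm] at h1
  have h2 : 2 * m = N := by
    rw [nsmul_eq_mul] at h1
    exact_mod_cast h1
  obtain ⟨c, hc⟩ := hN
  omega

theorem not_sq {n : ℕ} (h : MvPowerSeries (Fin n) k) (a : Fin n → k) (N : ℕ) (hN : Odd N)
    (ha : subst (arcv a) h = X () ^ N) (r : MvPowerSeries (Fin n) k) : r ^ 2 ≠ h := by
  rintro rfl
  rw [subst_pow (arcv_hs a)] at ha
  exact odd_not_sq N hN _ ha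

theorem comap_const {n : ℕ} (f : MvPowerSeries (Fin (n+1)) k) (f' : MvPowerSeries (Fin n) k)
    (hf : finSuccEquiv k n f = PowerSeries.C f') :
    Ideal.span {X 0, f} = (Ideal.span {f'}).comap
      ((PowerSeries.constantCoeff).comp (finSuccEquiv k n : _ →+* _)) := by
  apply le_antisymm
  · rw [Ideal.span_le]
    rintro x (rfl | rfl)
    · change PowerSeries.constantCoeff (finSuccEquiv k n (X 0)) ∈ Ideal.span {f'}
      rw [finSuccEquiv_X_zero]; simp
    · change PowerSeries.constantCoeff (finSuccEquiv k n _) ∈ Ideal.span {f'}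
      rw [hf]; simp [Ideal.mem_span_singleton_self]
  · intro F hF
    change PowerSeries.constantCoeff (finSuccEquiv k n F) ∈ Ideal.span {f'} at hF
    obtain ⟨c, hc⟩ := Ideal.mem_span_singleton.1 hF
    have h4 := PowerSeries.eq_shift_mul_X_add_const (finSuccEquiv k n F)
    rw [hc] at h4
    rw [Ideal.mem_span_pair]
    refine ⟨(finSuccEquiv k n).symm (PowerSeries.mk fun p => PowerSeries.coeff (p+1)
      (finSuccEquiv k n F)), (finSuccEquiv k n).symm (PowerSeries.C c), ?_⟩
    apply (finSuccEquiv k n).injective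
    rw [map_add, map_mul, map_mul, AlgEquiv.apply_symm_apply, AlgEquiv.apply_symm_apply,
      finSuccEquiv_X_zero, hf]
    conv_rhs => rw [h4]
    rw [map_mul]; ring

/-- transport of primality of a principal ideal along an equivalence -/
theorem span_prime_of_equiv {P Q : Type*} [CommRing P] [CommRing Q] (e : P ≃+* Q) (g : P) 
    (h : (Ideal.span {e g}).IsPrime) : (Ideal.span {g}).IsPrime := by
  have h2 : (Ideal.span {e g}).comap (e : P →+* Q) = Ideal.span {g} := by
    ext x
    simp only [Ideal.mem_comap, Ideal.mem_span_singleton, RingEquiv.coe_toRingHom]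
    exact map_dvd_iff e
  rw [← h2]
  exact Ideal.comap_isPrime _ _

theorem f2_prime [Infinite k] (N : ℕ) (hN : Odd N) :
    (Ideal.span {(X 0 ^ 2 - X 1 ^ N : MvPowerSeries (Fin 2) k)}).IsPrime := by
  apply span_prime_of_equiv (finSuccEquiv k 1).toRingEquiv
  have h : (finSuccEquiv k 1).toRingEquiv (X 0 ^ 2 - X 1 ^ N) =
      PowerSeries.X ^ 2 - PowerSeries.C (X 0 ^ N) := by
    change finSuccEquiv k 1 _ = _
    have := finSuccEquiv_X_succ (R := k) (0 : Fin 1)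
    rw [map_sub, map_pow, map_pow, finSuccEquiv_X_zero, ← Fin.succ_zero_eq_one,
      finSuccEquiv_X_succ, map_pow]
  rw [h]
  apply quad_prime
  · rw [mem_maximalIdeal_iff]; simp [hN.pos.ne']
  · apply not_sq _ (fun _ => 1) N hN
    rw [subst_pow (arcv_hs _), subst_X (arcv_hs _)]; simp [arcv]

theorem f3_prime [Infinite k] (N : ℕ) (hN : Odd N) :
    (Ideal.span {X 0, (X 1 ^ 2 - X 2 ^ N : MvPowerSeries (Fin 3) k)}).IsPrime := by
  rw [comap_const (X 1 ^ 2 - X 2 ^ N) (X 0 ^ 2 - X 1 ^ N)]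
  · have := f2_prime (k := k) N hN
    exact Ideal.comap_isPrime _ _
  · rw [map_sub, map_pow, map_pow, ← Fin.succ_zero_eq_one, finSuccEquiv_X_succ,
      ← Fin.succ_one_eq_two, finSuccEquiv_X_succ]
    simp

theorem not_dvd_of_arc {n : ℕ} (u f : MvPowerSeries (Fin n) k) (a : Fin n → k)
    (hu : subst (arcv a) u = 0) (hf : subst (arcv a) f ≠ 0) : ¬ u ∣ f := by
  rintro ⟨c, rfl⟩
  rw [subst_mul (arcv_hs a), hu, zero_mul] at hf
  exact hf rfl

theorem X0_not_dvd (N : ℕ) (hN : Odd N) :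
    ¬ (X 0 : MvPowerSeries (Fin 3) k) ∣ X 1 ^ 2 - X 2 ^ N := by
  apply not_dvd_of_arc _ _ (Pi.single 1 1)
  · rw [subst_X (arcv_hs _)]; simp [arcv]
  · rw [subst_sub (arcv_hs _), subst_pow (arcv_hs _), subst_pow (arcv_hs _),
      subst_X (arcv_hs _), subst_X (arcv_hs _)]
    simp [arcv, hN.pos.ne']
    exact PowerSeries.X_ne_zero


theorem X0_prime (n : ℕ) : Prime (X 0 : MvPowerSeries (Fin (n+1)) k) := by
  rw [← MulEquiv.prime_iff (finSuccEquiv k n)]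
  rw [finSuccEquiv_X_zero]
  exact PowerSeries.X_prime

end concrete

section kernel

variable {k : Type*} [Field k]

theorem finSucc_rename {n : ℕ} (a : MvPowerSeries (Fin n) k) :
    finSuccEquiv k n (rename (Fin.succEmb n) a) = PowerSeries.C a := by
  ext d m
  rw [coeff_coeff_finSuccEquiv, PowerSeries.coeff_C]
  split_ifs with h
  · subst h
    have : (Finsupp.cons 0 m : Fin (n+1) →₀ ℕ) = Finsupp.embDomain (Fin.succEmb n) m := by
      ext i
      refine Fin.cases ?_ (fun j => ?_) i
      · rw [Finsupp.cons_zero, Finsupp.embDomain_of_notMem_range]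
        simp
      · rw [Finsupp.cons_succ]
        exact (Finsupp.embDomain_apply_self (Fin.succEmb n) m j).symm
    rw [this, coeff_embDomain_rename]
  · rw [coeff_rename_eq_zero, map_zero]
    rintro ⟨x, hx⟩
    have := DFunLike.congr_fun hx 0
    rw [Finsupp.cons_zero] at this
    apply h
    rw [← this, Finsupp.mapDomain_of_notMem_range]
    simp

theorem subst_finSucc_symm {n : ℕ} {τ : Type*} (s : Fin (n+1) → MvPowerSeries τ k)
    (hs : HasSubst s) (a : MvPowerSeries (Fin n) k) :
    subst s ((finSuccEquiv k n).symm (PowerSeries.C a)) = subst (fun j => s j.succ) a := by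
  rw [← finSucc_rename, AlgEquiv.symm_apply_apply, rename_eq_subst,
    subst_comp_subst_apply (HasSubst.X_comp _) hs]
  congr 1
  funext j
  rw [Function.comp_apply, subst_X hs]; rfl

/-- the substitution `u ↦ q², v ↦ p², t ↦ 0` -/
noncomputable def psiv (k : Type*) [Field k] : Fin 3 → MvPowerSeries (Fin 2) k :=
  ![X 0 ^ 2, X 1 ^ 2, 0]

theorem psiv_hs : HasSubst (psiv k) := hasSubst_of_constantCoeff_zero (by
  intro i; fin_cases i <;> simp [psiv])

theorem psiv_prod (e : Fin 3 →₀ ℕ) :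
    (e.prod fun s m => (psiv k s) ^ m) =
      monomial (Finsupp.single 0 (2 * e 0) + Finsupp.single 1 (2 * e 1)) (0 ^ e 2) := by
  rw [Finsupp.prod_fintype _ _ (by simp), Fin.prod_univ_three]
  simp only [psiv, Matrix.cons_val_zero, Matrix.cons_val_one, Matrix.cons_val]
  rw [← pow_mul, ← pow_mul, X_pow_eq, X_pow_eq, monomial_mul_monomial]
  by_cases h : e 2 = 0
  · simp [h]
  · simp [h]

theorem psi_zero (a : MvPowerSeries (Fin 3) k) (h : subst (psiv k) a = 0) : X 2 ∣ a := by
  classical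
  rw [X_dvd_iff]
  intro m hm
  have h1 := congrArg
    (coeff (Finsupp.single 0 (2 * m 0) + Finsupp.single 1 (2 * m 1) : Fin 2 →₀ ℕ)) h
  rw [coeff_subst psiv_hs, finsum_eq_single _ m, LinearMap.map_zero, psiv_prod, hm,
    coeff_monomial, if_pos rfl] at h1
  · simpa using h1
  · intro e he
    rw [psiv_prod, coeff_monomial]
    split_ifs with h2
    · have h3 := DFunLike.congr_fun h2 0
      have h4 := DFunLike.congr_fun h2 1
      simp at h3 h4
      have h5 : e 2 ≠ 0 := by
        intro h5
        apply he
        ext i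
        fin_cases i
        · exact h3.symm
        · exact h4.symm
        · exact h5.trans hm.symm
      simp [h5]
    · simp

/-- the parametrization of the cone -/
noncomputable def phiv (i : k) : Fin 4 → MvPowerSeries (Fin 2) k :=
  ![C i * (X 0 * X 1), X 0 ^ 2, X 1 ^ 2, 0]

theorem phiv_hs (i : k) : HasSubst (phiv i) := hasSubst_of_constantCoeff_zero (by
  intro j; fin_cases j <;> simp [phiv])

noncomputable def g1 (k : Type*) [Field k] (N : ℕ) : MvPowerSeries (Fin 4) k :=
  X 0 ^ 2 + X 1 * X 2 - X 3 ^ N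

theorem finSucc_g1 (N : ℕ) : finSuccEquiv k 3 (g1 k N) =
    PowerSeries.X ^ 2 - PowerSeries.C (X 2 ^ N - X 0 * X 1) := by
  have h1 : finSuccEquiv k 3 (X 1) = PowerSeries.C (X 0) := finSuccEquiv_X_succ (0 : Fin 3)
  have h2 : finSuccEquiv k 3 (X 2) = PowerSeries.C (X 1) := finSuccEquiv_X_succ (1 : Fin 3)
  have h3 : finSuccEquiv k 3 (X 3) = PowerSeries.C (X 2) := finSuccEquiv_X_succ (2 : Fin 3)
  rw [g1, map_sub, map_add, map_pow, map_mul, map_pow, h1, h2, h3, finSuccEquiv_X_zero,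
    map_sub, map_mul, map_pow]
  ring

theorem g1_prime [Infinite k] (N : ℕ) (hN : Odd N) : (Ideal.span {g1 k N}).IsPrime := by
  apply span_prime_of_equiv (finSuccEquiv k 3).toRingEquiv
  have h : (finSuccEquiv k 3).toRingEquiv (g1 k N) = _ := finSucc_g1 N
  rw [h]
  apply quad_prime
  · rw [mem_maximalIdeal_iff]; simp [hN.pos.ne']
  · apply not_sq _ (Pi.single 2 1) N hN
    rw [subst_sub (arcv_hs _), subst_pow (arcv_hs _), subst_mul (arcv_hs _),
      subst_X (arcv_hs _), subst_X (arcv_hs _), subst_X (arcv_hs _)]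
    simp [arcv]

theorem phi_g1 (i : k) (hi : i ^ 2 = -1) (N : ℕ) (hN : Odd N) :
    subst (phiv i) (g1 k N) = 0 := by
  have hs := phiv_hs i
  rw [g1, subst_sub hs, subst_add hs, subst_pow hs, subst_pow hs, subst_mul hs,
    subst_X hs, subst_X hs, subst_X hs, subst_X hs]
  simp only [phiv, Matrix.cons_val_zero, Matrix.cons_val_one, Matrix.cons_val]
  rw [zero_pow hN.pos.ne', mul_pow, ← map_pow, hi, map_neg, map_one]
  ring

theorem division {A : Type*} [CommRing A] [IsLocalRing A]
    [IsAdicComplete (IsLocalRing.maximalIdeal A) A] (h : A)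
    (hm : h ∈ IsLocalRing.maximalIdeal A) (F : PowerSeries A) :
    ∃ (c : PowerSeries A) (a b : A), F = (PowerSeries.X ^ 2 - PowerSeries.C h) * c +
      PowerSeries.C a + PowerSeries.C b * PowerSeries.X := by
  set P : Polynomial A := Polynomial.X ^ 2 - Polynomial.C h with hP
  have hmon : P.Monic := Polynomial.monic_X_pow_sub_C h two_ne_zero
  have hdeg : P.natDegree = 2 := Polynomial.natDegree_X_pow_sub_C
  have hd : P.IsDistinguishedAt (IsLocalRing.maximalIdeal A) := by
    refine ⟨⟨?_⟩, hmon⟩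
    intro n hn
    rw [hdeg] at hn
    interval_cases n
    · simpa [hP] using hm
    · simp [hP, Polynomial.coeff_X_pow]
  obtain ⟨y, hy⟩ := hd.algEquivQuotient.surjective (Ideal.Quotient.mk _ F)
  obtain ⟨q, rfl⟩ := Ideal.Quotient.mk_surjective y
  have h1 : (Ideal.Quotient.mk (Ideal.span {(P : PowerSeries A)})) F =
    (Ideal.Quotient.mk (Ideal.span {(P : PowerSeries A)})) (q : PowerSeries A) := hy.symm
  rw [Ideal.Quotient.eq, Ideal.mem_span_singleton] at h1
  obtain ⟨c, hc⟩ := h1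
  have h2 := Polynomial.modByMonic_add_div q P
  have h3 : (q %ₘ P).natDegree ≤ 1 := by
    have := Polynomial.natDegree_modByMonic_lt q hmon (by
      intro h; rw [h] at hdeg; simp at hdeg)
    omega
  obtain ⟨b, a, hab⟩ := Polynomial.exists_eq_X_add_C_of_natDegree_le_one h3
  rw [hab] at h2
  have hPc : (P : PowerSeries A) = PowerSeries.X ^ 2 - PowerSeries.C h := by
    rw [hP]; simp
  have h4 := congrArg (fun t : Polynomial A => (t : PowerSeries A)) h2
  simp only [Polynomial.coe_add, Polynomial.coe_mul, Polynomial.coe_C, Polynomial.coe_X] at h4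
  refine ⟨c + ((q /ₘ P : Polynomial A) : PowerSeries A), a, b, ?_⟩
  rw [← hPc, mul_add, ← hc, ← sub_eq_zero]
  rw [← sub_eq_zero] at h4
  linear_combination -h4

theorem ker_phi [CharZero k] (i : k) (hi : i ^ 2 = -1) (N : ℕ) (hN : Odd N)
    (F : MvPowerSeries (Fin 4) k) (hF : subst (phiv i) F = 0) :
    F ∈ Ideal.span {X 3, g1 k N} := by
  set e := finSuccEquiv k 3
  have h3 : e (X 3) = PowerSeries.C (X 2) := finSuccEquiv_X_succ (2 : Fin 3)
  obtain ⟨c, a, b, h⟩ := division (X 2 ^ N - X 0 * X 1 : MvPowerSeries (Fin 3) k)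
    (by rw [mem_maximalIdeal_iff]; simp [hN.pos.ne']) (e F)
  have hs := phiv_hs i
  have h1 : F = g1 k N * e.symm c + e.symm (PowerSeries.C a) +
      e.symm (PowerSeries.C b) * X 0 := by
    apply e.injective
    rw [map_add, map_add, map_mul, map_mul, AlgEquiv.apply_symm_apply,
      AlgEquiv.apply_symm_apply, AlgEquiv.apply_symm_apply, finSucc_g1, finSuccEquiv_X_zero]
    exact h
  have hpsi : (fun j : Fin 3 => phiv i j.succ) = psiv k := by
    funext j
    fin_cases j <;> rfl
  have h2 : subst (psiv k) a + subst (psiv k) b * (C i * (X 0 * X 1)) = 0 := by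
    rw [h1, subst_add hs, subst_add hs, subst_mul hs, subst_mul hs, phi_g1 i hi N hN,
      subst_finSucc_symm _ hs, subst_finSucc_symm _ hs, subst_X hs, hpsi, zero_mul,
      zero_add] at hF
    exact hF
  -- parity
  let σ : Fin 2 → MvPowerSeries (Fin 2) k := ![X 0, - X 1]
  have hσ : HasSubst σ := hasSubst_of_constantCoeff_zero (by
    intro j; fin_cases j <;> simp [σ])
  have hσψ : ∀ a : MvPowerSeries (Fin 3) k, subst σ (subst (psiv k) a) = subst (psiv k) a := by
    intro a
    rw [subst_comp_subst_apply psiv_hs hσ]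
    congr 1
    funext j
    fin_cases j
    · change subst σ (X 0 ^ 2 : MvPowerSeries (Fin 2) k) = X 0 ^ 2
      rw [subst_pow hσ, subst_X hσ]; rfl
    · change subst σ (X 1 ^ 2 : MvPowerSeries (Fin 2) k) = X 1 ^ 2
      rw [subst_pow hσ, subst_X hσ]
      simp [σ]
    · change subst σ (0 : MvPowerSeries (Fin 2) k) = 0
      rw [← coe_substAlgHom hσ, map_zero]
  have h4 := congrArg (subst σ) h2
  rw [subst_add hσ, subst_mul hσ, subst_C_mul hσ, subst_mul hσ, subst_X hσ, subst_X hσ, hσψ,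
    hσψ, ← coe_substAlgHom hσ, map_zero] at h4
  simp only [σ, Matrix.cons_val_zero, Matrix.cons_val_one] at h4
  have h5 : (2 : MvPowerSeries (Fin 2) k) * subst (psiv k) a = 0 := by
    linear_combination h2 + h4
  have two : (2 : MvPowerSeries (Fin 2) k) ≠ 0 := by
    intro h
    have := congrArg constantCoeff h
    rw [map_ofNat, map_zero] at this
    exact two_ne_zero this
  have ha := (mul_eq_zero.1 h5).resolve_left two
  rw [ha, zero_add] at h2
  have hi0 : i ≠ 0 := by rintro rfl; simp at hi
  have hX : ∀ j : Fin 2, (X j : MvPowerSeries (Fin 2) k) ≠ 0 := by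
    intro j h
    have := congrArg (coeff (Finsupp.single j 1)) h
    simp [coeff_X] at this
  have hC : (C i : MvPowerSeries (Fin 2) k) ≠ 0 := by
    intro h
    have := congrArg constantCoeff h
    simp [hi0] at this
  have hb := (mul_eq_zero.1 h2).resolve_right (mul_ne_zero hC (mul_ne_zero (hX 0) (hX 1)))
  obtain ⟨a', rfl⟩ := psi_zero a ha
  obtain ⟨b', rfl⟩ := psi_zero b hb
  have h6 : ∀ a, e.symm (PowerSeries.C (X 2 * a)) = X 3 * e.symm (PowerSeries.C a) := by
    intro a
    apply e.injective
    rw [map_mul e, h3, AlgEquiv.apply_symm_apply, AlgEquiv.apply_symm_apply, map_mul]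
  rw [h6, h6] at h1
  rw [Ideal.mem_span_pair]
  refine ⟨e.symm (PowerSeries.C a') + e.symm (PowerSeries.C b') * X 0, e.symm c, ?_⟩
  rw [h1]; ring

theorem X3_prime [CharZero k] (i : k) (hi : i ^ 2 = -1) (N : ℕ) (hN : Odd N) :
    (Ideal.span {X 3, g1 k N}).IsPrime := by
  have h : Ideal.span {X 3, g1 k N} =
      RingHom.ker (substAlgHom (R := k) (phiv_hs i)).toRingHom := by
    apply le_antisymm
    · rw [Ideal.span_le]
      rintro x (rfl | rfl)
      · change substAlgHom (phiv_hs i) (X 3) = 0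
        rw [coe_substAlgHom, subst_X (phiv_hs i)]; rfl
      · change substAlgHom (phiv_hs i) _ = 0
        rw [coe_substAlgHom, phi_g1 i hi N hN]
    · intro F hF
      change substAlgHom (phiv_hs i) F = 0 at hF
      rw [coe_substAlgHom] at hF
      exact ker_phi i hi N hN F hF
  rw [h]
  exact RingHom.ker_isPrime _

end kernel

section main

variable {k : Type*} [Field k]

noncomputable def g2 (k : Type*) [Field k] (N : ℕ) : MvPowerSeries (Fin 4) k :=
  X 0 * X 1 + X 2 ^ 2 - X 3 ^ N

/-- the polynomial corresponding to `g2` -/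
noncomputable def g2p (k : Type*) [Field k] (N : ℕ) : Polynomial (MvPowerSeries (Fin 3) k) :=
  Polynomial.C (X 0) * Polynomial.X + Polynomial.C (X 1 ^ 2 - X 2 ^ N)

theorem finSucc_g2 (N : ℕ) : finSuccEquiv k 3 (g2 k N) =
    (g2p k N : PowerSeries (MvPowerSeries (Fin 3) k)) := by
  have h1 : finSuccEquiv k 3 (X 1) = PowerSeries.C (X 0) := finSuccEquiv_X_succ (0 : Fin 3)
  have h2 : finSuccEquiv k 3 (X 2) = PowerSeries.C (X 1) := finSuccEquiv_X_succ (1 : Fin 3)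
  have h3 : finSuccEquiv k 3 (X 3) = PowerSeries.C (X 2) := finSuccEquiv_X_succ (2 : Fin 3)
  rw [g2, map_sub, map_add, map_pow, map_mul, map_pow, h1, h2, h3, finSuccEquiv_X_zero, g2p,
    Polynomial.coe_add, Polynomial.coe_mul, Polynomial.coe_C, Polynomial.coe_C, Polynomial.coe_X,
    map_sub, map_pow, map_pow]
  ring

noncomputable def Ta (d c : k) : Fin 4 → MvPowerSeries (Fin 4) k :=
  ![X 2 + C d * X 0, X 0, X 1 - C (2 * d) * X 2 + C (c ^ 2) * X 0, X 3]

noncomputable def Tb (d c : k) : Fin 4 → MvPowerSeries (Fin 4) k :=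
  ![X 1, X 2 + C (2 * d) * X 0 + C (c ^ 2) * X 1, X 0 - C d * X 1, X 3]

theorem Ta_hs (d c : k) : HasSubst (Ta d c) := hasSubst_of_constantCoeff_zero (by
  intro j; fin_cases j <;> simp [Ta])

theorem Tb_hs (d c : k) : HasSubst (Tb d c) := hasSubst_of_constantCoeff_zero (by
  intro j; fin_cases j <;> simp [Tb])

theorem Tab (d c : k) (hd : d ^ 2 = - c ^ 2) (j : Fin 4) : subst (Tb d c) (Ta d c j) = X j := by
  have hs := Tb_hs d c
  have hC : (C d : MvPowerSeries (Fin 4) k) ^ 2 = - C (c ^ 2) := by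
    rw [← map_pow, hd, map_neg]
  fin_cases j
  · change subst (Tb d c) (X 2 + C d * X 0) = X 0
    rw [subst_add hs, subst_C_mul hs, subst_X hs, subst_X hs]
    simp [Tb]
  · change subst (Tb d c) (X 0) = X 1
    rw [subst_X hs]
    simp [Tb]
  · change subst (Tb d c) (X 1 - C (2 * d) * X 2 + C (c ^ 2) * X 0) = X 2
    rw [subst_add hs, subst_sub hs, subst_C_mul hs, subst_C_mul hs, subst_X hs, subst_X hs,
      subst_X hs]
    simp only [Tb, Matrix.cons_val_zero, Matrix.cons_val_one, Matrix.cons_val]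
    rw [map_mul, map_ofNat]
    linear_combination 2 * X 1 * hC
  · change subst (Tb d c) (X 3) = X 3
    rw [subst_X hs]
    simp [Tb]

theorem Tba (d c : k) (hd : d ^ 2 = - c ^ 2) (j : Fin 4) : subst (Ta d c) (Tb d c j) = X j := by
  have hs := Ta_hs d c
  have hC : (C d : MvPowerSeries (Fin 4) k) ^ 2 = - C (c ^ 2) := by
    rw [← map_pow, hd, map_neg]
  fin_cases j
  · change subst (Ta d c) (X 1) = X 0
    rw [subst_X hs]
    simp [Ta]
  · change subst (Ta d c) (X 2 + C (2 * d) * X 0 + C (c ^ 2) * X 1) = X 1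
    rw [subst_add hs, subst_add hs, subst_C_mul hs, subst_C_mul hs, subst_X hs, subst_X hs,
      subst_X hs]
    simp only [Ta, Matrix.cons_val_zero, Matrix.cons_val_one, Matrix.cons_val]
    rw [map_mul, map_ofNat]
    linear_combination 2 * X 0 * hC
  · change subst (Ta d c) (X 0 - C d * X 1) = X 2
    rw [subst_sub hs, subst_C_mul hs, subst_X hs, subst_X hs]
    simp [Ta]
  · change subst (Ta d c) (X 3) = X 3
    rw [subst_X hs]
    simp [Ta]

theorem exists_T [Infinite k] (i : k) (hi : i ^ 2 = -1) (N : ℕ) (r : MvPowerSeries (Fin 4) k)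
    (hr : subst (phiv i) r ≠ 0) :
    ∃ e : MvPowerSeries (Fin 4) k ≃ₐ[k] MvPowerSeries (Fin 4) k, e (g1 k N) = g2 k N ∧
      (finSuccEquiv k 3 (e r)).map (IsLocalRing.residue _) ≠ 0 := by
  obtain ⟨a, ha0, ha⟩ := exists_arc _ hr
  set c := a 1 with hc
  set d := i * c with hdd
  have hd : d ^ 2 = - c ^ 2 := by rw [hdd, mul_pow, hi]; ring
  have hC : (C d : MvPowerSeries (Fin 4) k) ^ 2 = - C (c ^ 2) := by
    rw [← map_pow, hd, map_neg]
  have hs := Ta_hs d c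
  refine ⟨substEquiv (Ta d c) (Tb d c) hs (Tb_hs d c) (Tab d c hd) (Tba d c hd), ?_, ?_⟩
  · rw [substEquiv_apply, g1, g2, subst_sub hs, subst_add hs, subst_pow hs, subst_pow hs,
      subst_mul hs, subst_X hs, subst_X hs, subst_X hs, subst_X hs]
    simp only [Ta, Matrix.cons_val_zero, Matrix.cons_val_one, Matrix.cons_val]
    have h2d : (C (2 * d) : MvPowerSeries (Fin 4) k) = 2 * C d := by
      rw [map_mul (C (σ := Fin 4)) 2 d, map_ofNat]
    rw [h2d]
    linear_combination X 0 ^ 2 * hC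
  · apply regular_of_arc
    rw [substEquiv_apply]
    intro h0
    apply ha
    let sq : Unit → MvPowerSeries Unit k := fun _ => X () ^ 2
    have hsq : HasSubst sq := hasSubst_of_constantCoeff_zero (by intro j; simp [sq])
    have hA := arcv_hs (Pi.single 0 1 : Fin 4 → k)
    have hcomp : HasSubst
        (fun s => subst (arcv (Pi.single 0 1 : Fin 4 → k)) (Ta d c s)) := by
      simpa only [coe_substAlgHom] using hs.comp hA
    have h1 := congrArg (subst sq) h0
    rw [← coe_substAlgHom hsq, map_zero, coe_substAlgHom hsq,
      subst_comp_subst_apply hs hA, subst_comp_subst_apply hcomp hsq] at h1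
    rw [subst_comp_subst_apply (phiv_hs i) (arcv_hs a), ← h1]
    congr 1
    funext j
    have hB := arcv_hs a
    have hX : subst sq (X () : MvPowerSeries Unit k) = X () ^ 2 := by rw [subst_X hsq]
    fin_cases j
    · change subst (arcv a) (C i * (X 0 * X 1)) = subst sq (subst (arcv _) (X 2 + C d * X 0))
      rw [subst_C_mul hB, subst_mul hB, subst_X hB, subst_X hB, subst_add hA, subst_C_mul hA,
        subst_X hA, subst_X hA]
      simp only [arcv, ha0, ← hc]
      simp [-map_mul, subst_C_mul hsq, hX]
      rw [hdd, map_mul]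
      ring
    · change subst (arcv a) (X 0 ^ 2) = subst sq (subst (arcv _) (X 0))
      rw [subst_pow hB, subst_X hB, subst_X hA]
      simp only [arcv, ha0]
      simp [hX]
    · change subst (arcv a) (X 1 ^ 2) = subst sq (subst (arcv _)
        (X 1 - C (2 * d) * X 2 + C (c ^ 2) * X 0))
      rw [subst_pow hB, subst_X hB, subst_add hA, subst_sub hA, subst_C_mul hA, subst_C_mul hA,
        subst_X hA, subst_X hA, subst_X hA]
      simp only [arcv, ← hc]
      simp [-map_pow, subst_C_mul hsq, hX]
      rw [map_pow]
      ring
    · change subst (arcv a) (0 : MvPowerSeries (Fin 2) k) = subst sq (subst (arcv _) (X 3))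
      rw [subst_X hA, ← coe_substAlgHom hB, map_zero]
      simp only [arcv]
      simp
      rw [← coe_substAlgHom hsq, map_zero]

theorem X3_not_mem (N : ℕ) (hN : 2 ≤ N) :
    (X 3 : MvPowerSeries (Fin 4) k) ∉ Ideal.span {g1 k N} := by
  intro h
  obtain ⟨c, hc⟩ := Ideal.mem_span_singleton.1 h
  have hA := arcv_hs (Pi.single 3 1 : Fin 4 → k)
  have h1 := congrArg (subst (arcv (Pi.single 3 1 : Fin 4 → k))) hc
  rw [g1, subst_mul hA, subst_sub hA, subst_add hA, subst_pow hA, subst_pow hA, subst_mul hA,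
    subst_X hA, subst_X hA, subst_X hA, subst_X hA] at h1
  simp only [arcv] at h1
  simp at h1
  have h2 : (PowerSeries.X : PowerSeries k) ^ 2 ∣ PowerSeries.X := by
    have h3 : (PowerSeries.X : PowerSeries k) ^ N ∣ PowerSeries.X :=
      ⟨-subst (arcv (Pi.single 3 1 : Fin 4 → k)) c, by
        rw [mul_neg]; exact h1⟩
    exact (pow_dvd_pow _ hN).trans h3
  rw [PowerSeries.X_pow_dvd_iff] at h2
  have := h2 1 (by norm_num)
  simp at this

theorem span_pair_prime_of_equiv {P Q : Type*} [CommRing P] [CommRing Q] (e : P ≃+* Q) (g π : P)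
    (h : (Ideal.span {e π, e g}).IsPrime) : (Ideal.span {π, g}).IsPrime := by
  have h2 : (Ideal.span {π, g}).map e.symm.symm = Ideal.span {e π, e g} := by
    rw [Ideal.map_span, Set.image_pair]; rfl
  rw [Ideal.map_symm] at h2
  have h3 : Ideal.span {π, g} = (Ideal.span {e π, e g}).comap e := by
    rw [← h2]
    ext x
    simp
  rw [h3]
  exact Ideal.comap_isPrime _ _

theorem ufd_g1 [CharZero k] (i : k) (hi : i ^ 2 = -1) (N : ℕ) (hN : Odd N) (hN2 : 2 ≤ N)
    [IsDomain (MvPowerSeries (Fin 4) k ⧸ Ideal.span {g1 k N})] :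
    UniqueFactorizationMonoid (MvPowerSeries (Fin 4) k ⧸ Ideal.span {g1 k N}) := by
  apply UniqueFactorizationMonoid.iff_exists_prime_mem_of_isPrime.2
  intro q hq0 hq
  set p := q.comap (Ideal.Quotient.mk (Ideal.span {g1 k N})) with hp
  have hpp : p.IsPrime := Ideal.comap_isPrime _ _
  have hgp : g1 k N ∈ p := by
    rw [hp, Ideal.mem_comap, Ideal.Quotient.eq_zero_iff_mem.2 (Ideal.mem_span_singleton_self _)]
    exact zero_mem _
  have hnle : ¬ p ≤ Ideal.span {g1 k N} := by
    intro hle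
    apply hq0
    rw [eq_bot_iff]
    intro x hx
    obtain ⟨F, rfl⟩ := Ideal.Quotient.mk_surjective x
    exact Ideal.Quotient.eq_zero_iff_mem.2 (hle hx)
  by_cases hX : X 3 ∈ p
  · exact ⟨_, hX, prime_mk (X3_prime i hi N hN) (X3_not_mem N hN2)⟩
  have hr : ∃ r ∈ p, r ∉ Ideal.span {X 3, g1 k N} := by
    by_contra! hcon
    apply hnle
    apply Submodule.le_of_le_smul_of_le_jacobson_bot (I := Ideal.span {X 3})
      (IsNoetherian.noetherian p)
    · rw [IsLocalRing.jacobson_eq_maximalIdeal _ bot_ne_top, Ideal.span_singleton_le_iff_mem,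
        mem_maximalIdeal_iff]
      simp
    · intro F hF
      obtain ⟨a, b, hab⟩ := Ideal.mem_span_pair.1 (hcon F hF)
      have h1 : a * X 3 ∈ p := by
        have : a * X 3 = F - b * g1 k N := by rw [← hab]; ring
        rw [this]
        exact sub_mem hF (Ideal.mul_mem_left _ _ hgp)
      have ha : a ∈ p := (hpp.mem_or_mem h1).resolve_right hX
      rw [← hab, add_comm]
      refine Submodule.add_mem_sup
        (Ideal.mul_mem_left _ _ (Ideal.mem_span_singleton_self _)) ?_
      rw [mul_comm]
      exact Ideal.mul_mem_mul (Ideal.mem_span_singleton_self _) ha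
  obtain ⟨r, hrp, hr⟩ := hr
  have hr1 : r ∉ Ideal.span {g1 k N} := fun h => hr (Ideal.span_mono (by simp) h)
  obtain ⟨e, heg, he⟩ := exists_T i hi N r (fun h => hr (ker_phi i hi N hN r h))
  let ε : MvPowerSeries (Fin 4) k ≃+* PowerSeries (MvPowerSeries (Fin 3) k) :=
    (e.trans (finSuccEquiv k 3)).toRingEquiv
  have hεg : ε (g1 k N) = (g2p k N : PowerSeries (MvPowerSeries (Fin 3) k)) := by
    change finSuccEquiv k 3 (e _) = _
    rw [heg, finSucc_g2]
  have hmem : ∀ x, ε x ∈ Ideal.span {ε (g1 k N)} ↔ x ∈ Ideal.span {g1 k N} := by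
    intro x
    rw [Ideal.mem_span_singleton, Ideal.mem_span_singleton]
    exact map_dvd_iff ε
  have : IsDomain (Polynomial (MvPowerSeries (Fin 3) k) ⧸ Ideal.span {g2p k N}) :=
    linear_domain _ _ (X0_prime 2) (X0_not_dvd N hN)
  have : UniqueFactorizationMonoid
      (Polynomial (MvPowerSeries (Fin 3) k) ⧸ Ideal.span {g2p k N}) :=
by
    unfold g2p at *
    exact linear_ufd _ _ (X0_prime 2) (f3_prime N hN)
  obtain ⟨π, hπ, hπ1, hπ2⟩ := weier (g2p k N)
    (p.comap (ε.symm : _ →+* _)) (Ideal.comap_isPrime _ _)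
    (by rw [← hεg]; simpa using hgp) (ε r)
    (by simpa using hrp) (by rw [← hεg, hmem]; exact hr1) he
  obtain ⟨π, rfl⟩ := ε.surjective π
  rw [← hεg] at hπ1 hπ2
  refine ⟨_, ?_, prime_mk (span_pair_prime_of_equiv ε _ π hπ1) (fun h => hπ2 ((hmem _).2 h))⟩
  have h3 : ε.symm (ε π) ∈ p := hπ
  rw [RingEquiv.symm_apply_apply] at h3
  exact h3

end main

section final

variable {k : Type*} [Field k]

noncomputable def Ea (i s : k) : Fin 4 → MvPowerSeries (Fin 4) k :=
  ![X 0, C s * (X 1 + X 2), C (-(i * s)) * (X 1 - X 2), X 3]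

noncomputable def Eb (i : k) : Fin 4 → MvPowerSeries (Fin 4) k :=
  ![X 0, X 1 + C i * X 2, X 1 - C i * X 2, X 3]

theorem Ea_hs (i s : k) : HasSubst (Ea i s) := hasSubst_of_constantCoeff_zero (by
  intro j; fin_cases j <;> simp [Ea])

theorem Eb_hs (i : k) : HasSubst (Eb i) := hasSubst_of_constantCoeff_zero (by
  intro j; fin_cases j <;> simp [Eb])

theorem exists_E (i s : k) (hi : i ^ 2 = -1) (h2 : 2 * s = 1) (N : ℕ) :
    ∃ e : MvPowerSeries (Fin 4) k ≃ₐ[k] MvPowerSeries (Fin 4) k,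
      e (X 0 ^ 2 + X 1 ^ 2 + X 2 ^ 2 - X 3 ^ N) = g1 k N := by
  have ha := Ea_hs i s
  have hb := Eb_hs i
  have hI : (C i : MvPowerSeries (Fin 4) k) ^ 2 = -1 := by
    rw [← map_pow, hi, map_neg, map_one]
  have hS : 2 * (C s : MvPowerSeries (Fin 4) k) = 1 := by
    rw [← map_one (C (σ := Fin 4) (R := k)), ← h2, map_mul, map_ofNat]
  have hIS : (C (-(i * s)) : MvPowerSeries (Fin 4) k) = - (C i * C s) := by
    rw [map_neg, map_mul]
  refine ⟨substEquiv (Ea i s) (Eb i) ha hb ?_ ?_, ?_⟩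
  · intro j
    fin_cases j
    · change subst (Eb i) (X 0) = X 0
      rw [subst_X hb]; rfl
    · change subst (Eb i) (C s * (X 1 + X 2)) = X 1
      rw [subst_C_mul hb, subst_add hb, subst_X hb, subst_X hb]
      simp only [Eb, Matrix.cons_val_zero, Matrix.cons_val_one, Matrix.cons_val]
      linear_combination X 1 * hS
    · change subst (Eb i) (C (-(i * s)) * (X 1 - X 2)) = X 2
      rw [subst_C_mul hb, subst_sub hb, subst_X hb, subst_X hb, hIS]
      simp only [Eb, Matrix.cons_val_zero, Matrix.cons_val_one, Matrix.cons_val]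
      linear_combination X 2 * hS - 2 * C s * X 2 * hI
    · change subst (Eb i) (X 3) = X 3
      rw [subst_X hb]; rfl
  · intro j
    fin_cases j
    · change subst (Ea i s) (X 0) = X 0
      rw [subst_X ha]; rfl
    · change subst (Ea i s) (X 1 + C i * X 2) = X 1
      rw [subst_add ha, subst_C_mul ha, subst_X ha, subst_X ha]
      simp only [Ea, Matrix.cons_val_zero, Matrix.cons_val_one, Matrix.cons_val]
      rw [hIS]
      linear_combination X 1 * hS - C s * (X 1 - X 2) * hI
    · change subst (Ea i s) (X 1 - C i * X 2) = X 2
      rw [subst_sub ha, subst_C_mul ha, subst_X ha, subst_X ha]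
      simp only [Ea, Matrix.cons_val_zero, Matrix.cons_val_one, Matrix.cons_val]
      rw [hIS]
      linear_combination X 2 * hS + C s * (X 1 - X 2) * hI
    · change subst (Ea i s) (X 3) = X 3
      rw [subst_X ha]; rfl
  · rw [substEquiv_apply, g1, subst_sub ha, subst_add ha, subst_add ha, subst_pow ha,
      subst_pow ha, subst_pow ha, subst_pow ha, subst_X ha, subst_X ha, subst_X ha, subst_X ha]
    simp only [Ea, Matrix.cons_val_zero, Matrix.cons_val_one, Matrix.cons_val]
    rw [hIS]
    linear_combination X 1 * X 2 * (2 * C s + 1) * hS + (C s) ^ 2 * (X 1 - X 2) ^ 2 * hI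

end final

theorem ring_equiv (k : Type) [Field k] [IsAlgClosed k] [CharZero k] (b : ℕ) :
    Nonempty (cDVring k b ≃+* (MvPowerSeries (Fin 4) k ⧸ Ideal.span {g1 k (2 * b + 1)})) := by
  obtain ⟨i, hi⟩ := IsAlgClosed.exists_pow_nat_eq (-1 : k) (n := 2) (by norm_num)
  obtain ⟨e, he⟩ := exists_E i (1 / 2) hi (by norm_num) (2 * b + 1)
  refine ⟨Ideal.quotientEquiv _ _ e.toRingEquiv ?_⟩
  rw [Ideal.map_span, Set.image_singleton]
  have : (e.toRingEquiv : MvPowerSeries (Fin 4) k →+* _) (cDVeqn k b) = g1 k (2 * b + 1) := he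
  rw [this]

end CDV

/-- For `k` algebraically closed of characteristic zero and `b ≥ 1`,
the ring `R = k⟦x,y,z,t⟧/(x² + y² + z² − t^{2b+1})` is a factorial (UFD) complete local
domain; in particular `Cl(R) = 0`, i.e. every rank one reflexive `R`-module is free. -/
theorem stmt16 (k : Type) [Field k] [IsAlgClosed k] [CharZero k] (b : ℕ) (hb : 1 ≤ b) :
    IsLocalRing (cDVring k b) ∧
    (∀ [IsLocalRing (cDVring k b)],
      IsAdicComplete (IsLocalRing.maximalIdeal (cDVring k b)) (cDVring k b)) ∧
    IsDomain (cDVring k b) ∧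
    (∀ [IsDomain (cDVring k b)], UniqueFactorizationMonoid (cDVring k b)) := by
  have hN : Odd (2 * b + 1) := ⟨b, rfl⟩
  obtain ⟨i, hi⟩ := IsAlgClosed.exists_pow_nat_eq (-1 : k) (n := 2) (by norm_num)
  obtain ⟨e⟩ := CDV.ring_equiv k b
  have d1 : IsDomain (MvPowerSeries (Fin 4) k ⧸ Ideal.span {CDV.g1 k (2 * b + 1)}) := by
    rw [Ideal.Quotient.isDomain_iff_prime]
    exact CDV.g1_prime _ hN
  have u1 := CDV.ufd_g1 i hi (2 * b + 1) hN (by omega)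
  have d2 : IsDomain (cDVring k b) := MulEquiv.isDomain _ e.toMulEquiv
  have l2 : IsLocalRing (cDVring k b) :=
    IsLocalRing.of_surjective' (Ideal.Quotient.mk (Ideal.span {cDVeqn k b}))
      Ideal.Quotient.mk_surjective
  refine ⟨l2, ?_, d2, ?_⟩
  · intro _
    exact CDV.complete_quotient _
  · intro _
    exact e.symm.toMulEquiv.uniqueFactorizationMonoid u1
end
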